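/- Assume the Riemann Hypothesis. Then no integer k ≥ 3·10^13 is a P-integer. -/

import Mathlib

open scoped BigOperators

/-- Number of primes not exceeding the real number `x` (so `primePi x = 0` for `x ≤ 1`). -/
noncomputable def primePi (x : ℝ) : ℕ :=
  ((Finset.range (⌊x⌋₊ + 1)).filter Nat.Prime).card

/-- The `n`-th prime, with `nthPrime 1 = 2`, `nthPrime 2 = 3`, etc. -/
noncomputable def nthPrime (n : ℕ) : ℕ := Nat.nth Nat.Prime (n - 1)
/-- The `i`-th (0-indexed) prime not dividing `k`, in increasing order. -/
noncomputable def nthPrimeNotDvd (k i : ℕ) : ℕ := Nat.nth (fun p => p.Prime ∧ ¬ p ∣ k) i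

/-- `k` is a `P`-integer: `k > 1` and the first `φ(k)` primes not dividing `k` are pairwise
incongruent modulo `k` and their residues are exactly the residues coprime to `k`. -/
def IsPInteger (k : ℕ) : Prop :=
  1 < k ∧
  Set.InjOn (fun i => nthPrimeNotDvd k i % k) (Set.Iio k.totient) ∧
  (fun i => nthPrimeNotDvd k i % k) '' Set.Iio k.totient = {r | r < k ∧ Nat.Coprime r k}

section

open Complex Metric Filter Topology
open scoped BigOperators

/-- On a circle of radius `r`, `((z - c) / r) ^ n` has conjugate `(r / (z - c)) ^ n`. -/
theorem conj_div_pow_of_mem_sphere {c z : ℂ} {r : ℝ} (hr : 0 < r) (hz : z ∈ sphere c r) (n : ℕ) :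
    (starRingEnd ℂ) (((z - c) / r) ^ n) = (r / (z - c)) ^ n := by
  have h1 : ‖z - c‖ = r := by simpa [dist_eq] using hz
  have h0 : z - c ≠ 0 := by rw [← norm_pos_iff, h1]; exact hr
  have hr0 : (r : ℂ) ≠ 0 := by exact_mod_cast hr.ne'
  rw [map_pow]
  congr 1
  rw [map_div₀, conj_ofReal, div_eq_div_iff hr0 h0, mul_comm, mul_conj, normSq_eq_norm_sq, h1]
  push_cast; ring

/-- Carathéodory's coefficient bound on a smaller closed disc. -/
theorem norm_coeff_mul_pow_le_of_re_nonneg_aux {f : ℂ → ℂ} {c : ℂ} {r : ℝ} (hr : 0 < r)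
    (hf : DiffContOnCl ℂ f (ball c r)) (hre : ∀ z ∈ sphere c r, 0 ≤ (f z).re)
    {p : FormalMultilinearSeries ℂ ℂ ℂ} (hp : HasFPowerSeriesAt f p c) {n : ℕ} (hn : n ≠ 0) :
    ‖p.coeff n‖ * r ^ n ≤ 2 * (f c).re := by
  have hr' : |r| = r := abs_of_pos hr
  have hr0 : (r : ℂ) ≠ 0 := by exact_mod_cast hr.ne'
  have hcont : ContinuousOn f (sphere c r) :=
    hf.continuousOn.mono (by rw [closure_ball c hr.ne']; exact sphere_subset_closedBall)
  have hne : ∀ z ∈ sphere c r, z - c ≠ 0 := fun z hz => by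
    have h1 : ‖z - c‖ = r := by simpa [dist_eq] using hz
    rw [← norm_pos_iff, h1]; exact hr
  -- the coefficient as a circle average
  have hcoef : p.coeff n * r ^ n = Real.circleAverage (fun z => (r / (z - c)) ^ n * f z) c r := by
    have h1 := (hf.hasFPowerSeriesOnBall (R := ⟨r, hr.le⟩) hr).hasFPowerSeriesAt
    have h2 := hp.eq_formalMultilinearSeries h1
    have h3 := cauchyPowerSeries_apply f c r n (r : ℂ)
    rw [FormalMultilinearSeries.apply_eq_pow_smul_coeff] at h3
    rw [h2, Real.circleAverage_eq_circleIntegral hr.ne', mul_comm]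
    rw [smul_eq_mul] at h3
    erw [h3]
    congr 1
    apply circleIntegral.integral_congr hr.le
    intro z hz
    simp only [smul_eq_mul]; ring
  have hmean : Real.circleAverage (fun z => ((z - c) / r) ^ n * f z) c r = 0 := by
    have hd : DiffContOnCl ℂ (fun z => ((z - c) / r) ^ n * f z) (ball c |r|) := by
      rw [hr']
      have : Differentiable ℂ (fun z : ℂ => ((z - c) / r) ^ n) := by fun_prop
      exact this.diffContOnCl.smul hf
    rw [hd.circleAverage]
    simp [hn]
  have hgint : ∀ g : ℂ → ℂ, ContinuousOn g (sphere c r) → CircleIntegrable g c r :=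
    fun g hg => hg.circleIntegrable hr.le
  have hc1 : ContinuousOn (fun z => ((z - c) / r) ^ n * f z) (sphere c r) := by fun_prop
  have hc2 : ContinuousOn (fun z => (r / (z - c)) ^ n * f z) (sphere c r) := by
    refine ContinuousOn.mul (ContinuousOn.pow (ContinuousOn.div ?_ ?_ hne) n) hcont <;> fun_prop
  have hc3 : ContinuousOn (fun z => (starRingEnd ℂ) (((z - c) / r) ^ n * f z)) (sphere c r) :=
    continuous_conj.comp_continuousOn hc1
  have hconj : Real.circleAverage (fun z => (starRingEnd ℂ) (((z - c) / r) ^ n * f z)) c r = 0 := by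
    have := ContinuousLinearMap.circleAverage_comp_comm (c := c) (R := r)
      ((conjCLE : ℂ ≃L[ℝ] ℂ) : ℂ →L[ℝ] ℂ) (hgint _ hc1)
    rw [hmean] at this
    simpa [Function.comp_def] using this
  have hsum : p.coeff n * r ^ n =
      Real.circleAverage (fun z => (r / (z - c)) ^ n * (2 * (f z).re : ℝ)) c r := by
    rw [hcoef, ← add_zero (Real.circleAverage _ c r), ← hconj,
      ← Real.circleAverage_fun_add (hgint _ hc2) (hgint _ hc3)]
    apply Real.circleAverage_congr_sphere
    intro z hz
    rw [hr'] at hz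
    simp only [map_mul, conj_div_pow_of_mem_sphere hr hz]
    rw [← mul_add, add_conj]
  have hmeanre : Real.circleAverage (fun z => (f z).re) c r = (f c).re := by
    have := ContinuousLinearMap.circleAverage_comp_comm (c := c) (R := r) reCLM (hgint _ hcont)
    rw [DiffContOnCl.circleAverage (by rwa [hr'])] at this
    simpa [Function.comp_def] using this
  have hnorm : ‖p.coeff n * r ^ n‖ ≤ Real.circleAverage (fun z => 2 * (f z).re) c r := by
    rw [hsum, Real.circleAverage_def, Real.circleAverage_def, norm_smul, smul_eq_mul,
      Real.norm_of_nonneg (by positivity)]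
    gcongr
    apply intervalIntegral.norm_integral_le_of_norm_le (by positivity)
    · refine Eventually.of_forall fun θ _ => ?_
      have hz : circleMap c r θ ∈ sphere c r := circleMap_mem_sphere c hr.le θ
      have h1 : ‖circleMap c r θ - c‖ = r := by simpa [dist_eq] using hz
      rw [norm_mul, norm_pow, norm_div, h1, norm_real, norm_real, Real.norm_of_nonneg hr.le,
        div_self hr.ne', one_pow, one_mul, Real.norm_of_nonneg]
      linarith [hre _ hz]
    · have : CircleIntegrable (fun z => 2 * (f z).re) c r := by
        apply ContinuousOn.circleIntegrable hr.le
        exact continuousOn_const.mul (continuous_re.comp_continuousOn hcont)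
      exact this
  rw [norm_mul, norm_pow, norm_real, Real.norm_of_nonneg hr.le] at hnorm
  refine hnorm.trans_eq ?_
  have := Real.circleAverage_fun_smul (f := fun z => (f z).re) (c := c) (R := r) (a := (2 : ℝ))
  simp only [smul_eq_mul] at this
  rw [this, hmeanre]

/-- Carathéodory's bound for the Taylor coefficients of a function with nonnegative real part. -/
theorem norm_coeff_mul_pow_le_of_re_nonneg {f : ℂ → ℂ} {c : ℂ} {R : ℝ} (hR : 0 < R)
    (hf : DifferentiableOn ℂ f (ball c R)) (hre : ∀ z ∈ ball c R, 0 ≤ (f z).re)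
    {p : FormalMultilinearSeries ℂ ℂ ℂ} (hp : HasFPowerSeriesAt f p c) {n : ℕ} (hn : n ≠ 0) :
    ‖p.coeff n‖ * R ^ n ≤ 2 * (f c).re := by
  have ht : Tendsto (fun r : ℝ => ‖p.coeff n‖ * r ^ n) (𝓝[<] R) (𝓝 (‖p.coeff n‖ * R ^ n)) :=
    (Continuous.tendsto (by fun_prop) R).mono_left nhdsWithin_le_nhds
  refine le_of_tendsto ht ?_
  filter_upwards [Ioo_mem_nhdsLT hR] with r hr
  refine norm_coeff_mul_pow_le_of_re_nonneg_aux hr.1 ?_ ?_ hp hn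
  · exact (hf.mono (closedBall_subset_ball hr.2)).diffContOnCl_ball subset_rfl
  · exact fun z hz => hre z (sphere_subset_closedBall.trans (closedBall_subset_ball hr.2) hz)

end

section

open Complex Metric Filter Topology MeasureTheory Set
open scoped BigOperators Nat

theorem integrableOn_pow_mul_exp_neg_mul {y : ℝ} (hy : 0 < y) (m : ℕ) :
    IntegrableOn (fun t : ℝ => t ^ m * Real.exp (-(y * t))) (Ioi 0) := by
  have := integrableOn_rpow_mul_exp_neg_mul_rpow (p := 1) (s := m) (b := y)
    (by have : (0 : ℝ) ≤ m := by positivity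
        linarith) one_pos hy
  simpa [Real.rpow_natCast, neg_mul] using this

theorem integral_pow_mul_exp_neg_mul {y : ℝ} (hy : 0 < y) (m : ℕ) :
    ∫ t in Ioi (0 : ℝ), t ^ m * Real.exp (-(y * t)) = m ! / y ^ (m + 1) := by
  have := Real.integral_rpow_mul_exp_neg_mul_Ioi (a := m + 1) (r := y) (by positivity) hy
  rw [Real.Gamma_nat_eq_factorial] at this
  simp only [add_sub_cancel_right, Real.rpow_natCast] at this
  rw [this, ← Nat.cast_succ, Real.rpow_natCast]
  simp [div_eq_mul_inv, mul_comm]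

/-- The Laplace transform of a function of exponential growth is given by its moments. -/
theorem hasSum_laplace {P : ℝ → ℝ} {A M x : ℝ} (hPm : Measurable P)
    (hPb : ∀ t, 0 < t → |P t| ≤ M * Real.exp (A * t)) {w : ℂ} (hw : ‖w‖ < x - A) :
    HasSum (fun n : ℕ => w ^ n * ((-1) ^ n / n ! *
        (∫ t in Ioi (0 : ℝ), t ^ n * Real.exp (-(x * t)) * P t : ℝ)))
      (∫ t in Ioi (0 : ℝ), P t * cexp (-((x + w) * t))) := by
  have key := hasSum_integral_of_dominated_convergence (μ := volume.restrict (Ioi (0 : ℝ)))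
    (F := fun (n : ℕ) (t : ℝ) => (-(w * t)) ^ n / n ! * (Real.exp (-(x * t)) * P t : ℝ))
    (f := fun t => P t * cexp (-((x + w) * t)))
    (fun n t => (‖w‖ * t) ^ n / n ! * (Real.exp (-(x * t)) * (M * Real.exp (A * t)))) ?_ ?_ ?_ ?_ ?_
  · convert! key using 1
    ext n
    rw [← integral_complex_ofReal, ← integral_const_mul, ← integral_const_mul]
    congr 1
    ext t
    push_cast
    rw [neg_pow (w * t), mul_pow]; ring
  · intro n
    refine (Measurable.mul ?_ ?_).aestronglyMeasurable <;> fun_prop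
  · intro n
    filter_upwards [ae_restrict_mem measurableSet_Ioi] with t ht
    rw [norm_mul, norm_div, norm_pow, norm_neg, norm_mul, norm_real, norm_real, norm_mul,
      Real.norm_of_nonneg (le_of_lt ht), Real.norm_of_nonneg (Real.exp_pos _).le, Complex.norm_natCast]
    have := hPb t ht
    have ht' : (0 : ℝ) < t := ht
    have h0 : 0 ≤ (‖w‖ * t) ^ n / n ! := by positivity
    gcongr
    rwa [Real.norm_eq_abs]
  · refine Eventually.of_forall fun t => ?_
    exact (Real.summable_pow_div_factorial _).mul_right _
  · have h1 : ∀ t : ℝ, ∑' n : ℕ, (‖w‖ * t) ^ n / n ! *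
        (Real.exp (-(x * t)) * (M * Real.exp (A * t))) =
        M * (t ^ 0 * Real.exp (-((x - A - ‖w‖) * t))) := by
      intro t
      rw [tsum_mul_right]
      have := (NormedSpace.expSeries_div_hasSum_exp (‖w‖ * t)).tsum_eq
      rw [this, ← Real.exp_eq_exp_ℝ, mul_left_comm, mul_left_comm _ M, ← Real.exp_add,
        mul_left_comm _ M, ← Real.exp_add, pow_zero, one_mul]
      congr 2; ring
    simp only [h1]
    exact (integrableOn_pow_mul_exp_neg_mul (by linarith) 0).const_mul M
  · refine Eventually.of_forall fun t => ?_
    have h2 := (NormedSpace.expSeries_div_hasSum_exp (-(w * t))).mul_right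
      ((Real.exp (-(x * t)) * P t : ℝ) : ℂ)
    convert! h2 using 1
    rw [← Complex.exp_eq_exp_ℂ, ofReal_mul, ofReal_exp, ← mul_assoc, ← Complex.exp_add, mul_comm]
    push_cast
    congr 2; ring

/-- Bound for the moments of a function whose Laplace transform is a difference of functions with
nonnegative real part in the right half plane. -/
theorem abs_moment_le_of_laplace {P : ℝ → ℝ} {A M x : ℝ} {Q₁ Q₂ : ℂ → ℂ} (hPm : Measurable P)
    (hPb : ∀ t, 0 < t → |P t| ≤ M * Real.exp (A * t)) (hx : 0 < x) (hA : A < x)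
    (hQ₁ : DifferentiableOn ℂ Q₁ {z | 0 < z.re}) (hQ₁' : ∀ z : ℂ, 0 < z.re → 0 ≤ (Q₁ z).re)
    (hQ₂ : DifferentiableOn ℂ Q₂ {z | 0 < z.re}) (hQ₂' : ∀ z : ℂ, 0 < z.re → 0 ≤ (Q₂ z).re)
    (hG : ∀ z : ℂ, A < z.re → ∫ t in Ioi (0 : ℝ), P t * cexp (-(z * t)) = Q₁ z - Q₂ z)
    {n : ℕ} (hn : n ≠ 0) :
    |∫ t in Ioi (0 : ℝ), t ^ n * Real.exp (-(x * t)) * P t| * x ^ n / n ! ≤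
      2 * ((Q₁ x).re + (Q₂ x).re) := by
  have hball : ball (x : ℂ) x ⊆ {z | 0 < z.re} := by
    intro z hz
    rw [mem_ball, dist_eq] at hz
    have := (abs_re_le_norm (z - x)).trans_lt hz
    rw [sub_re, ofReal_re] at this
    have := (abs_lt.1 this).1
    show 0 < z.re
    linarith
  have hopen : IsOpen {z : ℂ | 0 < z.re} := isOpen_lt continuous_const continuous_re
  have han : ∀ {Q : ℂ → ℂ}, DifferentiableOn ℂ Q {z | 0 < z.re} →
      ∃ p, HasFPowerSeriesAt Q p (x : ℂ) := fun {Q} hQ =>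
    hQ.analyticAt (hopen.mem_nhds (by simpa using hx))
  obtain ⟨p₁, hp₁⟩ := han hQ₁
  obtain ⟨p₂, hp₂⟩ := han hQ₂
  have b₁ := norm_coeff_mul_pow_le_of_re_nonneg hx (hQ₁.mono hball)
    (fun z hz => hQ₁' z (hball hz)) hp₁ hn
  have b₂ := norm_coeff_mul_pow_le_of_re_nonneg hx (hQ₂.mono hball)
    (fun z hz => hQ₂' z (hball hz)) hp₂ hn
  have h3 : HasFPowerSeriesAt (fun z => Q₁ z - Q₂ z) (FormalMultilinearSeries.ofScalars ℂ
      (fun n : ℕ => ((-1) ^ n / n ! *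
        (∫ t in Ioi (0 : ℝ), t ^ n * Real.exp (-(x * t)) * P t : ℝ) : ℂ))) (x : ℂ) := by
    rw [hasFPowerSeriesAt_iff]
    have : ball (0 : ℂ) (x - A) ∈ 𝓝 (0 : ℂ) := ball_mem_nhds _ (by linarith)
    filter_upwards [this] with w hw
    rw [mem_ball_zero_iff] at hw
    rw [← hG]
    · simpa [FormalMultilinearSeries.coeff_ofScalars] using hasSum_laplace hPm hPb hw
    · have := (abs_re_le_norm w).trans_lt hw
      have := (abs_lt.1 this).1
      simp; linarith
  have h4 := congrArg (fun p => p.coeff n) (h3.eq_formalMultilinearSeries (hp₁.sub hp₂))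
  have h5 : (p₁ - p₂).coeff n = p₁.coeff n - p₂.coeff n := rfl
  simp only [FormalMultilinearSeries.coeff_ofScalars, h5] at h4
  have h6 := congrArg norm h4
  rw [norm_mul, norm_div, norm_pow, norm_neg, norm_one, one_pow, Complex.norm_natCast, norm_real,
    Real.norm_eq_abs] at h6
  have h7 := norm_sub_le (p₁.coeff n) (p₂.coeff n)
  rw [← h6] at h7
  calc _ = 1 / (n ! : ℝ) * |∫ t in Ioi (0 : ℝ), t ^ n * Real.exp (-(x * t)) * P t| * x ^ n := by ring
    _ ≤ (‖p₁.coeff n‖ + ‖p₂.coeff n‖) * x ^ n := by gcongr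
    _ ≤ _ := by linarith

/-- The Post–Widder inversion formula for bounded functions. -/
theorem tendsto_postWidder {P : ℝ → ℝ} {M u : ℝ} (hPm : Measurable P)
    (hPb : ∀ t, 0 < t → |P t| ≤ M) (hu : 0 < u) (hc : ContinuousAt P u) :
    Tendsto (fun n : ℕ => (n / u) ^ (n + 1) / n ! *
      ∫ t in Ioi (0 : ℝ), t ^ n * Real.exp (-(n / u * t)) * P t) atTop (𝓝 (P u)) := by
  have hM : 0 ≤ M := (abs_nonneg _).trans (hPb u hu)
  -- an explicit estimate
  have main : ∀ ε > 0, ∃ K, ∀ n : ℕ, 0 < n → |(n / u) ^ (n + 1) / n ! *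
      (∫ t in Ioi (0 : ℝ), t ^ n * Real.exp (-(n / u * t)) * P t) - P u| ≤
      ε + K * ((n + 2) / (n : ℝ) ^ 2) := by
    intro ε hε
    obtain ⟨δ, hδ, hδ'⟩ := Metric.continuousAt_iff.1 hc ε hε
    refine ⟨2 * M / δ ^ 2 * u ^ 2, fun n hn => ?_⟩
    have hn' : (0 : ℝ) < n := by exact_mod_cast hn
    set y : ℝ := n / u with hy
    have hy0 : 0 < y := by positivity
    have i0 := integrableOn_pow_mul_exp_neg_mul hy0 n
    have i1 := integrableOn_pow_mul_exp_neg_mul hy0 (n + 1)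
    have i2 := integrableOn_pow_mul_exp_neg_mul hy0 (n + 2)
    have v0 := integral_pow_mul_exp_neg_mul hy0 n
    have v1 := integral_pow_mul_exp_neg_mul hy0 (n + 1)
    have v2 := integral_pow_mul_exp_neg_mul hy0 (n + 2)
    have iP : IntegrableOn (fun t : ℝ => t ^ n * Real.exp (-(y * t)) * P t) (Ioi 0) := by
      refine Integrable.mono' (i0.mul_const M) ?_ ?_
      · exact (Measurable.mul (by fun_prop) hPm).aestronglyMeasurable
      · filter_upwards [ae_restrict_mem measurableSet_Ioi] with t ht
        have ht' : (0 : ℝ) < t := ht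
        rw [norm_mul, Real.norm_of_nonneg (by positivity), Real.norm_eq_abs]
        gcongr
        exact hPb t ht
    set c : ℝ := y ^ (n + 1) / n ! with hcdef
    have hc0 : 0 < c := by positivity
    have e1 : c * (∫ t in Ioi (0 : ℝ), t ^ n * Real.exp (-(y * t)) * P t) - P u =
        c * ∫ t in Ioi (0 : ℝ), t ^ n * Real.exp (-(y * t)) * (P t - P u) := by
      simp only [mul_sub]
      rw [integral_sub iP (i0.mul_const _), integral_mul_const, v0, mul_sub, hcdef]
      field_simp
    rw [e1, abs_mul, abs_of_pos hc0]
    have i3 : IntegrableOn (fun t : ℝ => t ^ (n + 2) * Real.exp (-(y * t)) -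
        2 * u * (t ^ (n + 1) * Real.exp (-(y * t)))) (Ioi 0) := i2.sub (i1.const_mul (2 * u))
    have i4 : IntegrableOn (fun t : ℝ => t ^ (n + 2) * Real.exp (-(y * t)) -
        2 * u * (t ^ (n + 1) * Real.exp (-(y * t))) + u ^ 2 * (t ^ n * Real.exp (-(y * t))))
        (Ioi 0) := i3.add (i0.const_mul (u ^ 2))
    have ib : IntegrableOn (fun t : ℝ => ε * (t ^ n * Real.exp (-(y * t))) + 2 * M / δ ^ 2 *
        ((t ^ (n + 2) * Real.exp (-(y * t)) - 2 * u * (t ^ (n + 1) * Real.exp (-(y * t))))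
          + u ^ 2 * (t ^ n * Real.exp (-(y * t))))) (Ioi 0) :=
      (i0.const_mul ε).add (i4.const_mul _)
    have e2 : |∫ t in Ioi (0 : ℝ), t ^ n * Real.exp (-(y * t)) * (P t - P u)| ≤
        ∫ t in Ioi (0 : ℝ), (ε * (t ^ n * Real.exp (-(y * t))) + 2 * M / δ ^ 2 *
        ((t ^ (n + 2) * Real.exp (-(y * t)) - 2 * u * (t ^ (n + 1) * Real.exp (-(y * t))))
          + u ^ 2 * (t ^ n * Real.exp (-(y * t))))) := by
      rw [← Real.norm_eq_abs]
      refine norm_integral_le_of_norm_le ib ?_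
      filter_upwards [ae_restrict_mem measurableSet_Ioi] with t ht
      have ht' : (0 : ℝ) < t := ht
      have hker : 0 ≤ t ^ n * Real.exp (-(y * t)) := by positivity
      rw [norm_mul, Real.norm_of_nonneg hker, Real.norm_eq_abs]
      have hd : |P t - P u| ≤ ε + 2 * M / δ ^ 2 * (t - u) ^ 2 := by
        by_cases h : |t - u| < δ
        · have := hδ' (x := t) (by rwa [Real.dist_eq])
          rw [Real.dist_eq] at this
          have h2 : 0 ≤ 2 * M / δ ^ 2 * (t - u) ^ 2 := by positivity
          linarith
        · have h1 : δ ^ 2 ≤ (t - u) ^ 2 := by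
            rw [← sq_abs (t - u)]; push Not at h; gcongr
          have h2 : 2 * M ≤ 2 * M / δ ^ 2 * (t - u) ^ 2 := by
            rw [div_mul_eq_mul_div, le_div_iff₀ (by positivity)]
            gcongr
          have := abs_sub (P t) (P u)
          linarith [hPb t ht, hPb u hu]
      calc _ ≤ t ^ n * Real.exp (-(y * t)) * (ε + 2 * M / δ ^ 2 * (t - u) ^ 2) := by gcongr
        _ = _ := by ring
    refine (mul_le_mul_of_nonneg_left e2 hc0.le).trans_eq ?_
    rw [integral_add (i0.const_mul ε) (i4.const_mul _), integral_const_mul, integral_const_mul,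
      integral_add i3 (i0.const_mul (u ^ 2)),
      integral_sub i2 (i1.const_mul (2 * u)), integral_const_mul, integral_const_mul, v0, v1, v2,
      hcdef, Nat.factorial_succ (n + 1), Nat.factorial_succ n]
    push_cast
    have e3 : y ^ (n + 1) / n ! * (ε * (n ! / y ^ (n + 1)) + 2 * M / δ ^ 2 *
        ((n + 1 + 1) * ((n + 1) * n !) / y ^ (n + 2 + 1) -
          2 * u * ((n + 1) * n ! / y ^ (n + 1 + 1)) + u ^ 2 * (n ! / y ^ (n + 1)))) =
        ε + 2 * M / δ ^ 2 * ((n + 2) * (n + 1) / y ^ 2 - 2 * u * ((n + 1) / y) + u ^ 2) := by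
      field_simp
      ring
    rw [e3, hy]
    field_simp
    ring
  rw [Metric.tendsto_atTop]
  intro ε hε
  obtain ⟨K, hK⟩ := main (ε / 2) (by positivity)
  have hlim : Tendsto (fun n : ℕ => K * (((n : ℝ) + 2) / (n : ℝ) ^ 2)) atTop (𝓝 0) := by
    have h1 : Tendsto (fun n : ℕ => K * (1 / (n : ℝ) + 2 * (1 / (n : ℝ)) ^ 2)) atTop
        (𝓝 (K * (0 + 2 * 0 ^ 2))) :=
      ((tendsto_one_div_atTop_nhds_zero_nat).add
        ((tendsto_one_div_atTop_nhds_zero_nat.pow 2).const_mul 2)).const_mul K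
    simp only [ne_eq, OfNat.ofNat_ne_zero, not_false_eq_true, zero_pow, mul_zero, add_zero] at h1
    refine h1.congr' ?_
    filter_upwards [eventually_gt_atTop 0] with n hn
    have : (n : ℝ) ≠ 0 := by positivity
    field_simp
  obtain ⟨N, hN⟩ := ((hlim.eventually (gt_mem_nhds (show (0 : ℝ) < ε / 2 by positivity))).and
    (eventually_gt_atTop 0)).exists_forall_of_atTop
  refine ⟨N, fun n hn => ?_⟩
  obtain ⟨h1, h2⟩ := hN n hn
  rw [Real.dist_eq]
  linarith [hK n h2]

/-- A function whose Laplace transform is a difference of functions with nonnegative real part in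
the right half plane is bounded by the growth of these functions along the real axis. -/
theorem abs_le_of_laplace {P : ℝ → ℝ} {A M B : ℝ} {Q₁ Q₂ : ℂ → ℂ} (hPm : Measurable P)
    (hPb : ∀ t, 0 < t → |P t| ≤ M * Real.exp (A * t)) (hA : 0 ≤ A)
    (hQ₁ : DifferentiableOn ℂ Q₁ {z | 0 < z.re}) (hQ₁' : ∀ z : ℂ, 0 < z.re → 0 ≤ (Q₁ z).re)
    (hQ₂ : DifferentiableOn ℂ Q₂ {z | 0 < z.re}) (hQ₂' : ∀ z : ℂ, 0 < z.re → 0 ≤ (Q₂ z).re)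
    (hG : ∀ z : ℂ, A < z.re → ∫ t in Ioi (0 : ℝ), P t * cexp (-(z * t)) = Q₁ z - Q₂ z)
    (hB : ∀ᶠ x : ℝ in atTop, x * ((Q₁ x).re + (Q₂ x).re) ≤ B)
    {u : ℝ} (hu : 0 < u) (hc : ContinuousAt P u) : |P u| ≤ 2 * B := by
  have hw := tendsto_postWidder (P := fun t => P t * Real.exp (-(A * t))) (M := M) (u := u)
    (hPm.mul (by fun_prop)) (fun t ht => by
      rw [abs_mul, abs_of_pos (Real.exp_pos _)]
      calc _ ≤ M * Real.exp (A * t) * Real.exp (-(A * t)) := by gcongr; exact hPb t ht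
        _ = M := by rw [mul_assoc, ← Real.exp_add]; simp)
    hu (hc.mul (Continuous.continuousAt (by fun_prop)))
  have hE : Tendsto (fun n : ℕ => (1 + A * u / n) ^ (n + 1)) atTop (𝓝 (Real.exp (A * u))) := by
    have h1 := Real.tendsto_one_add_div_pow_exp (A * u)
    have h2 : Tendsto (fun n : ℕ => 1 + A * u / n) atTop (𝓝 (1 + 0)) :=
      tendsto_const_nhds.add (tendsto_const_div_atTop_nhds_zero_nat _)
    have := h1.mul h2
    simpa [pow_succ] using this
  have hlim := (hw.abs.mul hE)
  have hval : |P u * Real.exp (-(A * u))| * Real.exp (A * u) = |P u| := by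
    rw [abs_mul, abs_of_pos (Real.exp_pos _), mul_assoc, ← Real.exp_add]; simp
  rw [hval] at hlim
  refine le_of_tendsto hlim ?_
  have hxt : Tendsto (fun n : ℕ => (n : ℝ) / u + A) atTop atTop :=
    tendsto_atTop_add_const_right _ _ (tendsto_natCast_atTop_atTop.atTop_div_const hu)
  filter_upwards [hxt.eventually hB, eventually_gt_atTop 0] with n hn hn0
  have hn' : (0 : ℝ) < n := by exact_mod_cast hn0
  set x : ℝ := n / u + A with hx
  have hx0 : 0 < x := by positivity
  have hm := abs_moment_le_of_laplace hPm hPb hx0 (by have : 0 < n / u := by positivity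
                                                      linarith) hQ₁ hQ₁' hQ₂ hQ₂' hG hn0.ne'
  have e : ∀ t : ℝ, t ^ n * Real.exp (-(n / u * t)) * (P t * Real.exp (-(A * t))) =
      t ^ n * Real.exp (-(x * t)) * P t := by
    intro t
    rw [hx, add_mul, neg_add, Real.exp_add]; ring
  simp only [e]
  rw [abs_mul, abs_of_nonneg (by positivity)]
  have e2 : ((n : ℝ) / u) ^ (n + 1) * (1 + A * u / n) ^ (n + 1) = x ^ (n + 1) := by
    rw [← mul_pow, hx]
    congr 1
    field_simp
  calc _ = (((n : ℝ) / u) ^ (n + 1) * (1 + A * u / n) ^ (n + 1)) / n ! *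
        |∫ t in Ioi (0 : ℝ), t ^ n * Real.exp (-(x * t)) * P t| := by ring
    _ = x * (|∫ t in Ioi (0 : ℝ), t ^ n * Real.exp (-(x * t)) * P t| * x ^ n / n !) := by
      rw [e2, pow_succ]; ring
    _ ≤ x * (2 * ((Q₁ x).re + (Q₂ x).re)) := by gcongr
    _ ≤ 2 * B := by linarith

end

section

open Complex Metric Filter Topology MeasureTheory Set
open scoped BigOperators Nat ComplexConjugate

theorem isOpen_re_pos : IsOpen {z : ℂ | 0 < z.re} := isOpen_lt continuous_const continuous_re

theorem re_one_add_div_one_sub (w : ℂ) :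
    ((1 + w) / (1 - w)).re = (1 - ‖w‖ ^ 2) / ‖1 - w‖ ^ 2 := by
  rw [div_re, ← add_div, normSq_eq_norm_sq]
  congr 1
  rw [← normSq_eq_norm_sq, normSq_apply]
  simp; ring

/-- The Cayley transform of the right half plane centred at `1/2`. -/
theorem norm_cayley_lt_one {z : ℂ} (hz : 0 < z.re) : ‖(2 * z - 1) / (2 * z + 1)‖ < 1 := by
  have h : 2 * z + 1 ≠ 0 := fun h => by
    have := congrArg re h
    simp at this; linarith
  rw [norm_div, div_lt_one (norm_pos_iff.2 h), ← sq_lt_sq₀ (norm_nonneg _) (norm_nonneg _),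
    ← normSq_eq_norm_sq, ← normSq_eq_norm_sq, normSq_apply, normSq_apply]
  simp; nlinarith

theorem re_pos_inv_cayley {w : ℂ} (hw : ‖w‖ < 1) : 0 < ((1 + w) / (2 * (1 - w))).re := by
  have h : (1 + w) / (2 * (1 - w)) = ((1 / 2 : ℝ) : ℂ) * ((1 + w) / (1 - w)) := by
    push_cast; rw [div_mul_div_comm, one_mul]
  rw [h, re_ofReal_mul, re_one_add_div_one_sub]
  have : 1 - w ≠ 0 := fun h => by
    rw [← sub_eq_zero.1 h] at hw; simp at hw
  have h1 : 0 < ‖1 - w‖ := norm_pos_iff.2 this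
  have : 0 < 1 - ‖w‖ ^ 2 := by nlinarith [norm_nonneg w]
  positivity

/-- Positivity of the real part of `(1 - w) (1 - ν) / (1 - w ν)` on the bidisc. -/
theorem re_bidisc_nonneg {w ν : ℂ} (hw : ‖w‖ < 1) (hν : ‖ν‖ ≤ 1) :
    0 ≤ ((1 - w) * (1 - ν) / (1 - w * ν)).re := by
  by_cases h1 : ν = 1
  · simp [h1]
  have hν1 : 1 - ν ≠ 0 := sub_ne_zero.2 (Ne.symm h1)
  have hw1 : 1 - w ≠ 0 := fun h => by rw [← sub_eq_zero.1 h] at hw; simp at hw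
  have ha : 0 < ((1 + w) / (1 - w)).re := by
    rw [re_one_add_div_one_sub]
    have : 0 < ‖1 - w‖ := norm_pos_iff.2 hw1
    have : 0 < 1 - ‖w‖ ^ 2 := by nlinarith [norm_nonneg w]
    positivity
  have hc : 0 ≤ ((1 + ν) / (1 - ν)).re := by
    rw [re_one_add_div_one_sub]
    have : 0 < ‖1 - ν‖ := norm_pos_iff.2 hν1
    have : 0 ≤ 1 - ‖ν‖ ^ 2 := by nlinarith [norm_nonneg ν]
    positivity
  have hd : 1 - w * ν ≠ 0 := by
    intro h
    have := congrArg norm (sub_eq_zero.1 h)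
    rw [norm_one, norm_mul] at this
    nlinarith [norm_nonneg w, norm_nonneg ν]
  have key : (1 - w) * (1 - ν) / (1 - w * ν) =
      ((2 : ℝ) : ℂ) * ((1 + w) / (1 - w) + (1 + ν) / (1 - ν))⁻¹ := by
    rw [div_add_div _ _ hw1 hν1, inv_div]
    have : (1 + w) * (1 - ν) + (1 - w) * (1 + ν) = 2 * (1 - w * ν) := by ring
    rw [this]; push_cast; field_simp
  rw [key, re_ofReal_mul, inv_re, add_re]
  have := normSq_nonneg ((1 + w) / (1 - w) + (1 + ν) / (1 - ν))
  positivity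

/-- Division of a positive real function by `1/4 - z^2` after removal of the poles. -/
theorem exists_regularization {H : ℂ → ℂ} {b : ℝ} (hb : 0 < b)
    (hH : DifferentiableOn ℂ H {z | 0 < z.re}) (hre : ∀ z : ℂ, 0 < z.re → 0 ≤ (H z).re)
    (hHb : H (1 / 2) = b) :
    ∃ Q : ℂ → ℂ, DifferentiableOn ℂ Q {z | 0 < z.re} ∧ (∀ z : ℂ, 0 < z.re → 0 ≤ (Q z).re) ∧
      ∀ z : ℂ, 0 < z.re → (1 / 4 - z ^ 2) * Q z = H z - 2 * z * b := by
  set g : ℂ → ℂ := fun w => (H ((1 + w) / (2 * (1 - w))) - b) / (H ((1 + w) / (2 * (1 - w))) + b)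
    with hg
  have hden : ∀ z : ℂ, 0 < z.re → H z + b ≠ 0 := fun z hz h => by
    have := congrArg re h
    simp at this
    linarith [hre z hz]
  have h1w : ∀ w ∈ ball (0 : ℂ) 1, 1 - w ≠ 0 := fun w hw h => by
    rw [mem_ball_zero_iff, ← sub_eq_zero.1 h] at hw; simp at hw
  have hgd : DifferentiableOn ℂ g (ball 0 1) := by
    have hmaps : MapsTo (fun w : ℂ => (1 + w) / (2 * (1 - w))) (ball 0 1) {z | 0 < z.re} :=
      fun w hw => re_pos_inv_cayley (by simpa using hw)
    have hC : DifferentiableOn ℂ (fun w : ℂ => (1 + w) / (2 * (1 - w))) (ball 0 1) := by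
      refine DifferentiableOn.div (by fun_prop) (by fun_prop) ?_
      exact fun w hw => mul_ne_zero two_ne_zero (h1w w hw)
    have := hH.comp hC hmaps
    refine DifferentiableOn.div (this.sub_const _) (this.add_const _) ?_
    exact fun w hw => hden _ (hmaps hw)
  have hg0 : g 0 = 0 := by simp [hg, ← hHb]
  have hgm : MapsTo g (ball 0 1) (closedBall (g 0) 1) := by
    intro w hw
    rw [hg0, mem_closedBall_zero_iff]
    have hz := re_pos_inv_cayley (w := w) (by simpa using hw)
    simp only [hg]
    rw [norm_div, div_le_one (norm_pos_iff.2 (hden _ hz)),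
      ← sq_le_sq₀ (norm_nonneg _) (norm_nonneg _),
      ← normSq_eq_norm_sq, ← normSq_eq_norm_sq, normSq_apply, normSq_apply]
    have := hre _ hz
    simp only [sub_re, sub_im, add_re, add_im, ofReal_re, ofReal_im]
    nlinarith
  set ν : ℂ → ℂ := dslope g 0
  have hνn : ∀ w ∈ ball (0 : ℂ) 1, ‖ν w‖ ≤ 1 := fun w hw => by
    simpa using norm_dslope_le_div_of_mapsTo_ball hgd hgm hw
  have hνd : DifferentiableOn ℂ ν (ball 0 1) :=
    (differentiableOn_dslope (ball_mem_nhds _ one_pos)).2 hgd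
  have hνe : ∀ w, w * ν w = g w := fun w => by
    have := sub_smul_dslope g 0 w
    simpa [hg0] using this
  set C : ℂ → ℂ := fun z => (2 * z - 1) / (2 * z + 1)
  have hC1 : ∀ z : ℂ, 0 < z.re → 2 * z + 1 ≠ 0 := fun z hz h => by
    have := congrArg re h
    simp at this; linarith
  have hCb : ∀ z : ℂ, 0 < z.re → C z ∈ ball (0 : ℂ) 1 := fun z hz => by
    rw [mem_ball_zero_iff]; exact norm_cayley_lt_one hz
  have hCd : DifferentiableOn ℂ C {z | 0 < z.re} :=
    DifferentiableOn.div (by fun_prop) (by fun_prop) hC1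
  have hνC : DifferentiableOn ℂ (fun z => ν (C z)) {z | 0 < z.re} := hνd.comp hCd hCb
  have hne : ∀ z : ℂ, 0 < z.re → 1 - C z * ν (C z) ≠ 0 := fun z hz h => by
    have h2 := congrArg norm (sub_eq_zero.1 h)
    rw [norm_one, norm_mul] at h2
    have h3 := hνn _ (hCb z hz)
    have h4 := norm_cayley_lt_one hz
    nlinarith [norm_nonneg (C z), norm_nonneg (ν (C z))]
  refine ⟨fun z => ((2 * b : ℝ) : ℂ) * ((1 - C z) * (1 - ν (C z)) / (1 - C z * ν (C z))),
    ?_, ?_, ?_⟩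
  · refine DifferentiableOn.const_mul (DifferentiableOn.div ?_ ?_ hne) _
    · exact (hCd.const_sub 1).mul (hνC.const_sub 1)
    · exact (hCd.mul hνC).const_sub 1
  · intro z hz
    rw [re_ofReal_mul]
    have := re_bidisc_nonneg (norm_cayley_lt_one hz) (hνn _ (hCb z hz))
    positivity
  · intro z hz
    have hz1 := hC1 z hz
    have hd := hden z hz
    have hCz : (1 + C z) / (2 * (1 - C z)) = z := by
      have e1 : 1 + C z = 4 * z / (2 * z + 1) := by simp only [C]; field_simp; ring
      have e2 : 1 - C z = 2 / (2 * z + 1) := by simp only [C]; field_simp; ring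
      rw [e1, e2, ← mul_div_assoc, div_div_div_cancel_right₀ hz1]; ring
    have hval : C z * ν (C z) = (H z - b) / (H z + b) := by
      rw [hνe]; simp only [hg, hCz]
    have hne' := hne z hz
    beta_reduce
    rw [hval] at hne' ⊢
    have hb' : (b : ℂ) ≠ 0 := by exact_mod_cast hb.ne'
    have hD : 1 - (H z - b) / (H z + b) = 2 * b / (H z + b) := by field_simp; ring
    have e5 : C z * (2 * z + 1) = 2 * z - 1 := by simp only [C]; field_simp
    have e3 : (1 / 4 - z ^ 2) * (1 - C z) = -(C z) * (2 * z + 1) / 2 := by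
      have e2 : 1 - C z = 2 / (2 * z + 1) := by simp only [C]; field_simp; ring
      rw [neg_mul, e5, e2, ← mul_div_assoc, div_eq_iff hz1]; ring
    have e4 : (1 / 4 - z ^ 2) * ((1 - C z) * (1 - ν (C z))) =
        ((H z - b) / (H z + b)) * (2 * z + 1) / 2 - (2 * z - 1) / 2 := by
      rw [← hval, ← mul_assoc, e3, ← e5]; ring
    rw [hD, mul_left_comm, ← mul_div_assoc, e4]
    push_cast
    field_simp
    ring

/-- The real part of the regularization on the real axis. -/
theorem mul_re_regularization_le {H Q : ℂ → ℂ} {b x : ℝ} (hx : 1 / 2 < x)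
    (hre : 0 ≤ (H x).re) (hQ : (1 / 4 - (x : ℂ) ^ 2) * Q x = H x - 2 * x * b) :
    x * (Q x).re ≤ 2 * b * x ^ 2 / (x ^ 2 - 1 / 4) := by
  have h : ((1 / 4 - x ^ 2 : ℝ) : ℂ) * Q x = H x - ((2 * x * b : ℝ) : ℂ) := by
    push_cast; exact hQ
  have h2 := congrArg re h
  rw [re_ofReal_mul, sub_re, ofReal_re] at h2
  have hpos : 0 < x ^ 2 - 1 / 4 := by nlinarith
  rw [le_div_iff₀ hpos]
  nlinarith

end

section

open Complex Metric Filter Topology MeasureTheory Set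
open scoped BigOperators Nat ComplexConjugate

/-- The entire Riemann `ξ` function (normalised so that `ξ 0 = ξ 1 = 1`). -/
noncomputable def riemannXi (s : ℂ) : ℂ := s * (s - 1) * completedRiemannZeta₀ s + 1

theorem differentiable_riemannXi : Differentiable ℂ riemannXi :=
  ((differentiable_id.mul (differentiable_id.sub_const 1)).mul
    differentiable_completedZeta₀).add_const 1

theorem riemannXi_one_sub (s : ℂ) : riemannXi (1 - s) = riemannXi s := by
  rw [riemannXi, riemannXi, completedRiemannZeta₀_one_sub]; ring

theorem riemannXi_one : riemannXi 1 = 1 := by simp [riemannXi]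

theorem riemannXi_eq {s : ℂ} (hs : 0 < s.re) (hs1 : s ≠ 1) :
    riemannXi s = s * (s - 1) * (Gammaℝ s * riemannZeta s) := by
  have h0 : s ≠ 0 := fun h => by simp [h] at hs
  rw [riemannZeta_def_of_ne_zero h0, mul_div_cancel₀ _ (Gammaℝ_ne_zero_of_re_pos hs),
    completedRiemannZeta_eq, riemannXi]
  have : 1 - s ≠ 0 := sub_ne_zero.2 hs1.symm
  field_simp
  ring

theorem riemannXi_ne_zero (hRH : RiemannHypothesis) {s : ℂ} (hs : 1 / 2 < s.re) :
    riemannXi s ≠ 0 := by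
  by_cases h1 : s = 1
  · simp [h1, riemannXi_one]
  have h0 : s ≠ 0 := fun h => by rw [h] at hs; norm_num at hs
  rw [riemannXi_eq (by linarith) h1]
  refine mul_ne_zero (mul_ne_zero h0 (sub_ne_zero.2 h1))
    (mul_ne_zero (Gammaℝ_ne_zero_of_re_pos (by linarith)) fun hz => ?_)
  refine hs.ne' (hRH s hz ?_ h1)
  rintro ⟨n, rfl⟩
  have : ((-2 * ((n : ℂ) + 1)).re) = -2 * ((n : ℝ) + 1) := by simp
  rw [this] at hs
  have : (0 : ℝ) ≤ n := n.cast_nonneg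
  linarith

theorem norm_Gammaℝ_conj (s : ℂ) : ‖Gammaℝ (conj s)‖ = ‖Gammaℝ s‖ := by
  rw [Gammaℝ_def, Gammaℝ_def, norm_mul, norm_mul]
  congr 1
  · rw [norm_cpow_eq_rpow_re_of_pos Real.pi_pos, norm_cpow_eq_rpow_re_of_pos Real.pi_pos]
    simp
  · have : conj s / 2 = conj (s / 2) := by rw [map_div₀, conj_ofNat]
    rw [this, Gamma_conj, norm_conj]

theorem norm_riemannXi_conj {s : ℂ} (hs : 0 < s.re) : ‖riemannXi (conj s)‖ = ‖riemannXi s‖ := by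
  by_cases h1 : s = 1
  · simp [h1]
  have h1' : conj s ≠ 1 := fun h => h1 (by simpa using congrArg conj h)
  have hc : conj s - 1 = conj (s - 1) := by simp
  rw [riemannXi_eq hs h1, riemannXi_eq (by simpa using hs) h1', riemannZeta_conj, hc]
  simp only [norm_mul, norm_conj, norm_Gammaℝ_conj]

theorem exists_norm_completedRiemannZeta₀_le :
    ∃ B, ∀ s : ℂ, 0 ≤ s.re → s.re ≤ 6 → ‖completedRiemannZeta₀ s‖ ≤ B := by
  set f : ℝ → ℂ := (HurwitzZeta.hurwitzEvenFEPair 0).f_modif with hf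
  have hconv : ∀ s : ℂ, MellinConvergent f s := fun s =>
    ((HurwitzZeta.hurwitzEvenFEPair 0).isStrongFEPair_toStrongFEPair.hasMellin s).1
  have h0 := (hconv 0).norm
  have h3 := (hconv 3).norm
  refine ⟨(∫ t in Ioi (0 : ℝ), (‖(t : ℂ) ^ ((0 : ℂ) - 1) • f t‖ +
    ‖(t : ℂ) ^ ((3 : ℂ) - 1) • f t‖)) / 2, fun s hs0 hs6 => ?_⟩
  change ‖mellin f (s / 2) / 2‖ ≤ _
  rw [norm_div, mellin]
  simp only [RCLike.norm_ofNat]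
  gcongr
  refine norm_integral_le_of_norm_le (h0.add h3) ?_
  filter_upwards [ae_restrict_mem measurableSet_Ioi] with t ht
  have ht : 0 < t := ht
  simp only [norm_smul, norm_cpow_eq_rpow_re_of_pos ht]
  rw [← add_mul]
  gcongr
  have e : (s / 2).re = s.re / 2 := by simp
  simp only [sub_re, e, zero_re, one_re, re_ofNat]
  rcases le_total t 1 with h | h
  · have := Real.rpow_le_rpow_of_exponent_ge ht h (show (0:ℝ) - 1 ≤ s.re / 2 - 1 by linarith)
    exact this.trans (le_add_of_nonneg_right (Real.rpow_nonneg ht.le _))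
  · have := Real.rpow_le_rpow_of_exponent_le h (show s.re / 2 - 1 ≤ (3:ℝ) - 1 by linarith)
    exact this.trans (le_add_of_nonneg_left (Real.rpow_nonneg ht.le _))

/-- A lower bound for a nonvanishing function on a disc, from the Borel-Carathéodory theorem. -/
theorem norm_ge_of_ne_zero_on_ball {f : ℂ → ℂ} {c : ℂ} {R M ρ : ℝ} (hρR : ρ < R) (hM : 0 < M)
    (hf : DifferentiableOn ℂ f (ball c R)) (h0 : ∀ z ∈ ball c R, f z ≠ 0)
    (hb : ∀ z ∈ ball c R, ‖f z‖ ≤ ‖f c‖ * Real.exp M) {z : ℂ} (hz : ‖z - c‖ ≤ ρ) :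
    ‖f c‖ * Real.exp (-(2 * M * ρ / (R - ρ))) ≤ ‖f z‖ := by
  have hρ : 0 ≤ ρ := (norm_nonneg _).trans hz
  have hR : 0 < R := by linarith
  have hc : c ∈ ball c R := mem_ball_self hR
  have hzR : z ∈ ball c R := by rw [mem_ball, dist_eq_norm]; linarith
  have hfd : ∀ z ∈ ball c R, DifferentiableAt ℂ f z := fun z hz =>
    hf.differentiableAt (isOpen_ball.mem_nhds hz)
  obtain ⟨g, hg⟩ : IsExactOn (fun z => deriv f z / f z) (ball c R) :=
    ((hf.deriv isOpen_ball).div hf h0).isExactOn_ball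
  have key : ∀ z ∈ ball c R, f z = f c * cexp (g z - g c) := by
    have hconst : ∀ z ∈ ball c R, HasDerivAt (fun z => f z * cexp (-g z)) 0 z := by
      intro z hz
      have := (hfd z hz).hasDerivAt.mul ((hg z hz).neg.cexp)
      refine this.congr_deriv ?_
      have e : deriv f z * cexp (-g z) + f z * (cexp (-g z) * -(deriv f z / f z)) = 0 := by
        linear_combination -(cexp (-g z)) * mul_div_cancel₀ (deriv f z) (h0 z hz)
      exact e
    intro z hz
    have := (convex_ball c R).is_const_of_fderivWithin_eq_zero (𝕜 := ℂ)
      (fun z hz => (hconst z hz).differentiableAt.differentiableWithinAt)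
      (fun z hz => by
        rw [fderivWithin_of_isOpen isOpen_ball hz]
        ext; simp [(hconst z hz).deriv]) hz hc
    have e := congrArg (· * cexp (g z)) this
    simp only [mul_assoc, ← Complex.exp_add] at e
    rw [neg_add_cancel, Complex.exp_zero, mul_one] at e
    rw [e]; ring_nf
  have hfc : 0 < ‖f c‖ := norm_pos_iff.2 (h0 c hc)
  have hshift : ∀ w ∈ ball (0:ℂ) R, c + w ∈ ball c R := by
    intro w hw; simpa [dist_eq_norm] using hw
  have bc := Complex.borelCaratheodory_zero (f := fun w => g (c + w) - g c) (z := z - c) (R := R) hM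
    (fun w hw => (((hg _ (hshift w hw)).differentiableAt.comp w
      (by fun_prop : DifferentiableAt ℂ (fun w => c + w) w)).sub_const _).differentiableWithinAt)
    (fun w hw => by
      have h1 := hb _ (hshift w hw)
      rw [key _ (hshift w hw), norm_mul, norm_exp] at h1
      exact Real.exp_le_exp.1 (le_of_mul_le_mul_left h1 hfc)) hR
    (by rw [mem_ball_zero_iff]; linarith) (by simp)
  rw [key z hzR, norm_mul, norm_exp]
  gcongr
  have h2 : ‖g z - g c‖ ≤ 2 * M * ρ / (R - ρ) := by
    simp only [add_sub_cancel] at bc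
    refine bc.trans ?_
    have : 0 < R - ρ := by linarith
    gcongr
  have := (abs_re_le_norm (g z - g c)).trans h2
  exact (abs_le.1 this).1

end

section

open Complex Metric Filter Topology MeasureTheory Set
open scoped BigOperators Nat ComplexConjugate

theorem norm_Gamma_mul_Gamma_le {w : ℂ} {u h : ℝ} (hu : 0 < u) (hw : u ≤ w.re) (hh : 0 < h) :
    ‖Gamma w‖ * ‖Gamma ((u + h : ℝ) : ℂ)‖ ≤ ‖Gamma (w + h)‖ * ‖Gamma (u : ℂ)‖ := by
  have hw0 : 0 < w.re := hu.trans_le hw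
  have hh' : 0 < (h : ℂ).re := by simpa
  have hu' : 0 < (u : ℂ).re := by simpa
  have e1 := congrArg norm (Gamma_mul_Gamma_eq_betaIntegral hw0 hh')
  have e2 := congrArg norm (Gamma_mul_Gamma_eq_betaIntegral hu' hh')
  rw [norm_mul, norm_mul] at e1 e2
  have hle : ‖betaIntegral w h‖ ≤ ‖betaIntegral u h‖ := by
    have hr : betaIntegral u h = ((∫ x in (0:ℝ)..1, x ^ (u - 1) * (1 - x) ^ (h - 1) : ℝ) : ℂ) := by
      rw [betaIntegral, ← intervalIntegral.integral_ofReal]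
      refine intervalIntegral.integral_congr fun x hx => ?_
      rw [uIcc_of_le zero_le_one] at hx
      have : 0 ≤ 1 - x := by linarith [hx.2]
      push_cast
      rw [ofReal_cpow hx.1, ofReal_cpow this]
      push_cast; rfl
    have hgint : IntervalIntegrable (fun x : ℝ => x ^ (u - 1) * (1 - x) ^ (h - 1)) volume 0 1 := by
      have := (betaIntegral_convergent hu' hh').norm
      refine this.congr_ae ?_
      rw [uIoc_of_le zero_le_one]
      refine (ae_restrict_iff' measurableSet_Ioc).2 ?_
      filter_upwards [(measure_singleton (1:ℝ) : volume {(1:ℝ)} = 0) |> compl_mem_ae_iff.2] with x hx1 hx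
      have h1 : 0 < 1 - x := by
        have := lt_of_le_of_ne hx.2 hx1
        linarith
      have e : (1 - (x:ℂ)) = ((1 - x : ℝ) : ℂ) := by push_cast; rfl
      rw [norm_mul, e, norm_cpow_eq_rpow_re_of_pos hx.1, norm_cpow_eq_rpow_re_of_pos h1]
      simp
    refine le_trans ?_ ((le_abs_self _).trans_eq (by rw [hr, norm_real, Real.norm_eq_abs]))
    rw [betaIntegral]
    refine intervalIntegral.norm_integral_le_of_norm_le zero_le_one ?_ hgint
    filter_upwards [(measure_singleton (1:ℝ) : volume {(1:ℝ)} = 0) |> compl_mem_ae_iff.2] with x hx1 hx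
    have h1 : 0 < 1 - x := by
      have := lt_of_le_of_ne hx.2 hx1
      linarith
    have e : (1 - (x:ℂ)) = ((1 - x : ℝ) : ℂ) := by push_cast; rfl
    rw [norm_mul, e, norm_cpow_eq_rpow_re_of_pos hx.1, norm_cpow_eq_rpow_re_of_pos h1]
    simp only [sub_re, one_re, ofReal_re]
    refine mul_le_mul_of_nonneg_right ?_ (Real.rpow_nonneg h1.le _)
    exact Real.rpow_le_rpow_of_exponent_ge hx.1 hx.2 (by linarith)
  have hG : 0 < ‖Gamma (h : ℂ)‖ := norm_pos_iff.2 (Gamma_ne_zero_of_re_pos hh')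
  refine le_of_mul_le_mul_right ?_ hG
  push_cast
  calc ‖Gamma w‖ * ‖Gamma (u + h)‖ * ‖Gamma (h : ℂ)‖
      = ‖Gamma (u + h)‖ * (‖Gamma w‖ * ‖Gamma (h : ℂ)‖) := by ring
    _ = ‖Gamma (u + h)‖ * (‖Gamma (w + h)‖ * ‖betaIntegral w h‖) := by rw [e1]
    _ ≤ ‖Gamma (u + h)‖ * (‖Gamma (w + h)‖ * ‖betaIntegral u h‖) := by gcongr
    _ = ‖Gamma (w + h)‖ * (‖Gamma (u + h)‖ * ‖betaIntegral u h‖) := by ring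
    _ = _ := by rw [← e2]; ring

/-- Comparing logarithmic derivatives through ratios of absolute values. -/
theorem re_div_le_re_div_of_norm_le {F G : ℂ → ℂ} {a b F' G' : ℂ} {ε : ℝ} (hε : 0 < ε)
    (hF : HasDerivAt F F' a) (hG : HasDerivAt G G' b) (hFa : F a ≠ 0) (hGb : G b ≠ 0)
    (h : ∀ t : ℝ, 0 < t → t ≤ ε → ‖F a‖ * ‖G (b + t)‖ ≤ ‖F (a + t)‖ * ‖G b‖) :
    (G' / G b).re ≤ (F' / F a).re := by
  have hd : ∀ {K : ℂ → ℂ} {K' c : ℂ}, HasDerivAt K K' c →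
      HasDerivAt (fun t : ℝ => ‖K (c + t)‖ ^ 2) (2 * ((K' / K c).re * ‖K c‖ ^ 2)) 0 := by
    intro K K' c hK
    have h1 : HasDerivAt (fun t : ℝ => K (c + t)) K' 0 := by
      have h2 : HasDerivAt (fun t : ℝ => c + (t : ℂ)) 1 0 :=
        (HasDerivAt.ofReal_comp (hasDerivAt_id (0:ℝ))).const_add c |>.congr_deriv (by simp)
      have hK' : HasDerivAt K K' (c + ((0 : ℝ) : ℂ)) := by simpa using hK
      exact (hK'.comp (0:ℝ) h2).congr_deriv (mul_one K')
    refine h1.norm_sq.congr_deriv ?_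
    rw [Complex.inner]
    simp only [ofReal_zero, add_zero]
    by_cases hc : K c = 0
    · simp [hc]
    congr 1
    rw [← re_mul_ofReal, ofReal_pow, ← mul_conj']
    congr 1
    field_simp
  have hq : HasDerivAt (fun t : ℝ => ‖F (a + t)‖ ^ 2 * ‖G b‖ ^ 2 - ‖F a‖ ^ 2 * ‖G (b + t)‖ ^ 2)
      (2 * ((F' / F a).re * ‖F a‖ ^ 2) * ‖G b‖ ^ 2 - ‖F a‖ ^ 2 * (2 * ((G' / G b).re * ‖G b‖ ^ 2)))
      0 := ((hd hF).mul_const _).sub ((hd hG).const_mul _)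
  have hnn := hq.tendsto_slope_zero_right
  have h0 : 0 ≤ 2 * ((F' / F a).re * ‖F a‖ ^ 2) * ‖G b‖ ^ 2 -
      ‖F a‖ ^ 2 * (2 * ((G' / G b).re * ‖G b‖ ^ 2)) := by
    refine ge_of_tendsto hnn ?_
    filter_upwards [Ioc_mem_nhdsGT hε] with t ht
    have := h t ht.1 ht.2
    have h2 : (‖F a‖ * ‖G (b + t)‖) ^ 2 ≤ (‖F (a + t)‖ * ‖G b‖) ^ 2 := by gcongr
    simp only [zero_add, smul_eq_mul, ofReal_zero, add_zero, sub_self, sub_zero]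
    refine mul_nonneg (inv_nonneg.2 ht.1.le) ?_
    nlinarith [h2]
  have hp : 0 < ‖F a‖ ^ 2 * ‖G b‖ ^ 2 := by
    have := norm_pos_iff.2 hFa
    have := norm_pos_iff.2 hGb
    positivity
  by_contra! hlt
  nlinarith [mul_lt_mul_of_pos_right hlt hp]

theorem re_digamma_ge {w : ℂ} {u : ℝ} (hu : 0 < u) (hw : u ≤ w.re) :
    (digamma u).re ≤ (digamma w).re := by
  have hd : ∀ {z : ℂ}, 0 < z.re → HasDerivAt Gamma (deriv Gamma z) z := fun {z} hz =>
    (differentiableAt_Gamma z fun m h => by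
      have := congrArg re h
      simp at this
      have h2 : (0:ℝ) ≤ m := m.cast_nonneg
      linarith).hasDerivAt
  have hu' : 0 < (u : ℂ).re := by simpa
  have hw' : 0 < w.re := hu.trans_le hw
  rw [digamma_def, logDeriv_apply, logDeriv_apply]
  refine re_div_le_re_div_of_norm_le one_pos (hd hw') (hd hu') (Gamma_ne_zero_of_re_pos hw')
    (Gamma_ne_zero_of_re_pos hu') fun t ht _ => ?_
  have := norm_Gamma_mul_Gamma_le hu hw ht
  push_cast at this
  exact this

end

section

open Complex Metric Filter Topology MeasureTheory Set
open scoped BigOperators Nat ComplexConjugate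

theorem norm_sin_le_exp_abs_im (z : ℂ) : ‖Complex.sin z‖ ≤ Real.exp |z.im| := by
  have h : Complex.sin z = (cexp (-z * I) - cexp (z * I)) * I / 2 := rfl
  rw [h, norm_div, norm_mul, norm_I, mul_one, RCLike.norm_ofNat, div_le_iff₀ (by norm_num)]
  refine (norm_sub_le _ _).trans ?_
  rw [norm_exp, norm_exp]
  have h1 : Real.exp ((-z * I).re) ≤ Real.exp |z.im| := Real.exp_le_exp.2 (by simp [le_abs_self])
  have h2 : Real.exp ((z * I).re) ≤ Real.exp |z.im| := Real.exp_le_exp.2 (by simp [neg_le_abs])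
  linarith

theorem norm_Gamma_half_add_mul_I_ge (y : ℝ) :
    Real.exp (-(Real.pi * |y|)) ≤ ‖Gamma (1 / 2 + y * I)‖ := by
  have e := congrArg norm (Gamma_mul_Gamma_one_sub (1 / 2 + y * I))
  have e1 : (1 - (1 / 2 + y * I) : ℂ) = conj (1 / 2 + y * I : ℂ) := by
    apply Complex.ext <;> simp; norm_num
  rw [e1, Gamma_conj, norm_mul, norm_conj, norm_div, norm_real, Real.norm_eq_abs,
    abs_of_pos Real.pi_pos] at e
  have hG : 0 < ‖Gamma (1 / 2 + y * I)‖ := norm_pos_iff.2 (Gamma_ne_zero_of_re_pos (by simp))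
  have hs := norm_sin_le_exp_abs_im (Real.pi * (1 / 2 + y * I))
  have him : ((Real.pi : ℂ) * (1 / 2 + y * I)).im = Real.pi * y := by simp
  rw [him, abs_mul, abs_of_pos Real.pi_pos] at hs
  have hsp : 0 < ‖Complex.sin (Real.pi * (1 / 2 + y * I))‖ := by
    rcases (norm_nonneg (Complex.sin (Real.pi * (1 / 2 + y * I)))).eq_or_lt with h | h
    · rw [← h, div_zero] at e; nlinarith
    · exact h
  have hge : Real.exp (-(Real.pi * |y|)) ≤ ‖Gamma (1 / 2 + y * I)‖ ^ 2 := by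
    rw [sq, e, Real.exp_neg, ← one_div, div_le_div_iff₀ (Real.exp_pos _) hsp, one_mul]
    have := Real.pi_gt_three
    nlinarith [Real.exp_pos (Real.pi * |y|)]
  have hle1 : Real.exp (-(Real.pi * |y|)) ≤ 1 := Real.exp_le_one_iff.2 (by
    have := Real.pi_pos; have := abs_nonneg y; nlinarith [mul_nonneg Real.pi_pos.le (abs_nonneg y)])
  have hp := Real.exp_pos (-(Real.pi * |y|))
  nlinarith

theorem norm_riemannZeta_le {s : ℂ} {σ : ℝ} (hσ : 1 < σ) (hs : σ ≤ s.re) :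
    ‖riemannZeta s‖ ≤ ∑' n : ℕ, 1 / ((n : ℝ) + 1) ^ σ := by
  rw [zeta_eq_tsum_one_div_nat_add_one_cpow (hσ.trans_le hs)]
  have hsum : Summable fun n : ℕ => 1 / ((n : ℝ) + 1) ^ σ := by
    have := (summable_nat_add_iff 1).2 (Real.summable_one_div_nat_rpow.2 hσ)
    simpa using this
  refine tsum_of_norm_bounded hsum.hasSum fun n => ?_
  have e : ((n : ℂ) + 1) = ((n + 1 : ℝ) : ℂ) := by push_cast; rfl
  have hn : (0 : ℝ) < n + 1 := by positivity
  rw [norm_div, norm_one, e, norm_cpow_eq_rpow_re_of_pos hn]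
  gcongr
  linarith [(n.cast_nonneg : (0:ℝ) ≤ n)]

theorem norm_riemannZeta_ge {s : ℂ} (hs : 2 ≤ s.re) : 1 / 4 ≤ ‖riemannZeta s‖ := by
  have h1 : HasSum (fun n : ℕ => 1 / ((n : ℝ) + 1 + 1) ^ 2) (Real.pi ^ 2 / 6 - 1) := by
    have := (hasSum_nat_add_iff' 2).2 hasSum_zeta_two
    simp [Finset.sum_range_succ] at this
    refine this.congr_fun fun n => ?_
    rw [one_div, add_assoc, one_add_one_eq_two]
  have hz := zeta_eq_tsum_one_div_nat_add_one_cpow (s := s) (by linarith)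
  have hsum : Summable fun n : ℕ => 1 / ((n : ℂ) + 1) ^ s := by
    have := (summable_nat_add_iff 1).2 (Complex.summable_one_div_nat_cpow.2 (by linarith : 1 < s.re))
    simpa using this
  rw [hsum.tsum_eq_zero_add] at hz
  have hb : ‖∑' n : ℕ, 1 / (((n + 1 : ℕ) : ℂ) + 1) ^ s‖ ≤ Real.pi ^ 2 / 6 - 1 := by
    refine tsum_of_norm_bounded h1 fun n => ?_
    have e : (((n + 1 : ℕ) : ℂ) + 1) = ((n + 1 + 1 : ℝ) : ℂ) := by push_cast; rfl
    have hn : (0 : ℝ) < n + 1 + 1 := by positivity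
    rw [norm_div, norm_one, e, norm_cpow_eq_rpow_re_of_pos hn, ← Real.rpow_natCast]
    gcongr
    · linarith [(n.cast_nonneg : (0:ℝ) ≤ n)]
    · exact_mod_cast hs
  have h3 : ‖riemannZeta s‖ ≥ 1 - (Real.pi ^ 2 / 6 - 1) := by
    rw [hz]
    have := norm_sub_le_norm_add (1 / (((0:ℕ) : ℂ) + 1) ^ s)
      (∑' n : ℕ, 1 / (((n + 1 : ℕ) : ℂ) + 1) ^ s)
    simp only [Nat.cast_zero, zero_add, one_cpow, div_one, norm_one] at this ⊢
    linarith
  have := Real.pi_lt_d2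
  have := Real.pi_pos
  nlinarith

/-- `ξ` is bounded below exponentially on the line `Re s = 3`. -/
theorem norm_riemannXi_three_add_mul_I_ge (T : ℝ) :
    1 / 64 * Real.exp (-(2 * |T|)) ≤ ‖riemannXi (3 + T * I)‖ := by
  have hre : (3 + T * I : ℂ).re = 3 := by simp
  rw [riemannXi_eq (by rw [hre]; norm_num) (fun h => by
    have := congrArg re h; rw [hre] at this; norm_num at this), Gammaℝ_def]
  have e : (3 + T * I : ℂ) / 2 = (1 / 2 + (T / 2 : ℝ) * I) + 1 := by push_cast; ring
  have hne : (1 / 2 + (T / 2 : ℝ) * I : ℂ) ≠ 0 := fun h => by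
    have := congrArg re h; simp at this
  rw [e, Gamma_add_one _ hne]
  simp only [norm_mul]
  have h1 : 3 ≤ ‖(3 + T * I : ℂ)‖ := by
    have := abs_re_le_norm (3 + T * I : ℂ); rw [hre] at this; simpa using this
  have h2 : 2 ≤ ‖(3 + T * I - 1 : ℂ)‖ := by
    have := abs_re_le_norm (3 + T * I - 1 : ℂ); rw [sub_re, hre] at this; norm_num at this; exact this
  have h3 : 1 / 2 ≤ ‖(1 / 2 + (T / 2 : ℝ) * I : ℂ)‖ := by
    have := abs_re_le_norm (1 / 2 + (T / 2 : ℝ) * I : ℂ); simp at this; simpa using this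
  have h4 := norm_Gamma_half_add_mul_I_ge (T / 2)
  have h5 : 1 / 4 ≤ ‖riemannZeta (3 + T * I)‖ := norm_riemannZeta_ge (by rw [hre]; norm_num)
  have h6 : 1 / 16 ≤ ‖(Real.pi : ℂ) ^ (-(3 + T * I : ℂ) / 2)‖ := by
    rw [norm_cpow_eq_rpow_re_of_pos Real.pi_pos]
    have e : (-(3 + T * I : ℂ) / 2).re = -(3 / 2) := by simp; norm_num
    rw [e, Real.rpow_neg Real.pi_pos.le, ← one_div]
    refine one_div_le_one_div_of_le (by have := Real.pi_pos; positivity) ?_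
    calc Real.pi ^ (3 / 2 : ℝ) ≤ Real.pi ^ (2 : ℝ) :=
          Real.rpow_le_rpow_of_exponent_le (by linarith [Real.pi_gt_three]) (by norm_num)
      _ = Real.pi ^ 2 := by norm_cast
      _ ≤ 16 := by nlinarith [Real.pi_lt_four, Real.pi_pos]
  have h7 : Real.exp (-(2 * |T|)) ≤ Real.exp (-(Real.pi * |T / 2|)) := by
    apply Real.exp_le_exp.2
    rw [abs_div, abs_two]
    have := abs_nonneg T
    nlinarith [Real.pi_lt_four]
  have h8 := h7.trans h4
  have hE := Real.exp_pos (-(2 * |T|))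
  calc 1 / 64 * Real.exp (-(2 * |T|))
      ≤ 3 * 2 * ((1 / 16) * (1 / 2 * Real.exp (-(2 * |T|))) * (1 / 4)) := by nlinarith
    _ ≤ _ := by gcongr

end

section

open Complex Metric Filter Topology MeasureTheory Set Asymptotics
open scoped BigOperators Nat ComplexConjugate

theorem exists_norm_riemannXi_le :
    ∃ B, 1 ≤ B ∧ ∀ s : ℂ, 0 ≤ s.re → s.re ≤ 6 → ‖riemannXi s‖ ≤ B * Real.exp (2 * ‖s‖) := by
  obtain ⟨B, hB⟩ := exists_norm_completedRiemannZeta₀_le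
  have hB0 : 0 ≤ B := (norm_nonneg _).trans (hB 0 (by simp) (by simp))
  refine ⟨B + 1, by linarith, fun s h0 h6 => ?_⟩
  have h1 : ‖s - 1‖ ≤ ‖s‖ + 1 := by simpa using norm_sub_le s 1
  have h2 : 1 + ‖s‖ ≤ Real.exp ‖s‖ := by linarith [Real.add_one_le_exp ‖s‖]
  have h3 : Real.exp (2 * ‖s‖) = Real.exp ‖s‖ * Real.exp ‖s‖ := by rw [← Real.exp_add]; ring_nf
  have h4 : 1 ≤ Real.exp (2 * ‖s‖) := Real.one_le_exp (by positivity)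
  have h5 : ‖s‖ * ‖s - 1‖ ≤ Real.exp (2 * ‖s‖) := by
    rw [h3]; have := norm_nonneg s; gcongr <;> linarith
  calc ‖riemannXi s‖ ≤ ‖s * (s - 1) * completedRiemannZeta₀ s‖ + ‖(1 : ℂ)‖ := norm_add_le _ _
    _ ≤ Real.exp (2 * ‖s‖) * B + 1 := by
        rw [norm_mul, norm_mul, norm_one]
        have := hB s h0 h6
        gcongr
    _ ≤ _ := by nlinarith

theorem exists_norm_riemannXi_ratio_le {h : ℝ} (hh : 0 < h) (hh' : h ≤ 1 / 4) :
    ∃ K, ∀ s : ℂ, 2 - h ≤ s.re → ‖riemannXi (s - h) / riemannXi (s + h)‖ ≤ K := by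
  set K₁ : ℝ := ∑' n : ℕ, 1 / ((n : ℝ) + 1) ^ (3 / 2 : ℝ)
  set K₂ : ℝ := ‖Gamma ((3 / 4 : ℝ) : ℂ)‖ / ‖Gamma ((3 / 4 + h : ℝ) : ℂ)‖
  refine ⟨Real.pi ^ h * K₂ * (4 * K₁), fun s hs => ?_⟩
  have hr1 : (s - h).re = s.re - h := by simp
  have hr2 : (s + h).re = s.re + h := by simp
  have hn1 : s - h ≠ 1 := fun h => by rw [h, one_re] at hr1; linarith
  have hn2 : s + h ≠ 1 := fun h => by rw [h, one_re] at hr2; linarith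
  rw [riemannXi_eq (by rw [hr1]; linarith) hn1, riemannXi_eq (by rw [hr2]; linarith) hn2]
  have hcmp : ∀ a b : ℂ, |a.re| ≤ |b.re| → a.im = b.im → ‖a‖ ≤ ‖b‖ := by
    intro a b h1 h2
    rw [← sq_le_sq₀ (norm_nonneg _) (norm_nonneg _), ← normSq_eq_norm_sq, ← normSq_eq_norm_sq,
      normSq_apply, normSq_apply, h2]
    have := sq_le_sq.2 h1
    nlinarith
  have hA : ‖s - h‖ ≤ ‖s + h‖ := hcmp _ _ (by
    rw [hr1, hr2, abs_of_nonneg (by linarith), abs_of_nonneg (by linarith)]; linarith) (by simp)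
  have hB : ‖s - h - 1‖ ≤ ‖s + h - 1‖ := hcmp _ _ (by
    rw [sub_re (s - h), sub_re (s + h), hr1, hr2, one_re, abs_of_nonneg (by linarith), abs_of_nonneg (by linarith)]
    linarith) (by simp)
  have hA0 : 0 < ‖s + h‖ := by
    have := abs_re_le_norm (s + h)
    rw [hr2, abs_of_nonneg (by linarith)] at this; linarith
  have hB0 : 0 < ‖s + h - 1‖ := norm_pos_iff.2 (sub_ne_zero.2 hn2)
  have hG0 : 0 < ‖Gamma ((3 / 4 + h : ℝ) : ℂ)‖ :=
    norm_pos_iff.2 (Gamma_ne_zero_of_re_pos (by rw [ofReal_re]; linarith))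
  have hG : ‖Gammaℝ (s - h)‖ ≤ Real.pi ^ h * K₂ * ‖Gammaℝ (s + h)‖ := by
    rw [Gammaℝ_def, Gammaℝ_def, norm_mul, norm_mul]
    have h1 := norm_Gamma_mul_Gamma_le (w := (s - h) / 2) (u := 3 / 4) (h := h) (by norm_num)
      (by have : ((s - h) / 2).re = (s - h).re / 2 := by simp
          rw [this, hr1]; linarith) hh
    have e : (s - h) / 2 + h = (s + h) / 2 := by ring
    rw [e] at h1
    have h2 : ‖Gamma ((s - h) / 2)‖ ≤ K₂ * ‖Gamma ((s + h) / 2)‖ := by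
      rw [div_mul_eq_mul_div, le_div_iff₀ hG0]; linarith
    have h3 : ‖(Real.pi : ℂ) ^ (-(s - h) / 2)‖ = Real.pi ^ h * ‖(Real.pi : ℂ) ^ (-(s + h) / 2)‖ := by
      rw [norm_cpow_eq_rpow_re_of_pos Real.pi_pos, norm_cpow_eq_rpow_re_of_pos Real.pi_pos,
        ← Real.rpow_add Real.pi_pos]
      congr 1
      simp; ring
    rw [h3]
    calc _ ≤ Real.pi ^ h * ‖(Real.pi : ℂ) ^ (-(s + h) / 2)‖ * (K₂ * ‖Gamma ((s + h) / 2)‖) := by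
          gcongr
      _ = _ := by ring
  have hGp : 0 < ‖Gammaℝ (s + h)‖ :=
    norm_pos_iff.2 (Gammaℝ_ne_zero_of_re_pos (by rw [hr2]; linarith))
  have hZ1 : ‖riemannZeta (s - h)‖ ≤ K₁ :=
    norm_riemannZeta_le (by norm_num) (by rw [hr1]; linarith)
  have hZ2 : 1 / 4 ≤ ‖riemannZeta (s + h)‖ := norm_riemannZeta_ge (by rw [hr2]; linarith)
  have hK1 : 0 ≤ K₁ := (norm_nonneg _).trans hZ1
  have hK2 : 0 ≤ K₂ := by positivity
  have hpi := Real.rpow_pos_of_pos Real.pi_pos h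
  rw [norm_div]
  simp only [norm_mul]
  rw [div_le_iff₀ (by positivity)]
  calc ‖s - h‖ * ‖s - h - 1‖ * (‖Gammaℝ (s - h)‖ * ‖riemannZeta (s - h)‖)
      ≤ ‖s + h‖ * ‖s + h - 1‖ * ((Real.pi ^ h * K₂ * ‖Gammaℝ (s + h)‖) *
          (K₁ * (4 * ‖riemannZeta (s + h)‖))) := by
        gcongr
        nlinarith
    _ = _ := by ring

theorem exists_norm_riemannXi_ratio_le_exp (hRH : RiemannHypothesis) {h : ℝ} (hh : 0 < h)
    (hh' : h ≤ 1 / 4) : ∃ K, ∀ s : ℂ, 1 / 2 ≤ s.re → s.re ≤ 2 - h →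
      ‖riemannXi (s - h) / riemannXi (s + h)‖ ≤ Real.exp (K * (1 + ‖s‖)) := by
  obtain ⟨B, hB1, hB⟩ := exists_norm_riemannXi_le
  have hB0 : 0 < B := by linarith
  set L := Real.log B
  have hL : 0 ≤ L := Real.log_nonneg hB1
  have hBL : B = Real.exp L := (Real.exp_log hB0).symm
  have h64 : (1 / 64 : ℝ) = Real.exp (-Real.log 64) := by
    rw [Real.exp_neg, Real.exp_log (by norm_num)]; norm_num
  have hl64 : 0 ≤ Real.log 64 := Real.log_nonneg (by norm_num)
  set Λ := Real.log 64
  refine ⟨L + 3 + Λ + 2 + 10 * (16 + L + Λ) / h, fun s hs1 hs2 => ?_⟩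
  set T := s.im
  have hT : |T| ≤ ‖s‖ := abs_im_le_norm s
  have hN := norm_nonneg s
  set c : ℂ := 3 + T * I with hc
  have hcre : c.re = 3 := by simp [hc]
  have hcim : c.im = T := by simp [hc]
  have hcn : ‖c‖ ≤ 3 + |T| := by
    have := norm_le_abs_re_add_abs_im c
    rw [hcre, hcim] at this; simpa using this
  set M := 11 + 4 * |T| + L + Λ with hM
  have hMp : 0 < M := by have := abs_nonneg T; linarith
  have hlow := norm_riemannXi_three_add_mul_I_ge T
  rw [← hc] at hlow
  have hball : ∀ z ∈ ball c (5 / 2), 1 / 2 < z.re ∧ z.re ≤ 6 ∧ ‖z‖ ≤ ‖c‖ + 5 / 2 := by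
    intro z hz
    rw [mem_ball, dist_eq_norm] at hz
    have h1 := abs_le.1 ((abs_re_le_norm (z - c)).trans hz.le)
    have h1' := abs_lt.1 ((abs_re_le_norm (z - c)).trans_lt hz)
    rw [sub_re, hcre] at h1 h1'
    have h2 : ‖z‖ ≤ ‖z - c‖ + ‖c‖ := by simpa using norm_add_le (z - c) c
    exact ⟨by linarith, by linarith, by linarith⟩
  have hw := norm_ge_of_ne_zero_on_ball (f := riemannXi) (c := c) (R := 5 / 2) (M := M)
    (ρ := 5 / 2 - h) (by linarith) hMp differentiable_riemannXi.differentiableOn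
    (fun z hz => riemannXi_ne_zero hRH (hball z hz).1)
    (fun z hz => by
      obtain ⟨h1, h2, h3⟩ := hball z hz
      refine (hB z (by linarith) h2).trans ?_
      calc B * Real.exp (2 * ‖z‖) ≤ Real.exp L * Real.exp (11 + 2 * |T|) := by
            rw [hBL]; gcongr; linarith
        _ = 1 / 64 * Real.exp (-(2 * |T|)) * Real.exp M := by
            rw [h64, ← Real.exp_add, ← Real.exp_add, ← Real.exp_add, hM]; congr 1; ring
        _ ≤ _ := by gcongr) (z := s + h) (by
      have e : s + h - c = ((s.re + h - 3 : ℝ) : ℂ) := by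
        apply Complex.ext <;> simp [hcre, hcim, T]
      rw [e, norm_real, Real.norm_eq_abs, abs_le]
      constructor <;> linarith)
  have hden : Real.exp (-Λ - 2 * |T| - 5 * M / h) ≤ ‖riemannXi (s + h)‖ := by
    refine le_trans ?_ hw
    calc Real.exp (-Λ - 2 * |T| - 5 * M / h)
        ≤ 1 / 64 * Real.exp (-(2 * |T|)) *
          Real.exp (-(2 * M * (5 / 2 - h) / (5 / 2 - (5 / 2 - h)))) := by
          rw [h64, ← Real.exp_add, ← Real.exp_add]
          apply Real.exp_le_exp.2
          have : 2 * M * (5 / 2 - h) / (5 / 2 - (5 / 2 - h)) ≤ 5 * M / h := by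
            rw [sub_sub_cancel]
            apply div_le_div_of_nonneg_right _ hh.le
            nlinarith
          linarith
      _ ≤ _ := by gcongr
  have hnum : ‖riemannXi (s - h)‖ ≤ Real.exp (L + 2 * ‖s‖ + 1) := by
    refine (hB (s - h) (by simp; linarith) (by simp; linarith)).trans ?_
    rw [hBL, ← Real.exp_add]
    apply Real.exp_le_exp.2
    have : ‖s - h‖ ≤ ‖s‖ + h := by
      have := norm_sub_le s h; rwa [norm_real, Real.norm_eq_abs, abs_of_pos hh] at this
    linarith
  rw [norm_div, div_le_iff₀ ((Real.exp_pos _).trans_le hden)]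
  refine hnum.trans ?_
  refine le_trans ?_ (mul_le_mul_of_nonneg_left hden (Real.exp_pos _).le)
  rw [← Real.exp_add]
  apply Real.exp_le_exp.2
  have hM2 : 5 * M / h ≤ 10 * (16 + L + Λ) / h * (1 + ‖s‖) := by
    rw [div_mul_eq_mul_div]
    apply div_le_div_of_nonneg_right _ hh.le
    nlinarith
  nlinarith

theorem norm_riemannXi_sub_le (hRH : RiemannHypothesis) {h : ℝ} (hh : 0 < h) (hh' : h ≤ 1 / 4)
    {s : ℂ} (hs : 1 / 2 ≤ s.re) : ‖riemannXi (s - h)‖ ≤ ‖riemannXi (s + h)‖ := by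
  obtain ⟨K, hK⟩ := exists_norm_riemannXi_ratio_le hh hh'
  obtain ⟨K', hK'⟩ := exists_norm_riemannXi_ratio_le_exp hRH hh hh'
  set f : ℂ → ℂ := fun z => riemannXi (1 / 2 + z - h) / riemannXi (1 / 2 + z + h) with hf
  have hne : ∀ z : ℂ, -h < z.re → riemannXi (1 / 2 + z + h) ≠ 0 := fun z hz =>
    riemannXi_ne_zero hRH (by simp; linarith)
  have hd : DiffContOnCl ℂ f {z | 0 < z.re} := by
    refine DifferentiableOn.diffContOnCl fun z hz => ?_
    have hz0 : 0 ≤ z.re := by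
      rw [show {z : ℂ | 0 < z.re} = {z : ℂ | (0:ℝ) < z.re} from rfl, closure_setOfPred_lt_re] at hz
      exact hz
    refine DifferentiableAt.differentiableWithinAt ?_
    have hx := differentiable_riemannXi
    exact ((hx _).comp z (by fun_prop)).div ((hx _).comp z (by fun_prop)) (hne z (by linarith))
  have hbd : ∀ z : ℂ, 0 ≤ z.re → ‖f z‖ ≤ max K 1 * Real.exp (|K'| * (2 + ‖z‖)) := by
    intro z hz
    have hre : (1 / 2 + z).re = 1 / 2 + z.re := by simp
    have h1 : 1 ≤ Real.exp (|K'| * (2 + ‖z‖)) := Real.one_le_exp (by positivity)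
    have h2 : 1 ≤ max K 1 := le_max_right _ _
    rcases le_total (2 - h) (1 / 2 + z).re with hc | hc
    · have := hK _ hc
      have h3 := le_max_left K 1
      calc ‖f z‖ ≤ max K 1 := this.trans h3
        _ ≤ _ := le_mul_of_one_le_right (by linarith) h1
    · refine (hK' _ (by rw [hre]; linarith) hc).trans ?_
      refine le_trans ?_ (le_mul_of_one_le_left (Real.exp_pos _).le h2)
      apply Real.exp_le_exp.2
      have : ‖1 / 2 + z‖ ≤ 1 + ‖z‖ := by
        refine (norm_add_le _ _).trans ?_
        norm_num
      have h0 : 0 ≤ 1 + ‖1 / 2 + z‖ := by positivity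
      calc K' * (1 + ‖1 / 2 + z‖) ≤ |K'| * (1 + ‖1 / 2 + z‖) := by gcongr; exact le_abs_self _
        _ ≤ _ := mul_le_mul_of_nonneg_left (by linarith) (abs_nonneg _)
  have him : ∀ x : ℝ, ‖f (x * I)‖ ≤ 1 := by
    intro x
    have e : (1 / 2 + x * I - h : ℂ) = 1 - conj (1 / 2 + x * I + h : ℂ) := by
      apply Complex.ext
      · simp; norm_num
        ring
      · simp
    have h2 : ‖riemannXi (1 / 2 + x * I - h)‖ = ‖riemannXi (1 / 2 + x * I + h)‖ := by
      rw [e, riemannXi_one_sub, norm_riemannXi_conj (by simp; linarith)]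
    rw [hf, norm_div, h2]
    exact div_self_le_one _
  have := PhragmenLindelof.right_half_plane_of_bounded_on_real hd
    ⟨1, by norm_num, |K'|, IsBigO.of_bound (max K 1 * Real.exp (|K'| * 2)) ?_⟩
    ⟨K, ?_⟩ him (z := s - 1 / 2) (by simp; linarith)
  · rw [hf] at this
    simp only [add_sub_cancel] at this
    rw [norm_div] at this
    exact (div_le_one (norm_pos_iff.2 (riemannXi_ne_zero hRH (by simp; linarith)))).1 this
  · refine eventually_inf_principal.2 (Eventually.of_forall fun z hz => ?_)
    refine (hbd z (le_of_lt hz)).trans_eq ?_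
    rw [Real.norm_eq_abs, abs_of_pos (Real.exp_pos _), mul_assoc, ← Real.exp_add, Real.rpow_one]
    ring_nf
  · refine eventually_map.2 ?_
    filter_upwards [eventually_ge_atTop (2:ℝ)] with x hx
    exact hK _ (by simp; linarith)

/-- Under the Riemann hypothesis `ξ'/ξ` has nonnegative real part right of the critical line. -/
theorem re_deriv_riemannXi_div_nonneg (hRH : RiemannHypothesis) {s : ℂ} (hs : 1 / 2 < s.re) :
    0 ≤ (deriv riemannXi s / riemannXi s).re := by
  have hd := (differentiable_riemannXi s).hasDerivAt
  have hd' : HasDerivAt (fun z => riemannXi (2 * s - z)) (-deriv riemannXi s) s := by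
    have h1 : HasDerivAt riemannXi (deriv riemannXi s) (2 * s - s) := by
      rwa [show 2 * s - s = s by ring]
    exact (h1.comp_const_sub (2 * s) s)
  have e : 2 * s - s = s := by ring
  have hne := riemannXi_ne_zero hRH hs
  have := re_div_le_re_div_of_norm_le (ε := 1 / 4) (by norm_num) hd hd' hne (by rw [e]; exact hne)
    fun t ht ht' => by
      have e2 : 2 * s - (s + t) = s - t := by ring
      rw [e, e2, mul_comm]
      exact mul_le_mul_of_nonneg_right (norm_riemannXi_sub_le hRH ht ht' hs.le) (norm_nonneg _)
  beta_reduce at this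
  rw [e, neg_div, neg_re] at this
  linarith

end

section

open Complex Metric Filter Topology MeasureTheory Set Asymptotics
open scoped BigOperators Nat ComplexConjugate

theorem deriv_riemannXi_one :
    deriv riemannXi 1 = ((Real.eulerMascheroniConstant - Real.log (4 * Real.pi)) / 2 + 1 : ℝ) := by
  have h : HasDerivAt riemannXi ((1 * (1 - 1) + 1 * 1) * completedRiemannZeta₀ 1 +
      1 * (1 - 1) * deriv completedRiemannZeta₀ 1) 1 :=
    ((((hasDerivAt_id (1:ℂ)).mul ((hasDerivAt_id (1:ℂ)).sub_const 1)).mul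
      (differentiable_completedZeta₀ 1).hasDerivAt).add_const 1)
  rw [h.deriv, completedRiemannZeta₀_one]
  push_cast [ofReal_log (by positivity : 0 ≤ 4 * Real.pi)]
  ring

theorem digamma_add_nat {s : ℂ} (hs : 0 < s.re) (n : ℕ) :
    digamma (s + n) = digamma s + ∑ j ∈ Finset.range n, 1 / (s + j) := by
  induction n with
  | zero => simp
  | succ n ih =>
    rw [Finset.sum_range_succ, ← add_assoc, ← ih]
    push_cast
    rw [← add_assoc, digamma_apply_add_one, one_div]
    intro m h
    have := congrArg re h
    simp at this
    have h1 : (0:ℝ) ≤ n := n.cast_nonneg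
    have h2 : (0:ℝ) ≤ m := m.cast_nonneg
    linarith

theorem digamma_ten : digamma 10 =
    ((∑ j ∈ Finset.range 9, 1 / (1 + (j : ℝ)) - Real.eulerMascheroniConstant : ℝ) : ℂ) := by
  have h := digamma_add_nat (s := 1) (by simp) 9
  rw [digamma_one] at h
  have e : (1 : ℂ) + (9 : ℕ) = 10 := by norm_num
  rw [e] at h
  rw [h]
  push_cast
  ring

theorem digamma_ten_add_half : digamma (10 + 1 / 2) =
    ((∑ j ∈ Finset.range 10, 1 / (1 / 2 + (j : ℝ)) - 2 * Real.log 2 -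
      Real.eulerMascheroniConstant : ℝ) : ℂ) := by
  have h := digamma_add_nat (s := 1 / 2) (by simp) 10
  rw [digamma_one_half] at h
  have e : (1 / 2 : ℂ) + (10 : ℕ) = 10 + 1 / 2 := by push_cast; ring
  rw [e] at h
  rw [h]
  push_cast [ofReal_log (by norm_num : (0:ℝ) ≤ 2)]
  ring

theorem differentiableOn_digamma : DifferentiableOn ℂ digamma {z | 0 < z.re} := by
  have hd : DifferentiableOn ℂ Gamma {z | 0 < z.re} := fun z hz =>
    (differentiableAt_Gamma z fun m h => by
      have hz : 0 < z.re := hz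
      rw [h] at hz
      simp at hz
      have h2 : (0:ℝ) ≤ m := m.cast_nonneg
      linarith).differentiableWithinAt
  exact (hd.deriv isOpen_re_pos).div hd fun z hz => Gamma_ne_zero_of_re_pos hz

/-- The logarithmic derivative of `ζ` through those of `ξ` and `Γ`. -/
theorem deriv_riemannZeta_div {s : ℂ} (hs : 1 < s.re) (n : ℕ) :
    deriv riemannZeta s / riemannZeta s = deriv riemannXi s / riemannXi s - 1 / (s - 1) +
      Real.log Real.pi / 2 - digamma (s / 2 + (n + 1 : ℕ)) / 2 +
      ∑ j ∈ Finset.range n, 1 / (s + 2 * (j + 1)) := by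
  have hs0 : 0 < s.re := by linarith
  have h1 : s ≠ 1 := fun h => by rw [h] at hs; simp at hs
  have h0 : s ≠ 0 := fun h => by rw [h] at hs; norm_num at hs
  have h1' : s - 1 ≠ 0 := sub_ne_zero.2 h1
  have hz := riemannZeta_ne_zero_of_one_le_re hs.le
  have hs2 : 0 < (s / 2).re := by simpa
  have hG := Gamma_ne_zero_of_re_pos hs2
  have hpi : (Real.pi : ℂ) ≠ 0 := by exact_mod_cast Real.pi_ne_zero
  have hp : (Real.pi : ℂ) ^ (-s / 2) ≠ 0 := by simp [cpow_eq_zero_iff, hpi]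
  have hdz := (differentiableAt_riemannZeta h1).hasDerivAt
  have hdG : HasDerivAt Gamma (deriv Gamma (s / 2)) (s / 2) :=
    (differentiableAt_Gamma _ fun m h => by
      rw [h] at hs2
      simp at hs2
      have h2 : (0:ℝ) ≤ m := m.cast_nonneg
      linarith).hasDerivAt
  have hdG2 : HasDerivAt (fun s : ℂ => Gamma (s / 2)) (deriv Gamma (s / 2) * (1 / 2)) s :=
    hdG.comp s ((hasDerivAt_id s).div_const 2)
  have hdp : HasDerivAt (fun s : ℂ => (Real.pi : ℂ) ^ (-s / 2))
      ((Real.pi : ℂ) ^ (-s / 2) * Complex.log Real.pi * (-1 / 2)) s :=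
    (((hasDerivAt_id s).neg.div_const 2).const_cpow (Or.inl hpi))
  have hall := (((hasDerivAt_id s).mul ((hasDerivAt_id s).sub_const 1)).mul
    ((hdp.mul hdG2).mul hdz))
  have heq : riemannXi =ᶠ[𝓝 s] fun s => s * (s - 1) *
      ((Real.pi : ℂ) ^ (-s / 2) * Gamma (s / 2) * riemannZeta s) := by
    filter_upwards [(isOpen_lt continuous_const continuous_re).mem_nhds hs] with w hw
    have hw : 1 < w.re := hw
    rw [riemannXi_eq (by linarith) fun h => by rw [h] at hw; simp at hw]; rfl
  have hd := (hall.congr_of_eventuallyEq heq).deriv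
  rw [hd, heq.eq_of_nhds, digamma_add_nat hs2, Finset.sum_range_succ', digamma_def, logDeriv_apply,
    ofReal_log Real.pi_pos.le]
  have hsum : ∀ j : ℕ, 1 / (s / 2 + ((j + 1 : ℕ) : ℂ)) = 2 * (1 / (s + 2 * (j + 1))) := by
    intro j
    have h1 : s + 2 * ((j : ℂ) + 1) ≠ 0 := fun h => by
      have := congrArg re h
      simp at this
      have h2 : (0:ℝ) ≤ j := j.cast_nonneg
      linarith
    have h2 : s / 2 + ((j + 1 : ℕ) : ℂ) = (s + 2 * (j + 1)) / 2 := by push_cast; ring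
    rw [h2]
    field_simp
  simp only [hsum, ← Finset.mul_sum, Nat.cast_zero, add_zero, id, Pi.mul_apply]
  generalize (Real.pi : ℂ) ^ (-s / 2) = p at *
  generalize Gamma (s / 2) = G at *
  generalize deriv Gamma (s / 2) = G' at *
  generalize ∑ j ∈ Finset.range n, 1 / (s + 2 * ((j : ℂ) + 1)) = S
  field_simp
  ring

end

section

open Complex Metric Filter Topology MeasureTheory Set Asymptotics
open scoped BigOperators Nat ComplexConjugate

theorem log_pi_bounds : 33 / 20 * Real.log 2 < Real.log Real.pi ∧
    Real.log Real.pi < 5 / 3 * Real.log 2 := by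
  constructor
  · have h : Real.log ((2:ℝ) ^ 33) < Real.log (Real.pi ^ 20) := by
      apply Real.log_lt_log (by norm_num)
      calc (2:ℝ) ^ 33 < 3.14 ^ 20 := by norm_num
        _ ≤ Real.pi ^ 20 := by gcongr; exact Real.pi_gt_d2.le
    rw [Real.log_pow, Real.log_pow] at h
    push_cast at h; linarith
  · have h : Real.log (Real.pi ^ 3) < Real.log ((2:ℝ) ^ 5) := by
      apply Real.log_lt_log (by have := Real.pi_pos; positivity)
      calc Real.pi ^ 3 < 3.15 ^ 3 := by gcongr; exact Real.pi_lt_d2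
        _ < 2 ^ 5 := by norm_num
    rw [Real.log_pow, Real.log_pow] at h
    push_cast at h; linarith

theorem log_four_mul_pi : Real.log (4 * Real.pi) = 2 * Real.log 2 + Real.log Real.pi := by
  rw [Real.log_mul (by norm_num) Real.pi_ne_zero, show (4:ℝ) = 2 ^ 2 by norm_num, Real.log_pow]
  norm_num

theorem log_sixty_four : Real.log 64 = 6 * Real.log 2 := by
  rw [show (64:ℝ) = 2 ^ 6 by norm_num, Real.log_pow]; norm_num

theorem eulerMascheroniConstant_bounds :
    0.56 < Real.eulerMascheroniConstant ∧ Real.eulerMascheroniConstant < 0.5851 := by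
  have h1 := Real.eulerMascheroniSeq_lt_eulerMascheroniConstant 63
  have h2 := Real.eulerMascheroniConstant_lt_eulerMascheroniSeq' 64
  rw [Real.eulerMascheroniSeq] at h1
  rw [Real.eulerMascheroniSeq', if_neg (by norm_num)] at h2
  have e1 : Real.log ((63:ℕ) + 1) = 6 * Real.log 2 := by rw [← log_sixty_four]; norm_num
  have e2 : Real.log ((64:ℕ)) = 6 * Real.log 2 := by rw [← log_sixty_four]; norm_num
  have e3 : ((harmonic 63 : ℚ) : ℝ) > 4.72 := by
    have : (harmonic 63 : ℚ) > 4.72 := by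
      simp only [harmonic, Finset.sum_range_succ, Finset.sum_range_zero]; norm_num
    have := (Rat.cast_lt (K := ℝ)).2 this
    push_cast at this; convert this
  have e4 : ((harmonic 64 : ℚ) : ℝ) < 4.7439 := by
    have : (harmonic 64 : ℚ) < 4.7439 := by
      simp only [harmonic, Finset.sum_range_succ, Finset.sum_range_zero]; norm_num
    have := (Rat.cast_lt (K := ℝ)).2 this
    push_cast at this; convert this
  rw [e1] at h1
  rw [e2] at h2
  have := Real.log_two_gt_d9
  have := Real.log_two_lt_d9
  constructor
  · norm_num at *; linarith
  · norm_num at *; linarith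

theorem exists_posReal_decomposition (hRH : RiemannHypothesis) :
    ∃ (Q₁ Q₂ : ℂ → ℂ) (c b : ℝ), |c| ≤ 1 ∧ |b| ≤ 1 / 10 ∧
      DifferentiableOn ℂ Q₁ {z | 0 < z.re} ∧ (∀ z, 0 < z.re → 0 ≤ (Q₁ z).re) ∧
      DifferentiableOn ℂ Q₂ {z | 0 < z.re} ∧ (∀ z, 0 < z.re → 0 ≤ (Q₂ z).re) ∧
      (∀ z : ℂ, 1 / 2 < z.re → (1 / 4 - z ^ 2) * (Q₁ z - Q₂ z) =
        deriv riemannZeta (1 / 2 + z) / riemannZeta (1 / 2 + z) + 1 / (z - 1 / 2) - c - 2 * z * b -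
          ∑ j ∈ Finset.range 9, 1 / (z + 1 / 2 + 2 * (j + 1))) ∧
      ∀ᶠ x : ℝ in atTop, x * ((Q₁ x).re + (Q₂ x).re) ≤ 1 / 8 := by
  have l1 := Real.log_two_gt_d9
  have l2 := Real.log_two_lt_d9
  obtain ⟨p1, p2⟩ := log_pi_bounds
  obtain ⟨g1, g2⟩ := eulerMascheroniConstant_bounds
  set γ := Real.eulerMascheroniConstant
  set b₁ : ℝ := (γ - Real.log (4 * Real.pi)) / 2 + 1 with hb₁
  set d₀ : ℝ := ∑ j ∈ Finset.range 9, 1 / (1 + (j : ℝ)) - γ with hd₀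
  set d₁ : ℝ := ∑ j ∈ Finset.range 10, 1 / (1 / 2 + (j : ℝ)) - 2 * Real.log 2 - γ with hd₁
  have s1 : d₀ = 7129 / 2520 - γ := by
    rw [hd₀]; congr 1; simp only [Finset.sum_range_succ, Finset.sum_range_zero]; norm_num
  have s2 : d₁ = 62075752 / 14549535 - 2 * Real.log 2 - γ := by
    rw [hd₁]; congr 2; simp only [Finset.sum_range_succ, Finset.sum_range_zero]; norm_num
  rw [log_four_mul_pi] at hb₁
  have hb₁p : 0 < b₁ := by rw [hb₁]; norm_num at *; linarith
  have hb₂p : 0 < (d₁ - d₀) / 2 := by rw [s1, s2]; norm_num at *; linarith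
  have hbs : b₁ + (d₁ - d₀) / 2 ≤ 31 / 500 := by rw [hb₁, s1, s2]; norm_num at *; linarith
  set H : ℂ → ℂ := fun z => deriv riemannXi (1 / 2 + z) / riemannXi (1 / 2 + z) with hH
  set D : ℂ → ℂ := fun z => (digamma ((1 / 2 + z) / 2 + 10) - digamma 10) / 2 with hD
  have hmaps : ∀ z : ℂ, 0 < z.re → 1 / 2 < (1 / 2 + z).re := fun z hz => by simp; linarith
  have hHd : DifferentiableOn ℂ H {z | 0 < z.re} := fun z hz => by
    have h1 := differentiable_riemannXi.deriv (1 / 2 + z)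
    have h2 := differentiable_riemannXi (1 / 2 + z)
    exact ((h1.comp z (by fun_prop)).div (h2.comp z (by fun_prop))
      (riemannXi_ne_zero hRH (hmaps z hz))).differentiableWithinAt
  have hHre : ∀ z, 0 < z.re → 0 ≤ (H z).re := fun z hz =>
    re_deriv_riemannXi_div_nonneg hRH (hmaps z hz)
  have hHb : H (1 / 2) = b₁ := by
    simp only [hH]
    norm_num
    rw [riemannXi_one, deriv_riemannXi_one, log_four_mul_pi, hb₁, div_one]
  have hmapd : ∀ z : ℂ, 0 < z.re → 10 ≤ ((1 / 2 + z) / 2 + 10).re := fun z hz => by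
    have : ((1 / 2 + z) / 2 + 10 : ℂ).re = (1 / 2 + z.re) / 2 + 10 := by
      rw [add_re, show (1 / 2 + z) / 2 = ((1 / 2 : ℝ) : ℂ) * (1 / 2 + z) by push_cast; ring,
        re_ofReal_mul]
      simp; ring
    rw [this]; linarith
  have hDd : DifferentiableOn ℂ D {z | 0 < z.re} := by
    refine ((differentiableOn_digamma.comp (by fun_prop) fun z hz => ?_).sub_const _).div_const 2
    exact lt_of_lt_of_le (by norm_num : (0:ℝ) < 10) (hmapd z hz)
  have hDre : ∀ z, 0 < z.re → 0 ≤ (D z).re := fun z hz => by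
    have h := re_digamma_ge (u := 10) (by norm_num) (hmapd z hz)
    rw [show ((10 : ℝ) : ℂ) = 10 by norm_num] at h
    simp only [hD]
    rw [show ∀ a : ℂ, a / 2 = ((1 / 2 : ℝ) : ℂ) * a by intro a; push_cast; ring, re_ofReal_mul,
      sub_re]
    linarith
  have hDb : D (1 / 2) = ((d₁ - d₀) / 2 : ℝ) := by
    simp only [hD]
    rw [show ((1 / 2 + 1 / 2) / 2 + 10 : ℂ) = 10 + 1 / 2 by norm_num, digamma_ten_add_half,
      digamma_ten, ← hd₀, ← hd₁]
    push_cast; ring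
  obtain ⟨Q₁, q1, q2, q3⟩ := exists_regularization hb₁p hHd hHre hHb
  obtain ⟨Q₂, r1, r2, r3⟩ := exists_regularization hb₂p hDd hDre hDb
  refine ⟨Q₁, Q₂, Real.log Real.pi / 2 - d₀ / 2, b₁ - (d₁ - d₀) / 2, ?_, ?_, q1, q2, r1, r2, ?_, ?_⟩
  · rw [s1, abs_le]; norm_num at *; constructor <;> linarith
  · rw [abs_le]; norm_num at *; constructor <;> linarith
  · intro z hz
    have hz0 : 0 < z.re := by linarith
    have hk := deriv_riemannZeta_div (s := 1 / 2 + z) (by simp; linarith) 9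
    have e3 : (((9 + 1 : ℕ)) : ℂ) = 10 := by norm_num
    have e1 : (1 / 2 + z - 1) = z - 1 / 2 := by ring
    have e2 : ∑ j ∈ Finset.range 9, 1 / (1 / 2 + z + 2 * ((j : ℂ) + 1)) =
        ∑ j ∈ Finset.range 9, 1 / (z + 1 / 2 + 2 * ((j : ℂ) + 1)) :=
      Finset.sum_congr rfl fun j _ => by rw [add_comm (1 / 2) z]
    have hHz : H z = deriv riemannXi (1 / 2 + z) / riemannXi (1 / 2 + z) := rfl
    have hDz : D z = (digamma ((1 / 2 + z) / 2 + 10) - digamma 10) / 2 := rfl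
    rw [e1, e2, e3, ← hHz] at hk
    rw [digamma_ten, ← hd₀] at hDz
    rw [mul_sub, q3 z hz0, r3 z hz0, hk, hDz]
    generalize ∑ j ∈ Finset.range 9, 1 / (z + 1 / 2 + 2 * ((j : ℂ) + 1)) = S
    generalize H z = h
    generalize digamma ((1 / 2 + z) / 2 + 10) = d
    push_cast
    ring
  · filter_upwards [eventually_ge_atTop (100:ℝ)] with x hx
    have hx0 : 0 < (x : ℂ).re := by rw [ofReal_re]; linarith
    have h1 := mul_re_regularization_le (by linarith) (hHre x hx0) (q3 x hx0)
    have h2 := mul_re_regularization_le (by linarith) (hDre x hx0) (r3 x hx0)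
    rw [mul_add]
    refine (add_le_add h1 h2).trans ?_
    have haux : ∀ p q : ℝ, p + q ≤ 31 / 500 →
        2 * p * x ^ 2 / (x ^ 2 - 1 / 4) + 2 * q * x ^ 2 / (x ^ 2 - 1 / 4) ≤ 1 / 8 := by
      clear * - hx
      intro p q hpq
      rw [← add_div, div_le_iff₀ (by nlinarith)]
      nlinarith [mul_le_mul_of_nonneg_right hpq (sq_nonneg x)]
    exact haux _ _ hbs

end

section

open Complex Metric Filter Topology MeasureTheory Set Asymptotics
open scoped BigOperators Nat ComplexConjugate

/-- The Laplace transform of `f` converges absolutely at `z` with value `L`. -/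
def HasLaplace (f : ℝ → ℝ) (z L : ℂ) : Prop :=
  IntegrableOn (fun t : ℝ => (f t : ℂ) * cexp (-(z * t))) (Ioi 0) ∧
    ∫ t in Ioi (0 : ℝ), (f t : ℂ) * cexp (-(z * t)) = L

namespace HasLaplace

theorem add {f g : ℝ → ℝ} {z L K : ℂ} (hf : HasLaplace f z L) (hg : HasLaplace g z K) :
    HasLaplace (fun t => f t + g t) z (L + K) := by
  have e : (fun t : ℝ => ((f t + g t : ℝ) : ℂ) * cexp (-(z * t))) =
      fun t : ℝ => (f t : ℂ) * cexp (-(z * t)) + (g t : ℂ) * cexp (-(z * t)) := by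
    ext t; push_cast; ring
  refine ⟨by rw [e]; exact hf.1.add hg.1, ?_⟩
  rw [e, integral_add hf.1 hg.1, hf.2, hg.2]

theorem const_mul {f : ℝ → ℝ} {z L : ℂ} (c : ℝ) (hf : HasLaplace f z L) :
    HasLaplace (fun t => c * f t) z (c * L) := by
  have e : (fun t : ℝ => ((c * f t : ℝ) : ℂ) * cexp (-(z * t))) =
      fun t : ℝ => (c : ℂ) * ((f t : ℂ) * cexp (-(z * t))) := by
    ext t; push_cast; ring
  refine ⟨by rw [e]; exact hf.1.const_mul _, ?_⟩
  rw [e, integral_const_mul, hf.2]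

theorem sub {f g : ℝ → ℝ} {z L K : ℂ} (hf : HasLaplace f z L) (hg : HasLaplace g z K) :
    HasLaplace (fun t => f t - g t) z (L - K) := by
  have h := hf.add (hg.const_mul (-1))
  convert h using 1
  · ext t; ring
  · push_cast; ring

theorem sum {f : ℕ → ℝ → ℝ} {z : ℂ} {L : ℕ → ℂ} (n : ℕ)
    (hf : ∀ j < n, HasLaplace (f j) z (L j)) :
    HasLaplace (fun t => ∑ j ∈ Finset.range n, f j t) z (∑ j ∈ Finset.range n, L j) := by
  induction n with
  | zero => simp [HasLaplace]
  | succ n ih =>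
    simp only [Finset.sum_range_succ]
    exact (ih fun j hj => hf j (by omega)).add (hf n (by omega))

theorem exp {a : ℝ} {z : ℂ} (h : a < z.re) :
    HasLaplace (fun t => Real.exp (a * t)) z (1 / (z - a)) := by
  have e : (fun t : ℝ => ((Real.exp (a * t) : ℝ) : ℂ) * cexp (-(z * t))) =
      fun t : ℝ => cexp ((a - z) * t) := by
    ext t; rw [ofReal_exp, ← Complex.exp_add]; congr 1; push_cast; ring
  have hre : ((a : ℂ) - z).re < 0 := by simp; linarith
  refine ⟨by rw [e]; exact integrableOn_exp_mul_complex_Ioi hre 0, ?_⟩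
  rw [e, integral_exp_mul_complex_Ioi hre]
  have : (a : ℂ) - z ≠ 0 := fun h => by rw [h] at hre; simp at hre
  have h2 : z - a ≠ 0 := fun h => this (by linear_combination -h)
  simp only [ofReal_zero, mul_zero, Complex.exp_zero]
  rw [div_eq_div_iff this h2]; ring

theorem mul_exp {a : ℝ} {z : ℂ} (h : a < z.re) :
    HasLaplace (fun t => t * Real.exp (a * t)) z (1 / (z - a) ^ 2) := by
  set w := z - a with hw
  have hwre : 0 < w.re := by simp [hw]; linarith
  have hw0 : w ≠ 0 := fun h => by rw [h] at hwre; simp at hwre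
  have e : (fun t : ℝ => ((t * Real.exp (a * t) : ℝ) : ℂ) * cexp (-(z * t))) =
      fun t : ℝ => (t : ℂ) * cexp (-(w * t)) := by
    ext t; rw [ofReal_mul, ofReal_exp, mul_assoc, ← Complex.exp_add]
    congr 2; push_cast; rw [hw]; ring
  have hn : ∀ t : ℝ, ‖cexp (-(w * t))‖ = Real.exp (-(w.re * t)) := fun t => by
    rw [norm_exp]; simp
  have hgint : IntegrableOn (fun t : ℝ => (t : ℂ) * cexp (-(w * t))) (Ioi 0) := by
    refine (integrable_norm_iff (Continuous.aestronglyMeasurable (by fun_prop))).1 ?_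
    refine (integrableOn_pow_mul_exp_neg_mul hwre 1).congr_fun (fun t ht => ?_) measurableSet_Ioi
    have ht : 0 < t := ht
    beta_reduce
    rw [norm_mul, hn, norm_real, Real.norm_eq_abs, abs_of_pos ht, pow_one]
  refine ⟨by rw [e]; exact hgint, ?_⟩
  rw [e]
  have hd : ∀ t ∈ Ici (0:ℝ), HasDerivAt (fun t : ℝ => -((t / w + 1 / w ^ 2) * cexp (-(w * t))))
      ((t : ℂ) * cexp (-(w * t))) t := by
    intro t _
    have h1 : HasDerivAt (fun t : ℝ => (t : ℂ)) 1 t := (hasDerivAt_id t).ofReal_comp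
    have h2 := (((h1.div_const w).add_const (1 / w ^ 2)).mul ((h1.const_mul w).neg.cexp)).neg
    refine h2.congr_deriv ?_
    simp only [Pi.neg_apply]
    field_simp; ring
  have hlim : Tendsto (fun t : ℝ => -((t / w + 1 / w ^ 2) * cexp (-(w * t)))) atTop (𝓝 0) := by
    have ht : ∀ m : ℕ, Tendsto (fun t : ℝ => t ^ m * Real.exp (-(w.re * t))) atTop (𝓝 0) := by
      intro m
      have := tendsto_rpow_mul_exp_neg_mul_atTop_nhds_zero m w.re hwre
      simpa only [neg_mul, Real.rpow_natCast] using this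
    have h3 := ((ht 1).mul_const (‖w‖⁻¹)).add ((ht 0).mul_const (‖w ^ 2‖⁻¹))
    simp only [zero_mul, add_zero] at h3
    refine squeeze_zero_norm' ?_ h3
    filter_upwards [eventually_ge_atTop (0:ℝ)] with t ht0
    rw [norm_neg, norm_mul, hn]
    have : ‖(t : ℂ) / w + 1 / w ^ 2‖ ≤ t * ‖w‖⁻¹ + ‖w ^ 2‖⁻¹ := by
      refine (norm_add_le _ _).trans_eq ?_
      rw [norm_div, norm_div, norm_real, Real.norm_eq_abs, abs_of_nonneg ht0, norm_one,
        div_eq_mul_inv, one_div]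
    calc _ ≤ (t * ‖w‖⁻¹ + ‖w ^ 2‖⁻¹) * Real.exp (-(w.re * t)) := by gcongr
      _ = _ := by ring
  rw [integral_Ioi_of_hasDerivAt_of_tendsto' hd hgint hlim]
  simp

end HasLaplace

end

section

open Complex Metric Filter Topology MeasureTheory Set Asymptotics ArithmeticFunction
open scoped BigOperators Nat ComplexConjugate

/-- The contribution of `n` to the (normalised) integrated Chebyshev function at `exp u`. -/
noncomputable def chebTerm (n : ℕ) (u : ℝ) : ℝ :=
  vonMangoldt n * max (Real.exp (u / 2) / n - Real.exp (-u / 2)) 0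

theorem chebTerm_nonneg (n : ℕ) (u : ℝ) : 0 ≤ chebTerm n u :=
  mul_nonneg vonMangoldt_nonneg (le_max_right _ _)

theorem chebTerm_zero (u : ℝ) : chebTerm 0 u = 0 := by simp [chebTerm]

theorem exp_half_div_sub {n : ℕ} (hn : 0 < n) (u : ℝ) :
    Real.exp (u / 2) / n - Real.exp (-u / 2) = Real.exp (-u / 2) * (Real.exp u - n) / n := by
  have h : Real.exp (u / 2) = Real.exp (-u / 2) * Real.exp u := by
    rw [← Real.exp_add]; congr 1; ring
  have : (n : ℝ) ≠ 0 := by positivity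
  rw [h]; field_simp

theorem chebTerm_eq_zero {n : ℕ} {u : ℝ} (h : Real.exp u ≤ n) : chebTerm n u = 0 := by
  have hn : 0 < n := by
    have := (Real.exp_pos u).trans_le h
    exact_mod_cast this
  rw [chebTerm, max_eq_right, mul_zero]
  rw [exp_half_div_sub hn]
  exact div_nonpos_of_nonpos_of_nonneg
    (mul_nonpos_of_nonneg_of_nonpos (Real.exp_pos _).le (by linarith)) (by positivity)

theorem chebTerm_eq_of_le {n : ℕ} {u : ℝ} (h : (n : ℝ) ≤ Real.exp u) :
    chebTerm n u = vonMangoldt n * (Real.exp (u / 2) / n - Real.exp (-u / 2)) := by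
  rcases Nat.eq_zero_or_pos n with rfl | hn
  · simp [chebTerm]
  rw [chebTerm, max_eq_left]
  rw [exp_half_div_sub hn]
  exact div_nonneg (mul_nonneg (Real.exp_pos _).le (by linarith)) (by positivity)

theorem chebTerm_le (n : ℕ) (u : ℝ) : chebTerm n u ≤ Real.exp (u / 2) := by
  rcases Nat.eq_zero_or_pos n with rfl | hn
  · rw [chebTerm_zero]; positivity
  have hn' : (0 : ℝ) < n := by exact_mod_cast hn
  have h1 : max (Real.exp (u / 2) / n - Real.exp (-u / 2)) 0 ≤ Real.exp (u / 2) / n :=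
    max_le (by linarith [Real.exp_pos (-u / 2)]) (by positivity)
  have h2 : vonMangoldt n ≤ n :=
    vonMangoldt_le_log.trans ((Real.log_le_sub_one_of_pos hn').trans (by linarith))
  calc chebTerm n u ≤ n * (Real.exp (u / 2) / n) :=
        mul_le_mul h2 h1 (le_max_right _ _) hn'.le
    _ = _ := by field_simp

theorem continuous_chebTerm (n : ℕ) : Continuous (chebTerm n) := by
  unfold chebTerm; fun_prop

/-- The normalised integrated Chebyshev function in logarithmic scale. -/
noncomputable def chebSum (u : ℝ) : ℝ := ∑' n, chebTerm n u

theorem hasSum_chebTerm {u : ℝ} {N : ℕ} (h : Real.exp u ≤ N) :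
    HasSum (fun n => chebTerm n u) (∑ n ∈ Finset.range N, chebTerm n u) := by
  refine hasSum_sum_of_ne_finset_zero fun n hn => chebTerm_eq_zero (h.trans ?_)
  exact_mod_cast not_lt.1 (by simpa using hn)

theorem chebSum_eq {u : ℝ} {N : ℕ} (h : Real.exp u ≤ N) :
    chebSum u = ∑ n ∈ Finset.range N, chebTerm n u := (hasSum_chebTerm h).tsum_eq

theorem continuous_chebSum : Continuous chebSum := by
  refine continuous_iff_continuousAt.2 fun u => ?_
  obtain ⟨N, hN⟩ := exists_nat_gt (Real.exp u)
  have h1 : ∀ᶠ v in 𝓝 u, Real.exp v < N := Real.continuous_exp.continuousAt.eventually_lt_const hN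
  have h2 : ContinuousAt (fun v => ∑ n ∈ Finset.range N, chebTerm n v) u :=
    (continuous_finsetSum _ fun n _ => continuous_chebTerm n).continuousAt
  exact h2.congr (h1.mono fun v hv => (chebSum_eq hv.le).symm)

theorem chebSum_nonneg (u : ℝ) : 0 ≤ chebSum u := tsum_nonneg fun n => chebTerm_nonneg n u

theorem chebSum_le {u : ℝ} (hu : 0 < u) : chebSum u ≤ 2 * Real.exp (3 / 2 * u) := by
  have h1 : (1 : ℝ) ≤ Real.exp u := Real.one_le_exp hu.le
  rw [chebSum_eq (Nat.le_ceil _)]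
  calc _ ≤ ∑ n ∈ Finset.range ⌈Real.exp u⌉₊, Real.exp (u / 2) :=
        Finset.sum_le_sum fun n _ => chebTerm_le n u
    _ = ⌈Real.exp u⌉₊ * Real.exp (u / 2) := by simp
    _ ≤ (2 * Real.exp u) * Real.exp (u / 2) := by
        gcongr
        have := (Nat.ceil_lt_add_one (Real.exp_pos u).le).le
        linarith
    _ = _ := by rw [mul_assoc, ← Real.exp_add]; congr 2; ring

theorem hasLaplace_chebTerm (n : ℕ) {z : ℂ} (hz : 1 / 2 < z.re) :
    HasLaplace (chebTerm n) z
      (LSeries.term (fun n => (vonMangoldt n : ℂ)) (1 / 2 + z) n / (z ^ 2 - 1 / 4)) := by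
  rcases Nat.eq_zero_or_pos n with rfl | hn
  · simp [HasLaplace, chebTerm_zero]
  have hn1 : (1 : ℝ) ≤ n := by exact_mod_cast hn
  have hn' : (0 : ℝ) < n := by linarith
  have hnC : (n : ℂ) ≠ 0 := by exact_mod_cast hn.ne'
  set c := Real.log n
  have hc : 0 ≤ c := Real.log_nonneg hn1
  have hexpc : Real.exp c = n := Real.exp_log hn'
  have h1 : ((1 / 2 : ℂ) - z).re < 0 := by simp; linarith
  have h2 : (-(1 / 2 : ℂ) - z).re < 0 := by simp; linarith
  have h1' : (1 / 2 : ℂ) - z ≠ 0 := fun h => by rw [h] at h1; simp at h1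
  have h2' : -(1 / 2 : ℂ) - z ≠ 0 := fun h => by rw [h] at h2; simp at h2
  set L : ℂ := (vonMangoldt n : ℂ)
  let G : ℝ → ℂ := fun t => L / n * cexp ((1 / 2 - z) * t) - L * cexp ((-(1 / 2) - z) * t)
  have i1 := (integrableOn_exp_mul_complex_Ioi h1 c).const_mul (L / n)
  have i2 := (integrableOn_exp_mul_complex_Ioi h2 c).const_mul L
  have hG : IntegrableOn G (Ioi c) := i1.sub i2
  have he : (fun t : ℝ => (chebTerm n t : ℂ) * cexp (-(z * t))) = (Ioi c).indicator G := by
    ext t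
    by_cases ht : t ∈ Ioi c
    · rw [indicator_of_mem ht, chebTerm_eq_of_le
        (by rw [← hexpc]; exact Real.exp_le_exp.2 (le_of_lt ht))]
      simp only [G]
      push_cast
      rw [show ((1 / 2 : ℂ) - z) * t = t / 2 + -(z * t) by ring,
        show (-(1 / 2 : ℂ) - z) * t = -t / 2 + -(z * t) by ring, Complex.exp_add, Complex.exp_add]
      ring
    · rw [indicator_of_notMem ht, chebTerm_eq_zero
        (by rw [← hexpc]; exact Real.exp_le_exp.2 (not_lt.1 ht))]
      simp
  have hIoi : Ioi 0 ∩ Ioi c = Ioi c := by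
    rw [Ioi_inter_Ioi, max_eq_right hc]
  refine ⟨?_, ?_⟩
  · rw [he]
    exact ((integrable_indicator_iff measurableSet_Ioi).2 hG).integrableOn
  rw [he, setIntegral_indicator measurableSet_Ioi, hIoi]
  have hcC : (c : ℂ) = Complex.log n := by
    simp [c, Complex.natCast_log]
  have e3 : ∀ w : ℂ, cexp (w * c) = (n : ℂ) ^ w := fun w => by
    rw [hcC, Complex.cpow_def_of_ne_zero hnC, mul_comm]
  simp only [G]
  rw [integral_sub i1 i2, integral_const_mul, integral_const_mul,
    integral_exp_mul_complex_Ioi h1, integral_exp_mul_complex_Ioi h2, e3, e3,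
    LSeries.term_of_ne_zero hn.ne']
  have e4 : (n : ℂ) ^ ((1 / 2 : ℂ) - z) = n / (n : ℂ) ^ (1 / 2 + z) := by
    rw [show (1 / 2 : ℂ) - z = 1 - (1 / 2 + z) by ring, Complex.cpow_sub _ _ hnC, Complex.cpow_one]
  have e5 : (n : ℂ) ^ (-(1 / 2 : ℂ) - z) = 1 / (n : ℂ) ^ (1 / 2 + z) := by
    rw [show -(1 / 2 : ℂ) - z = -(1 / 2 + z) by ring, Complex.cpow_neg, inv_eq_one_div]
  rw [e4, e5]
  have hp : (n : ℂ) ^ (1 / 2 + z) ≠ 0 := by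
    rw [Complex.cpow_def_of_ne_zero hnC]; exact Complex.exp_ne_zero _
  have hz2 : z ^ 2 - 1 / 4 ≠ 0 := by
    rw [show z ^ 2 - 1 / 4 = (1 / 2 - z) * (-(1 / 2) - z) by ring]
    exact mul_ne_zero h1' h2'
  rw [show z ^ 2 - 1 / 4 = (1 / 2 - z) * (-(1 / 2) - z) by ring]
  change _ = L / _ / _
  rw [show -(1 / 2 : ℂ) - z = (1 / 2 - z) - 1 by ring] at h2' ⊢
  clear_value L c
  clear e3 e4 e5 hz2 hG i1 i2 he G
  generalize (n : ℂ) ^ (1 / 2 + z) = w at *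
  generalize (1 / 2 : ℂ) - z = a at *
  field_simp
  ring

theorem hasLaplace_chebSum {z : ℂ} (hz : 2 < z.re) :
    HasLaplace chebSum z (deriv riemannZeta (1 / 2 + z) / riemannZeta (1 / 2 + z) / (1 / 4 - z ^ 2)) := by
  have hgint : ∀ n : ℕ, Integrable (fun t : ℝ => (chebTerm n t : ℂ) * cexp (-(z * t)))
      (volume.restrict (Ioi 0)) := fun n => (hasLaplace_chebTerm n (by linarith)).1
  have hnorm : ∀ n : ℕ, ∫ t in Ioi (0 : ℝ), ‖(chebTerm n t : ℂ) * cexp (-(z * t))‖ =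
      ‖LSeries.term (fun n => (vonMangoldt n : ℂ)) (1 / 2 + (z.re : ℂ)) n / ((z.re : ℂ) ^ 2 - 1 / 4)‖ := by
    intro n
    rw [← (hasLaplace_chebTerm n (z := (z.re : ℂ)) (by simp; linarith)).2]
    have e1 : ∀ t : ℝ, (chebTerm n t : ℂ) * cexp (-((z.re : ℂ) * t)) =
        ((‖(chebTerm n t : ℂ) * cexp (-(z * t))‖ : ℝ) : ℂ) := fun t => by
      rw [norm_mul, norm_real, Real.norm_eq_abs, abs_of_nonneg (chebTerm_nonneg n t), norm_exp]
      push_cast; simp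
    simp only [e1]
    rw [integral_complex_ofReal, norm_real, Real.norm_eq_abs, abs_of_nonneg]
    exact integral_nonneg fun t => norm_nonneg _
  have hs : Summable fun n => ∫ t in Ioi (0 : ℝ), ‖(chebTerm n t : ℂ) * cexp (-(z * t))‖ := by
    simp only [hnorm]
    have := LSeriesSummable_vonMangoldt (s := 1 / 2 + (z.re : ℂ)) (by simp; linarith)
    exact (Summable.div_const this _).norm
  have hS := hasSum_integral_of_summable_integral_norm hgint hs
  have et : ∀ t : ℝ, ∑' n, (chebTerm n t : ℂ) * cexp (-(z * t)) = (chebSum t : ℂ) * cexp (-(z * t)) := by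
    intro t
    rw [tsum_mul_right, chebSum, Complex.ofReal_tsum]
  simp only [et] at hS
  refine ⟨?_, ?_⟩
  · have hi : IntegrableOn (fun t : ℝ => 2 * (t ^ 0 * Real.exp (-((z.re - 3 / 2) * t)))) (Ioi 0) :=
      (integrableOn_pow_mul_exp_neg_mul (by linarith) 0).const_mul 2
    refine Integrable.mono' hi ?_ ?_
    · have := continuous_chebSum
      exact Continuous.aestronglyMeasurable (by fun_prop)
    · filter_upwards [ae_restrict_mem measurableSet_Ioi] with t ht
      rw [norm_mul, norm_real, Real.norm_eq_abs, abs_of_nonneg (chebSum_nonneg t), norm_exp]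
      calc _ ≤ 2 * Real.exp (3 / 2 * t) * Real.exp (-(z * t)).re := by
            gcongr; exact chebSum_le ht
        _ = _ := by
            rw [mul_assoc, ← Real.exp_add, pow_zero, one_mul]
            congr 2; simp; ring
  · have h2 : HasSum (fun n => LSeries.term (fun n => (vonMangoldt n : ℂ)) (1 / 2 + z) n / (z ^ 2 - 1 / 4))
        (LSeries (fun n => (vonMangoldt n : ℂ)) (1 / 2 + z) / (z ^ 2 - 1 / 4)) :=
      (LSeriesSummable_vonMangoldt (s := 1 / 2 + z) (by simp; linarith)).hasSum.div_const _
    have h3 : ∀ n, ∫ t in Ioi (0 : ℝ), (chebTerm n t : ℂ) * cexp (-(z * t)) =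
      LSeries.term (fun n => (vonMangoldt n : ℂ)) (1 / 2 + z) n / (z ^ 2 - 1 / 4) :=
        fun n => (hasLaplace_chebTerm n (by linarith)).2
    simp only [h3] at hS
    rw [hS.unique h2, LSeries_vonMangoldt_eq_deriv_riemannZeta_div (by simp; linarith),
      neg_div, neg_div, ← div_neg, neg_sub]

end

section

open Complex Metric Filter Topology MeasureTheory Set Asymptotics ArithmeticFunction
open scoped BigOperators Nat ComplexConjugate

/-- The main term of `chebSum`, with parameters coming from the logarithmic derivative of zeta. -/
noncomputable def chebMain (c b u : ℝ) : ℝ :=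
  u * Real.exp (1 / 2 * u) - (1 + c + b) * Real.exp (1 / 2 * u) +
    (1 + c - b) * Real.exp (-1 / 2 * u) +
  ∑ j ∈ Finset.range 9, (-1 / (2 * j + 3) * Real.exp (1 / 2 * u) +
    1 / (2 * j + 2) * Real.exp (-1 / 2 * u) -
    1 / ((2 * j + 2) * (2 * j + 3)) * Real.exp (-(2 * j + 5 / 2) * u))

theorem continuous_chebMain (c b : ℝ) : Continuous (chebMain c b) := by
  unfold chebMain; fun_prop

theorem hasLaplace_chebMain (c b : ℝ) {z : ℂ} (hz : 1 / 2 < z.re) :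
    HasLaplace (chebMain c b) z
      ((-1 / (z - 1 / 2) + c + 2 * z * b + ∑ j ∈ Finset.range 9, 1 / (z + 1 / 2 + 2 * (j + 1))) /
        (1 / 4 - z ^ 2)) := by
  have hne : ∀ a : ℝ, a ≤ 1 / 2 → z - a ≠ 0 := fun a ha h => by
    have := congrArg Complex.re h
    simp at this; linarith
  have h1 : z - 1 / 2 ≠ 0 := by simpa using hne (1 / 2) le_rfl
  have h2 : z + 1 / 2 ≠ 0 := by simpa [neg_div] using hne (-1 / 2) (by norm_num)
  have h3 : ∀ j : ℕ, z + 1 / 2 + 2 * (j + 1) ≠ 0 := fun j => by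
    have := hne (-(2 * j + 5 / 2)) (by have : (0:ℝ) ≤ j := by positivity
                                       linarith)
    convert this using 1; push_cast; ring
  have hA := HasLaplace.mul_exp hz
  have hB := HasLaplace.exp hz
  have hC := HasLaplace.exp (a := -1 / 2) (z := z) (by linarith)
  have hD := fun j : ℕ => HasLaplace.exp (a := -(2 * j + 5 / 2)) (z := z) (by
    have : (0:ℝ) ≤ j := by positivity
    linarith)
  have H := (hA.sub (hB.const_mul (1 + c + b))).add (hC.const_mul (1 + c - b)) |>.add
    (HasLaplace.sum 9 fun j _ => ((hB.const_mul (-1 / (2 * j + 3))).add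
      (hC.const_mul (1 / (2 * j + 2)))).sub (((hD j).const_mul (1 / ((2 * j + 2) * (2 * j + 3))))))
  convert H using 1
  · ext t; simp only [chebMain]
  have e4 : (1 / 4 - z ^ 2) = -((z - 1 / 2) * (z + 1 / 2)) := by ring
  rw [add_div, Finset.sum_div]
  congr 1
  · rw [e4]
    push_cast
    rw [show z - -1 / 2 = z + 1 / 2 by ring]
    have e5 : z + 1 / 2 = (z - 1 / 2) + 1 := by ring
    have e6 : z = (z - 1 / 2) + 1 / 2 := by ring
    rw [e5] at h2 ⊢
    generalize z - 1 / 2 = w at *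
    subst e6
    field_simp
    ring
  · refine Finset.sum_congr rfl fun j _ => ?_
    have h3 := h3 j
    rw [e4]
    push_cast
    rw [show z - -1 / 2 = z + 1 / 2 by ring,
      show z - -(2 * (j : ℂ) + 5 / 2) = z + 1 / 2 + 2 * (j + 1) by ring]
    have e5 : z - 1 / 2 = (z + 1 / 2) - 1 := by ring
    rw [e5] at h1 ⊢
    have g1 : (2 * (j : ℂ) + 3) ≠ 0 := by exact_mod_cast (by omega : 2 * j + 3 ≠ 0)
    have g2 : (2 * (j : ℂ) + 2) ≠ 0 := by exact_mod_cast (by omega : 2 * j + 2 ≠ 0)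
    have g3 : (j : ℂ) + 1 ≠ 0 := by exact_mod_cast (by omega : j + 1 ≠ 0)
    clear e4 e5
    generalize z + 1 / 2 = w at *
    generalize (j : ℂ) = i at *
    have g4 : w + (2 * i + 2) ≠ 0 := by rwa [show w + (2 * i + 2) = w + 2 * (i + 1) by ring]
    rw [show w + 2 * (i + 1) = w + (2 * i + 2) by ring]
    field_simp
    ring

theorem abs_chebMain_le (c b : ℝ) (hc : |c| ≤ 1) (hb : |b| ≤ 1 / 10) {u : ℝ} (hu : 0 < u) :
    |chebMain c b u| ≤ 10 * Real.exp (2 * u) := by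
  rw [abs_le] at hc hb
  set E := Real.exp (2 * u)
  have h1 : Real.exp (1 / 2 * u) ≤ E := Real.exp_le_exp.2 (by linarith)
  have h2 : Real.exp (-1 / 2 * u) ≤ E := Real.exp_le_exp.2 (by linarith)
  have h3 : ∀ j : ℕ, Real.exp (-(2 * j + 5 / 2) * u) ≤ E := fun j => Real.exp_le_exp.2 (by
    have : 0 ≤ (j : ℝ) * u := by positivity
    nlinarith)
  have h4 : |u * Real.exp (1 / 2 * u)| ≤ E := by
    rw [abs_of_nonneg (by positivity)]
    have : u ≤ Real.exp (3 / 2 * u) := by linarith [Real.add_one_le_exp (3 / 2 * u)]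
    calc _ ≤ Real.exp (3 / 2 * u) * Real.exp (1 / 2 * u) := by gcongr
      _ = E := by rw [← Real.exp_add]; congr 1; ring
  have h5 : |(1 + c + b) * Real.exp (1 / 2 * u)| ≤ 21 / 10 * E := by
    rw [abs_mul, Real.abs_exp]
    refine mul_le_mul (abs_le.2 ⟨?_, ?_⟩) h1 (by positivity) (by norm_num) <;> linarith
  have h6 : |(1 + c - b) * Real.exp (-1 / 2 * u)| ≤ 21 / 10 * E := by
    rw [abs_mul, Real.abs_exp]
    refine mul_le_mul (abs_le.2 ⟨?_, ?_⟩) h2 (by positivity) (by norm_num) <;> linarith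
  have h7 : |∑ j ∈ Finset.range 9, (-1 / (2 * (j : ℝ) + 3) * Real.exp (1 / 2 * u) +
    1 / (2 * j + 2) * Real.exp (-1 / 2 * u) -
    1 / ((2 * j + 2) * (2 * j + 3)) * Real.exp (-(2 * j + 5 / 2) * u))| ≤ 4 * E := by
    calc _ ≤ ∑ j ∈ Finset.range 9, (1 / (2 * (j : ℝ) + 3) + 1 / (2 * j + 2) +
          1 / ((2 * j + 2) * (2 * j + 3))) * E := by
          refine (Finset.abs_sum_le_sum_abs _ _).trans (Finset.sum_le_sum fun j _ => ?_)
          have p1 : 0 ≤ 1 / (2 * (j : ℝ) + 3) := by positivity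
          have p2 : 0 ≤ 1 / (2 * (j : ℝ) + 2) := by positivity
          have p3 : 0 ≤ 1 / ((2 * (j : ℝ) + 2) * (2 * j + 3)) := by positivity
          have q1 := mul_le_mul_of_nonneg_left h1 p1
          have q2 := mul_le_mul_of_nonneg_left h2 p2
          have q3 := mul_le_mul_of_nonneg_left (h3 j) p3
          have r1 := mul_nonneg p1 (Real.exp_pos (1 / 2 * u)).le
          have r2 := mul_nonneg p2 (Real.exp_pos (-1 / 2 * u)).le
          have r3 := mul_nonneg p3 (Real.exp_pos (-(2 * j + 5 / 2) * u)).le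
          rw [neg_div, neg_mul, abs_le]
          constructor <;> linarith
      _ = (∑ j ∈ Finset.range 9, (1 / (2 * (j : ℝ) + 3) + 1 / (2 * j + 2) +
          1 / ((2 * j + 2) * (2 * j + 3)))) * E := by rw [Finset.sum_mul]
      _ ≤ 4 * E := by
          refine mul_le_mul_of_nonneg_right ?_ (Real.exp_pos _).le
          simp only [Finset.sum_range_succ, Finset.sum_range_zero]; norm_num
  have hE : 0 < E := Real.exp_pos _
  rw [chebMain]
  rw [abs_le] at h4 h5 h6 h7 ⊢
  constructor <;> linarith [h4.1, h4.2, h5.1, h5.2, h6.1, h6.2, h7.1, h7.2]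

theorem abs_chebSum_sub_le (hRH : RiemannHypothesis) : ∃ c b : ℝ, |c| ≤ 1 ∧ |b| ≤ 1 / 10 ∧
    ∀ u : ℝ, 0 < u → |chebSum u - chebMain c b u| ≤ 1 / 4 := by
  obtain ⟨Q₁, Q₂, c, b, hc, hb, hQ₁, hQ₁', hQ₂, hQ₂', hQ, hB⟩ := exists_posReal_decomposition hRH
  refine ⟨c, b, hc, hb, fun u hu => ?_⟩
  have hcont : Continuous fun u => chebSum u - chebMain c b u :=
    continuous_chebSum.sub (continuous_chebMain c b)
  have hM : ∀ t : ℝ, 0 < t → |chebSum t - chebMain c b t| ≤ 12 * Real.exp (2 * t) := by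
    intro t ht
    have h1 := chebSum_le ht
    have h2 := abs_chebMain_le c b hc hb ht
    have h3 : Real.exp (3 / 2 * t) ≤ Real.exp (2 * t) := Real.exp_le_exp.2 (by linarith)
    have h4 := abs_sub (chebSum t) (chebMain c b t)
    rw [abs_of_nonneg (chebSum_nonneg t)] at h4
    linarith
  have := abs_le_of_laplace hcont.measurable hM (by norm_num) hQ₁ hQ₁' hQ₂ hQ₂' (fun z hz => ?_) hB hu
    hcont.continuousAt
  · linarith
  · have hz' : 1 / 2 < z.re := by linarith
    rw [((hasLaplace_chebSum hz).sub (hasLaplace_chebMain c b hz')).2]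
    have hq := hQ z hz'
    have hne : ∀ a : ℝ, a ≤ 1 / 2 → z - a ≠ 0 := fun a ha h => by
      have := congrArg Complex.re h
      simp at this; linarith
    have h1 : z - 1 / 2 ≠ 0 := by simpa using hne (1 / 2) le_rfl
    have h2 : z + 1 / 2 ≠ 0 := by simpa [neg_div] using hne (-1 / 2) (by norm_num)
    have e4 : (1 / 4 - z ^ 2) ≠ 0 := by
      rw [show (1 / 4 - z ^ 2) = -((z - 1 / 2) * (z + 1 / 2)) by ring]
      exact neg_ne_zero.2 (mul_ne_zero h1 h2)
    rw [← sub_div, div_eq_iff e4, mul_comm (Q₁ z - Q₂ z), hq]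
    ring

theorem chebSum_log {x : ℝ} (hx : 1 < x) :
    √x * chebSum (Real.log x) = ∑ n ∈ Finset.range (⌊x⌋₊ + 1), vonMangoldt n * (x / n - 1) := by
  have hx0 : 0 < x := by linarith
  have hs : 0 < √x := Real.sqrt_pos.2 hx0
  have h1 : Real.exp (Real.log x / 2) = √x := by
    rw [Real.exp_half, Real.exp_log hx0]
  have h2 : Real.exp (-Real.log x / 2) = 1 / √x := by
    rw [neg_div, Real.exp_neg, h1, one_div]
  rw [chebSum_eq (N := ⌊x⌋₊ + 1) (by rw [Real.exp_log hx0]; push_cast; exact (Nat.lt_floor_add_one x).le),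
    Finset.mul_sum]
  refine Finset.sum_congr rfl fun n hn => ?_
  rw [chebTerm_eq_of_le, h1, h2]
  · have : √x * √x = x := Real.mul_self_sqrt hx0.le
    calc _ = vonMangoldt n * ((√x * √x) / n - √x / √x) := by ring
      _ = _ := by rw [this, div_self hs.ne']
  · rw [Real.exp_log hx0]
    exact (Nat.le_floor_iff hx0.le).1 (by simpa [Nat.lt_succ_iff] using hn)

/-- Explicit square-root error term for the integrated Chebyshev function under the
Riemann hypothesis. -/
theorem abs_sum_vonMangoldt_mul_sub_le (hRH : RiemannHypothesis) : ∃ α : ℝ, |α| ≤ 4 ∧ ∀ x : ℝ, 1 < x →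
    |∑ n ∈ Finset.range (⌊x⌋₊ + 1), vonMangoldt n * (x / n - 1) - x * Real.log x - α * x| ≤
      √x / 4 + 4 := by
  obtain ⟨c, b, hc, hb, H⟩ := abs_chebSum_sub_le hRH
  rw [abs_le] at hc hb
  set S : ℝ := ∑ j ∈ Finset.range 9, 1 / (2 * (j : ℝ) + 3) with hS
  have hSb : 0 ≤ S ∧ S ≤ 5 / 4 := by
    rw [hS]; simp only [Finset.sum_range_succ, Finset.sum_range_zero]; norm_num
  clear_value S
  refine ⟨-(1 + c + b + S), by rw [abs_le]; constructor <;> linarith [hc.1, hc.2, hb.1, hb.2, hSb.1, hSb.2], fun x hx => ?_⟩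
  have hx0 : 0 < x := by linarith
  have hs : 0 < √x := Real.sqrt_pos.2 hx0
  have hss : √x * √x = x := Real.mul_self_sqrt hx0.le
  have hl : 0 < Real.log x := Real.log_pos hx
  rw [← chebSum_log hx]
  set u := Real.log x
  have h1 : Real.exp (1 / 2 * u) = √x := by
    rw [one_div_mul_eq_div, Real.exp_half, Real.exp_log hx0]
  have h2 : Real.exp (-1 / 2 * u) = 1 / √x := by
    rw [show -1 / 2 * u = -(1 / 2 * u) by ring, Real.exp_neg, h1, one_div]
  have h3 : ∀ j : ℕ, √x * Real.exp (-(2 * j + 5 / 2) * u) ∈ Icc (0 : ℝ) 1 := by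
    intro j
    refine ⟨by positivity, ?_⟩
    rw [← h1, ← Real.exp_add, Real.exp_le_one_iff]
    have : 0 ≤ (j : ℝ) := by positivity
    nlinarith
  set T : ℝ := ∑ j ∈ Finset.range 9, (1 / (2 * (j : ℝ) + 2) -
    1 / ((2 * j + 2) * (2 * j + 3)) * (√x * Real.exp (-(2 * j + 5 / 2) * u))) with hT
  have hmain : √x * chebMain c b u = x * u + -(1 + c + b + S) * x + (1 + c - b) + T := by
    rw [chebMain, h1, h2, mul_add, Finset.mul_sum, hT, hS]
    have e1 : √x * (u * √x - (1 + c + b) * √x + (1 + c - b) * (1 / √x)) =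
        x * u - (1 + c + b) * x + (1 + c - b) := by
      calc _ = (√x * √x) * u - (1 + c + b) * (√x * √x) + (1 + c - b) * (√x / √x) := by ring
        _ = _ := by rw [hss, div_self hs.ne']; ring
    have e2 : ∀ j : ℕ, √x * (-1 / (2 * (j : ℝ) + 3) * √x + 1 / (2 * j + 2) * (1 / √x) -
        1 / ((2 * j + 2) * (2 * j + 3)) * Real.exp (-(2 * j + 5 / 2) * u)) =
        -(1 / (2 * (j : ℝ) + 3)) * x + (1 / (2 * (j : ℝ) + 2) -
    1 / ((2 * j + 2) * (2 * j + 3)) * (√x * Real.exp (-(2 * j + 5 / 2) * u))) := by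
      intro j
      calc _ = -(1 / (2 * (j : ℝ) + 3)) * (√x * √x) + (1 / (2 * (j : ℝ) + 2) * (√x / √x) -
        1 / ((2 * j + 2) * (2 * j + 3)) * (√x * Real.exp (-(2 * j + 5 / 2) * u))) := by ring
        _ = _ := by rw [hss, div_self hs.ne']; ring
    rw [e1, Finset.sum_congr rfl fun j _ => e2 j, Finset.sum_add_distrib, ← Finset.sum_mul,
      Finset.sum_neg_distrib]
    ring
  have hT0 : 0 ≤ T := by
    refine Finset.sum_nonneg fun j _ => ?_
    have h4 := (h3 j).2
    have g1 : (1:ℝ) ≤ 2 * j + 3 := by have : 0 ≤ (j : ℝ) := by positivity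
                                      linarith
    have g2 : (0:ℝ) < 2 * j + 2 := by positivity
    have : 1 / ((2 * (j:ℝ) + 2) * (2 * j + 3)) * (√x * Real.exp (-(2 * j + 5 / 2) * u)) ≤
        1 / (2 * j + 2) * 1 := by
      refine mul_le_mul ?_ h4 (h3 j).1 (by positivity)
      exact one_div_le_one_div_of_le g2 (by nlinarith)
    linarith
  have hT1 : T ≤ 29 / 20 := by
    calc T ≤ ∑ j ∈ Finset.range 9, 1 / (2 * (j : ℝ) + 2) := by
          refine Finset.sum_le_sum fun j _ => ?_
          have := mul_nonneg (by positivity : 0 ≤ 1 / ((2 * (j:ℝ) + 2) * (2 * j + 3))) (h3 j).1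
          linarith
      _ ≤ _ := by simp only [Finset.sum_range_succ, Finset.sum_range_zero]; norm_num
  have h5 := mul_le_mul_of_nonneg_left (H u hl) hs.le
  rw [← abs_of_pos hs, ← abs_mul, mul_sub, abs_of_pos hs, hmain] at h5
  rw [abs_le] at h5 ⊢
  constructor <;> linarith [h5.1, h5.2, hc.1, hc.2, hb.1, hb.2]

end

section

open Complex Metric Filter Topology MeasureTheory Set Asymptotics ArithmeticFunction
open scoped BigOperators Nat ComplexConjugate

theorem sum_vonMangoldt_eq_max {x Y : ℝ} (hx : 0 ≤ x) (hxY : x ≤ Y) :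
    ∑ n ∈ Finset.range (⌊x⌋₊ + 1), vonMangoldt n * (x / n - 1) =
      ∑ n ∈ Finset.range (⌊Y⌋₊ + 1), vonMangoldt n * max (x / n - 1) 0 := by
  have hsub : Finset.range (⌊x⌋₊ + 1) ⊆ Finset.range (⌊Y⌋₊ + 1) :=
    Finset.range_mono (Nat.succ_le_succ (Nat.floor_mono hxY))
  rw [← Finset.sum_subset hsub]
  · refine Finset.sum_congr rfl fun n hn => ?_
    rcases Nat.eq_zero_or_pos n with rfl | hn0
    · simp
    have hn' : (0 : ℝ) < n := by exact_mod_cast hn0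
    have : (n : ℝ) ≤ x := (Nat.le_floor_iff hx).1 (by simpa [Nat.lt_succ_iff] using hn)
    rw [max_eq_left]
    rw [sub_nonneg, le_div_iff₀ hn']; linarith
  · intro n _ hn
    have h : x < n := (Nat.floor_lt hx).1 (by simpa [Nat.lt_succ_iff] using hn)
    have hn' : (0 : ℝ) < n := hx.trans_lt h
    rw [max_eq_right, mul_zero]
    rw [sub_nonpos, div_le_one hn']; exact h.le

theorem integral_mul_max_eq {f f₁ f₂ : ℝ → ℝ} {a y Y : ℝ} (ha : 0 < a) (hay : a ≤ y) (hy : y ≤ Y)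
    (h₁ : ∀ x ∈ Icc a Y, HasDerivAt f (f₁ x) x) (h₂ : ∀ x ∈ Icc a Y, HasDerivAt f₁ (f₂ x) x)
    (hc : ContinuousOn f₂ (Icc a Y)) (hfY : f Y = 0) :
    ∫ x in a..Y, f₂ x * max (x / y - 1) 0 = f₁ Y * (Y / y - 1) + f y / y := by
  have hy0 : 0 < y := by linarith
  have hcm : ContinuousOn (fun x => f₂ x * max (x / y - 1) 0) (Icc a Y) :=
    hc.mul (Continuous.continuousOn (by fun_prop))
  have i1 : IntervalIntegrable (fun x => f₂ x * max (x / y - 1) 0) volume a y :=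
    (hcm.mono (Icc_subset_Icc_right hy)).intervalIntegrable_of_Icc hay
  have i2 : IntervalIntegrable (fun x => f₂ x * max (x / y - 1) 0) volume y Y :=
    (hcm.mono (Icc_subset_Icc_left hay)).intervalIntegrable_of_Icc hy
  rw [← intervalIntegral.integral_add_adjacent_intervals i1 i2]
  have e1 : ∫ x in a..y, f₂ x * max (x / y - 1) 0 = 0 := by
    rw [intervalIntegral.integral_congr (g := fun _ => (0 : ℝ))]
    · simp
    · intro x hx
      rw [uIcc_of_le hay] at hx
      beta_reduce
      rw [max_eq_right, mul_zero]
      rw [sub_nonpos, div_le_one hy0]; exact hx.2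
  have e2 : ∫ x in y..Y, f₂ x * max (x / y - 1) 0 = ∫ x in y..Y, f₂ x * (x / y - 1) := by
    refine intervalIntegral.integral_congr fun x hx => ?_
    rw [uIcc_of_le hy] at hx
    rw [max_eq_left]
    rw [sub_nonneg, le_div_iff₀ hy0]; linarith [hx.1]
  have e3 : ∫ x in y..Y, f₂ x * (x / y - 1) =
      (f₁ Y * (Y / y - 1) - f Y / y) - (f₁ y * (y / y - 1) - f y / y) := by
    refine intervalIntegral.integral_eq_sub_of_hasDerivAt
      (f := fun x => f₁ x * (x / y - 1) - f x / y) (fun x hx => ?_) ?_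
    · rw [uIcc_of_le hy] at hx
      have hx' : x ∈ Icc a Y := ⟨hay.trans hx.1, hx.2⟩
      have := ((h₂ x hx').mul (((hasDerivAt_id x).div_const y).sub_const 1)).sub ((h₁ x hx').div_const y)
      refine this.congr_deriv ?_
      simp only [id]; ring
    · refine ContinuousOn.intervalIntegrable_of_Icc hy ?_
      exact (hc.mono (Icc_subset_Icc_left hay)).mul (Continuous.continuousOn (by fun_prop))
  rw [e1, e2, e3, hfY, div_self (ne_of_gt hy0)]
  ring

/-- Summation of a smooth weight against the von Mangoldt function, given an explicit bound
for the integrated Chebyshev function. -/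
theorem abs_sum_vonMangoldt_mul_sub_integral_le {α : ℝ} (hα : |α| ≤ 4)
    (hW : ∀ x : ℝ, 1 < x →
      |∑ n ∈ Finset.range (⌊x⌋₊ + 1), vonMangoldt n * (x / n - 1) - x * Real.log x - α * x| ≤
        √x / 4 + 4)
    {f f₁ f₂ : ℝ → ℝ} {Y c₀ c₁ : ℝ} (hY : 2 ≤ Y)
    (h₁ : ∀ x ∈ Icc 2 Y, HasDerivAt f (f₁ x) x) (h₂ : ∀ x ∈ Icc 2 Y, HasDerivAt f₁ (f₂ x) x)
    (hc : ContinuousOn f₂ (Icc 2 Y)) (hfY : f Y = 0)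
    (hb : ∀ x ∈ Icc 2 Y, |f₂ x| * (√x / 4 + 4) ≤ c₀ + c₁ * x) (hc₀ : 0 ≤ c₀) (hc₁ : 0 ≤ c₁) :
    |∑ n ∈ Finset.range (⌊Y⌋₊ + 1), vonMangoldt n * (f n / n) - ∫ x in (2 : ℝ)..Y, f x / x| ≤
      c₀ * Y + c₁ * (Y ^ 2 / 2) + |f₁ Y| * (√Y / 4 + 4) + |f₁ 2| * 10 + |f 2| * 6 := by
  set W : ℝ → ℝ := fun x => ∑ n ∈ Finset.range (⌊Y⌋₊ + 1), vonMangoldt n * max (x / n - 1) 0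
  have hWc : Continuous W := by
    refine continuous_finsetSum _ fun n _ => ?_
    fun_prop
  have hWb : ∀ x ∈ Icc 2 Y, |W x - (x * Real.log x + α * x)| ≤ √x / 4 + 4 := fun x hx => by
    have := hW x (by linarith [hx.1])
    rw [sum_vonMangoldt_eq_max (by linarith [hx.1]) hx.2] at this
    rwa [← sub_sub]
  have hfc : ContinuousOn f (Icc 2 Y) := fun x hx => (h₁ x hx).continuousAt.continuousWithinAt
  have hMc : ContinuousOn (fun x : ℝ => x * Real.log x + α * x) (Icc 2 Y) := by
    refine ContinuousOn.add (continuousOn_id.mul (Real.continuousOn_log.mono ?_))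
      (Continuous.continuousOn (by fun_prop))
    intro x hx; simp only [mem_compl_iff, mem_singleton_iff]; linarith [hx.1]
  have hgc : ContinuousOn (fun x => f x / x) (Icc 2 Y) :=
    hfc.div continuousOn_id fun x hx => by linarith [hx.1]
  have e1 : ∑ n ∈ Finset.range (⌊Y⌋₊ + 1), vonMangoldt n * (f n / n) =
      (∫ x in (2 : ℝ)..Y, f₂ x * W x) - f₁ Y * W Y := by
    have : ∀ x, f₂ x * W x =
        ∑ n ∈ Finset.range (⌊Y⌋₊ + 1), vonMangoldt n * (f₂ x * max (x / n - 1) 0) := fun x => by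
      simp only [W]; rw [Finset.mul_sum]; exact Finset.sum_congr rfl fun _ _ => by ring
    simp only [this]
    rw [intervalIntegral.integral_finsetSum, Finset.mul_sum, ← Finset.sum_sub_distrib]
    · refine Finset.sum_congr rfl fun n hn => ?_
      rw [intervalIntegral.integral_const_mul]
      rcases lt_or_ge n 2 with h | h
      · have : vonMangoldt n = 0 := by interval_cases n <;> simp
        simp [this]
      have h2 : (2 : ℝ) ≤ n := by exact_mod_cast h
      have hnY : (n : ℝ) ≤ Y := (Nat.le_floor_iff (by linarith)).1 (by simpa [Nat.lt_succ_iff] using hn)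
      rw [integral_mul_max_eq two_pos h2 hnY h₁ h₂ hc hfY, max_eq_left]
      · ring
      · rw [sub_nonneg, le_div_iff₀ (by linarith)]; linarith
    · intro n _
      refine ContinuousOn.intervalIntegrable_of_Icc hY ?_
      exact continuousOn_const.mul (hc.mul (Continuous.continuousOn (by fun_prop)))
  have hiM : IntervalIntegrable (fun x => f₂ x * (x * Real.log x + α * x)) volume 2 Y :=
    (hc.mul hMc).intervalIntegrable_of_Icc hY
  have hig : IntervalIntegrable (fun x => f x / x) volume 2 Y := hgc.intervalIntegrable_of_Icc hY
  have hiW : IntervalIntegrable (fun x => f₂ x * W x) volume 2 Y :=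
    (hc.mul hWc.continuousOn).intervalIntegrable_of_Icc hY
  have e2 : (∫ x in (2 : ℝ)..Y, (f₂ x * (x * Real.log x + α * x) - f x / x)) =
      (f₁ Y * (Y * Real.log Y + α * Y) - f Y * (Real.log Y + 1 + α)) -
      (f₁ 2 * (2 * Real.log 2 + α * 2) - f 2 * (Real.log 2 + 1 + α)) := by
    refine intervalIntegral.integral_eq_sub_of_hasDerivAt
      (f := fun x => f₁ x * (x * Real.log x + α * x) - f x * (Real.log x + 1 + α))
      (fun x hx => ?_) (hiM.sub hig)
    rw [uIcc_of_le hY] at hx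
    have hx0 : x ≠ 0 := by linarith [hx.1]
    have hl := Real.hasDerivAt_log hx0
    have := ((h₂ x hx).mul (((hasDerivAt_id x).mul hl).add ((hasDerivAt_id x).const_mul α))).sub
      ((h₁ x hx).mul ((hl.add_const 1).add_const α))
    refine this.congr_deriv ?_
    simp only [id, Pi.add_apply, Pi.mul_apply]
    field_simp
    ring
  rw [intervalIntegral.integral_sub hiM hig, hfY] at e2
  have e3 : |∫ x in (2 : ℝ)..Y, (f₂ x * W x - f₂ x * (x * Real.log x + α * x))| ≤
      c₀ * Y + c₁ * (Y ^ 2 / 2) := by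
    have hi : IntervalIntegrable (fun x : ℝ => c₀ + c₁ * x) volume 2 Y :=
      (Continuous.intervalIntegrable (by fun_prop) _ _)
    have h := intervalIntegral.norm_integral_le_of_norm_le (μ := volume) hY
      (f := fun x => f₂ x * W x - f₂ x * (x * Real.log x + α * x)) (g := fun x => c₀ + c₁ * x)
      (ae_of_all _ fun x hx => ?_) hi
    · rw [Real.norm_eq_abs] at h
      refine h.trans ?_
      rw [intervalIntegral.integral_add (by simp)
        (Continuous.intervalIntegrable (by fun_prop) _ _), intervalIntegral.integral_const_mul,
        integral_id, intervalIntegral.integral_const, smul_eq_mul]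
      nlinarith
    · have hx' : x ∈ Icc 2 Y := ⟨hx.1.le, hx.2⟩
      rw [← mul_sub, norm_mul, Real.norm_eq_abs, Real.norm_eq_abs]
      exact (mul_le_mul_of_nonneg_left (hWb x hx') (abs_nonneg _)).trans (hb x hx')
  rw [intervalIntegral.integral_sub hiW hiM] at e3
  have e4 : |f₁ Y * (W Y - (Y * Real.log Y + α * Y))| ≤ |f₁ Y| * (√Y / 4 + 4) := by
    rw [abs_mul]
    exact mul_le_mul_of_nonneg_left (hWb Y ⟨hY, le_rfl⟩) (abs_nonneg _)
  have hl2 : 0 < Real.log 2 := Real.log_pos (by norm_num)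
  have hl2' : Real.log 2 < 1 := by linarith [Real.log_two_lt_d9]
  rw [abs_le] at hα
  have e5 : |f₁ 2 * (2 * Real.log 2 + α * 2)| ≤ |f₁ 2| * 10 := by
    rw [abs_mul]
    refine mul_le_mul_of_nonneg_left (abs_le.2 ⟨?_, ?_⟩) (abs_nonneg _) <;> linarith [hα.1, hα.2]
  have e6 : |f 2 * (Real.log 2 + 1 + α)| ≤ |f 2| * 6 := by
    rw [abs_mul]
    refine mul_le_mul_of_nonneg_left (abs_le.2 ⟨?_, ?_⟩) (abs_nonneg _) <;> linarith [hα.1, hα.2]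
  rw [e1]
  rw [abs_le] at e3 e4 e5 e6 ⊢
  constructor <;> linarith [e3.1, e3.2, e4.1, e4.2, e5.1, e5.2, e6.1, e6.2]

/-- Lower bound for the Chebyshev function obtained from the integrated Chebyshev function. -/
theorem le_sum_vonMangoldt {α : ℝ}
    (hW : ∀ x : ℝ, 1 < x →
      |∑ n ∈ Finset.range (⌊x⌋₊ + 1), vonMangoldt n * (x / n - 1) - x * Real.log x - α * x| ≤
        √x / 4 + 4) {x : ℝ} (hx : 2 ≤ x) :
    10 / 11 * x - 6 * √x - 90 ≤ Chebyshev.psi x := by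
  have hx0 : 0 < x := by linarith
  set y := 10 / 11 * x with hy
  have h1 := hW x (by linarith)
  have h2 := hW y (by linarith)
  rw [sum_vonMangoldt_eq_max (by linarith) le_rfl] at h1
  rw [sum_vonMangoldt_eq_max (Y := x) (by linarith) (by linarith)] at h2
  have hs : √y ≤ √x := Real.sqrt_le_sqrt (by linarith)
  have hlog : Real.log y = Real.log x + Real.log (10 / 11) := by
    rw [hy, Real.log_mul (by norm_num) hx0.ne']; ring
  have hlog' : Real.log (10 / 11) ≤ -(1 / 11) := by
    linarith [Real.log_le_sub_one_of_pos (show (0 : ℝ) < 10 / 11 by norm_num)]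
  have key : ∑ n ∈ Finset.range (⌊x⌋₊ + 1), vonMangoldt n * max (x / n - 1) 0 -
      11 / 10 * ∑ n ∈ Finset.range (⌊x⌋₊ + 1), vonMangoldt n * max (y / n - 1) 0 ≤
      1 / 10 * Chebyshev.psi x := by
    rw [Chebyshev.psi_eq_sum_Icc, Finset.range_eq_Ico, Finset.mul_sum, Finset.mul_sum,
      ← Finset.sum_sub_distrib]
    refine Finset.sum_le_sum fun n hn => ?_
    have hn' : n ≤ ⌊x⌋₊ := by simpa [Nat.lt_succ_iff] using hn
    rcases Nat.eq_zero_or_pos n with rfl | hn0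
    · simp
    have hnr : (0 : ℝ) < n := by exact_mod_cast hn0
    have hnx : (n : ℝ) ≤ x := (Nat.le_floor_iff hx0.le).1 hn'
    have e1 : max (x / n - 1) 0 = x / n - 1 := by
      rw [max_eq_left]
      rw [sub_nonneg, le_div_iff₀ hnr]; linarith
    have e2 : y / n - 1 ≤ max (y / n - 1) 0 := le_max_left _ _
    have e3 : y / n = 10 / 11 * (x / n) := by rw [hy]; ring
    rw [e1]
    have : vonMangoldt n * (x / n - 1 - 11 / 10 * max (y / n - 1) 0) ≤ vonMangoldt n * (1 / 10) :=
      mul_le_mul_of_nonneg_left (by linarith) vonMangoldt_nonneg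
    linarith
  rw [abs_le] at h1 h2
  rw [hlog] at h2
  have h3 : x * Real.log (10 / 11) ≤ x * -(1 / 11) := mul_le_mul_of_nonneg_left hlog' hx0.le
  have e4 : 11 / 10 * (y * (Real.log x + Real.log (10 / 11)) + α * y) =
      x * Real.log x + x * Real.log (10 / 11) + α * x := by rw [hy]; ring
  have := h1.1
  have := h2.2
  have := Real.sqrt_nonneg x
  linarith

end

section

open Complex Metric Filter Topology MeasureTheory Set Asymptotics ArithmeticFunction
open scoped BigOperators Nat ComplexConjugate

theorem log_three_mul_ten_pow_lt : Real.log (3 * 10 ^ 13) < 156 / 5 := by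
  have h : Real.log (3 * 10 ^ 13) ≤ Real.log (2 ^ 45) := Real.log_le_log (by norm_num) (by norm_num)
  rw [Real.log_pow] at h
  refine h.trans_lt ?_
  push_cast
  linarith [Real.log_two_lt_d9]

theorem lt_log_three_mul_ten_pow : 61 / 2 - 1 / 100 < Real.log (3 * 10 ^ 13) := by
  have h : Real.log (2 ^ 44) ≤ Real.log (3 * 10 ^ 13) := Real.log_le_log (by norm_num) (by norm_num)
  rw [Real.log_pow] at h
  refine lt_of_lt_of_le ?_ h
  push_cast
  linarith [Real.log_two_gt_d9]

theorem exp_two_lt : Real.exp 2 < 9 := by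
  have := Real.exp_one_lt_d9
  rw [show (2 : ℝ) = 1 + 1 by norm_num, Real.exp_add]
  nlinarith [Real.exp_pos 1]

theorem le_sqrt_div_log {Y : ℝ} (hY : 3 * 10 ^ 13 ≤ Y) : 1000 ≤ √Y / Real.log Y := by
  have h0 : (0 : ℝ) < 3 * 10 ^ 13 := by norm_num
  have hl : 0 < Real.log Y := Real.log_pos (by linarith)
  have hs : 0 < √Y := Real.sqrt_pos.2 (by linarith)
  have he := exp_two_lt
  have h := Real.log_div_sqrt_antitoneOn (a := 3 * 10 ^ 13) (b := Y)
    (he.le.trans (by norm_num)) (he.le.trans (le_trans (by norm_num) hY)) hY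
  beta_reduce at h
  have hs0 : (10 ^ 6 : ℝ) ≤ √(3 * 10 ^ 13) := Real.le_sqrt_of_sq_le (by norm_num)
  have h2 : Real.log (3 * 10 ^ 13) / √(3 * 10 ^ 13) ≤ 1 / 1000 := by
    rw [div_le_div_iff₀ (by linarith) (by norm_num)]
    have := log_three_mul_ten_pow_lt
    generalize Real.log (3 * 10 ^ 13) = a at *
    generalize √(3 * 10 ^ 13) = b at *
    linarith
  have h3 := h.trans h2
  rw [div_le_div_iff₀ hs (by norm_num)] at h3
  rw [le_div_iff₀ hl]; linarith

theorem sqrt_div_log_le {x Y : ℝ} (hx : 2 ≤ x) (hxY : x ≤ Y) (hY : 3 * 10 ^ 13 ≤ Y) :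
    (√x / 4 + 4) / Real.log x ≤ 13 / 50 * (√Y / Real.log Y) := by
  have hS := le_sqrt_div_log hY
  have hlx : 0 < Real.log x := Real.log_pos (by linarith)
  have hlY : 0 < Real.log Y := Real.log_pos (by linarith)
  have hl2 : (2 : ℝ) / 3 ≤ Real.log x :=
    le_trans (by linarith [Real.log_two_gt_d9]) (Real.log_le_log two_pos hx)
  have h4 : 4 / Real.log x ≤ 6 := by rw [div_le_iff₀ hlx]; linarith
  have he := exp_two_lt
  have key : √x / Real.log x ≤ √Y / Real.log Y := by
    rcases le_total (Real.exp 2) x with h | h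
    · have hx0 : 0 < √x := Real.sqrt_pos.2 (by linarith)
      have hY0 : 0 < √Y := Real.sqrt_pos.2 (by linarith)
      have := Real.log_div_sqrt_antitoneOn (a := x) (b := Y) h (h.trans hxY) hxY
      beta_reduce at this
      rw [div_le_div_iff₀ hY0 hx0] at this
      rw [div_le_div_iff₀ hlx hlY]; linarith
    · have hs : √x ≤ 3 := Real.sqrt_le_iff.2 ⟨by norm_num, by linarith⟩
      refine le_trans ?_ hS
      rw [div_le_iff₀ hlx]; linarith
  rw [add_div, show √x / 4 / Real.log x = 1 / 4 * (√x / Real.log x) by ring]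
  linarith

/-- `x * sin (θ x) / log x`, the weight whose quotient by `x` detects the sign of residues. -/
noncomputable def sinWeight (θ x : ℝ) : ℝ := x * Real.sin (θ * x) / Real.log x

/-- The derivative of `sinWeight`. -/
noncomputable def sinWeightDeriv (θ x : ℝ) : ℝ :=
  Real.sin (θ * x) / Real.log x + θ * x * Real.cos (θ * x) / Real.log x -
    Real.sin (θ * x) / Real.log x ^ 2

/-- The second derivative of `sinWeight`. -/
noncomputable def sinWeightDerivTwo (θ x : ℝ) : ℝ :=
  -(θ ^ 2 * x * Real.sin (θ * x) / Real.log x) + 2 * θ * Real.cos (θ * x) / Real.log x -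
    2 * θ * Real.cos (θ * x) / Real.log x ^ 2 - Real.sin (θ * x) / (x * Real.log x ^ 2) +
    2 * Real.sin (θ * x) / (x * Real.log x ^ 3)

theorem hasDerivAt_sinWeight (θ : ℝ) {x : ℝ} (hx : 1 < x) :
    HasDerivAt (sinWeight θ) (sinWeightDeriv θ x) x := by
  have hx0 : x ≠ 0 := by linarith
  have hl : Real.log x ≠ 0 := (Real.log_pos hx).ne'
  have hs : HasDerivAt (fun x => Real.sin (θ * x)) (Real.cos (θ * x) * (θ * 1)) x :=
    ((hasDerivAt_id x).const_mul θ).sin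
  refine (((hasDerivAt_id x).mul hs).div (Real.hasDerivAt_log hx0) hl).congr_deriv ?_
  simp only [sinWeightDeriv, Pi.mul_apply, id]
  field_simp

theorem hasDerivAt_sinWeightDeriv (θ : ℝ) {x : ℝ} (hx : 1 < x) :
    HasDerivAt (sinWeightDeriv θ) (sinWeightDerivTwo θ x) x := by
  have hx0 : x ≠ 0 := by linarith
  have hl : Real.log x ≠ 0 := (Real.log_pos hx).ne'
  have hs : HasDerivAt (fun x => Real.sin (θ * x)) (Real.cos (θ * x) * (θ * 1)) x :=
    ((hasDerivAt_id x).const_mul θ).sin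
  have hc : HasDerivAt (fun x => Real.cos (θ * x)) (-Real.sin (θ * x) * (θ * 1)) x :=
    ((hasDerivAt_id x).const_mul θ).cos
  have hL := Real.hasDerivAt_log hx0
  refine (((hs.div hL hl).add ((((hasDerivAt_id x).const_mul θ).mul hc).div hL hl)).sub
    (hs.div (hL.pow 2) (pow_ne_zero 2 hl))).congr_deriv ?_
  simp only [sinWeightDerivTwo, Pi.mul_apply, Pi.pow_apply, id]
  field_simp
  ring

theorem continuousOn_sinWeightDerivTwo (θ Y : ℝ) : ContinuousOn (sinWeightDerivTwo θ) (Icc 2 Y) := by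
  unfold sinWeightDerivTwo
  have hlog : ContinuousOn Real.log (Icc 2 Y) := Real.continuousOn_log.mono fun x hx => by
    simp only [mem_compl_iff, mem_singleton_iff]; linarith [hx.1]
  have hne : ∀ x ∈ Icc 2 Y, Real.log x ≠ 0 := fun x hx => (Real.log_pos (by linarith [hx.1])).ne'
  have hne0 : ∀ x ∈ Icc 2 Y, x ≠ 0 := fun x hx => by linarith [hx.1]
  have hp : ∀ n : ℕ, ∀ x ∈ Icc 2 Y, x * Real.log x ^ n ≠ 0 := fun n x hx =>
    mul_ne_zero (hne0 x hx) (pow_ne_zero _ (hne x hx))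
  have hp' : ∀ n : ℕ, ∀ x ∈ Icc 2 Y, Real.log x ^ n ≠ 0 := fun n x hx => pow_ne_zero _ (hne x hx)
  have c : ∀ g : ℝ → ℝ, Continuous g → ContinuousOn g (Icc 2 Y) := fun g h => h.continuousOn
  exact (((((c _ (by fun_prop)).div hlog hne).neg.add ((c _ (by fun_prop)).div hlog hne)).sub
    ((c _ (by fun_prop)).div (hlog.pow 2) (hp' 2))).sub
    ((c _ (by fun_prop)).div (continuousOn_id.mul (hlog.pow 2)) (hp 2))).add
    ((c _ (by fun_prop)).div (continuousOn_id.mul (hlog.pow 3)) (hp 3))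

theorem abs_sin_mul_le {θ x : ℝ} (hθ : 0 ≤ θ) (hx : 0 ≤ x) : |Real.sin (θ * x)| ≤ θ * x :=
  Real.abs_sin_le_abs.trans_eq (abs_of_nonneg (by positivity))

theorem inv_log_le {x : ℝ} (hx : 2 ≤ x) : (Real.log x)⁻¹ ≤ 14428 / 10000 := by
  have hl2 : Real.log 2 ≤ Real.log x := Real.log_le_log two_pos hx
  have h := Real.log_two_gt_d9
  rw [inv_le_comm₀ (by linarith) (by norm_num)]
  linarith

theorem abs_sinWeightDerivTwo_le {θ x : ℝ} (hθ : 0 ≤ θ) (hx : 2 ≤ x) :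
    |sinWeightDerivTwo θ x| ≤ (θ ^ 2 * x + 21 / 2 * θ) / Real.log x := by
  have hs := abs_sin_mul_le hθ (show 0 ≤ x by linarith)
  have hs1 := Real.abs_sin_le_one (θ * x)
  have hc1 := Real.abs_cos_le_one (θ * x)
  have hi := inv_log_le hx
  have hi0 : 0 < (Real.log x)⁻¹ := inv_pos.2 (Real.log_pos (by linarith))
  have hx0 : 0 < x := by linarith
  set i := (Real.log x)⁻¹
  set s := Real.sin (θ * x)
  set c := Real.cos (θ * x)
  have hsx : |s / x| ≤ θ := by
    rw [abs_div, abs_of_pos hx0, div_le_iff₀ hx0]; exact hs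
  have e : sinWeightDerivTwo θ x = i * (-(θ ^ 2 * x * s) + 2 * θ * c - 2 * θ * (c * i) -
      s / x * i + 2 * (s / x * i ^ 2)) := by
    simp only [sinWeightDerivTwo, i, s, c, div_eq_mul_inv, mul_inv, inv_pow]
    ring
  have t1 : |θ ^ 2 * x * s| ≤ θ ^ 2 * x := by
    rw [abs_mul, abs_of_nonneg (by positivity)]
    exact mul_le_of_le_one_right (by positivity) hs1
  have t2 : |θ * c| ≤ θ := by
    rw [abs_mul, abs_of_nonneg hθ]; exact mul_le_of_le_one_right hθ hc1
  have t3 : |θ * c * i| ≤ θ * (14428 / 10000) := by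
    rw [abs_mul, abs_of_pos hi0]; exact mul_le_mul t2 hi hi0.le hθ
  have t4 : |s / x * i| ≤ θ * (14428 / 10000) := by
    rw [abs_mul, abs_of_pos hi0]; exact mul_le_mul hsx hi hi0.le hθ
  have t5 : |s / x * i ^ 2| ≤ θ * (14428 / 10000) ^ 2 := by
    rw [abs_mul, abs_of_pos (pow_pos hi0 2)]
    exact mul_le_mul hsx (pow_le_pow_left₀ hi0.le hi 2) (by positivity) hθ
  rw [e, abs_mul, abs_of_pos hi0,
    show (θ ^ 2 * x + 21 / 2 * θ) / Real.log x = i * (θ ^ 2 * x + 21 / 2 * θ) by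
      rw [div_eq_mul_inv, mul_comm]]
  refine mul_le_mul_of_nonneg_left ?_ hi0.le
  rw [abs_le] at *
  constructor <;> nlinarith [t1.1, t1.2, t2.1, t2.2, t3.1, t3.2, t4.1, t4.2, t5.1, t5.2]

theorem integral_one_sub_cos_div_ge {k : ℝ} (hk : 4 ≤ k) (m : ℕ) :
    ∑ j ∈ Finset.range (m + 1), 1 / ((j : ℝ) + 1) - 2 / k ≤
      ∫ x in (2 : ℝ)..((m + 1 : ℕ) * k), (1 - Real.cos (2 * Real.pi / k * x)) / x := by
  have hk0 : 0 < k := by linarith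
  set θ := 2 * Real.pi / k with hθ
  have hθ0 : 0 < θ := by positivity
  have hθk : θ * k = 2 * Real.pi := by rw [hθ]; field_simp
  have hcont : ∀ a b : ℝ, 2 ≤ a → a ≤ b →
      IntervalIntegrable (fun x => (1 - Real.cos (θ * x)) / x) volume a b := fun a b ha hab =>
    ContinuousOn.intervalIntegrable_of_Icc hab
      ((Continuous.continuousOn (by fun_prop)).div continuousOn_id fun x hx => by
        linarith [hx.1])
  have hblock : ∀ a b : ℝ, 2 ≤ a → a ≤ b →
      ((b - Real.sin (θ * b) / θ) - (a - Real.sin (θ * a) / θ)) / b ≤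
        ∫ x in a..b, (1 - Real.cos (θ * x)) / x := by
    intro a b ha hab
    have e : ∫ x in a..b, (1 - Real.cos (θ * x)) / b =
        (b - Real.sin (θ * b) / θ) / b - (a - Real.sin (θ * a) / θ) / b := by
      refine intervalIntegral.integral_eq_sub_of_hasDerivAt
        (f := fun x => (x - Real.sin (θ * x) / θ) / b) (fun x _ => ?_)
        (Continuous.intervalIntegrable (by fun_prop) _ _)
      have hs : HasDerivAt (fun x => Real.sin (θ * x)) (Real.cos (θ * x) * (θ * 1)) x :=
        ((hasDerivAt_id x).const_mul θ).sin
      refine (((hasDerivAt_id x).sub (hs.div_const θ)).div_const b).congr_deriv ?_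
      field_simp
    rw [sub_div, ← e]
    refine intervalIntegral.integral_mono_on hab
      (Continuous.intervalIntegrable (by fun_prop) _ _) (hcont a b ha hab) fun x hx => ?_
    have h1 := Real.cos_le_one (θ * x)
    exact div_le_div_of_nonneg_left (by linarith) (by linarith [hx.1]) hx.2
  have hsin : ∀ j : ℕ, Real.sin (θ * (j * k)) = 0 := fun j => by
    rw [show θ * (j * k) = (2 * j : ℕ) * Real.pi by push_cast; linear_combination j * hθk]
    exact Real.sin_nat_mul_pi _
  induction m with
  | zero =>
    have h := hblock 2 k le_rfl (by linarith)
    have h1 := hsin 1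
    rw [Nat.cast_one, one_mul] at h1
    simp only [zero_add, Nat.cast_one, one_mul, Finset.sum_range_one, Nat.cast_zero, div_one]
    refine le_trans ?_ h
    rw [h1]
    have : 0 ≤ Real.sin (θ * 2) := by
      refine Real.sin_nonneg_of_nonneg_of_le_pi (by positivity) ?_
      nlinarith
    have h2 : (k - 0 / θ - (2 - Real.sin (θ * 2) / θ)) / k = 1 - 2 / k + Real.sin (θ * 2) / θ / k := by
      field_simp; ring
    rw [h2]
    have : 0 ≤ Real.sin (θ * 2) / θ / k := by positivity
    linarith
  | succ m ih =>
    have ha : 2 ≤ ((m + 1 : ℕ) : ℝ) * k := by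
      push_cast
      have : (0 : ℝ) ≤ m := by positivity
      nlinarith
    have hab : ((m + 1 : ℕ) : ℝ) * k ≤ ((m + 1 + 1 : ℕ) : ℝ) * k := by
      gcongr; omega
    have h := hblock _ _ ha hab
    rw [← intervalIntegral.integral_add_adjacent_intervals (hcont _ _ le_rfl ha) (hcont _ _ ha hab),
      Finset.sum_range_succ]
    have e : (((m + 1 + 1 : ℕ) : ℝ) * k - Real.sin (θ * (((m + 1 + 1 : ℕ) : ℝ) * k)) / θ -
        (((m + 1 : ℕ) : ℝ) * k - Real.sin (θ * (((m + 1 : ℕ) : ℝ) * k)) / θ)) /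
        (((m + 1 + 1 : ℕ) : ℝ) * k) = 1 / (((m + 1 : ℕ) : ℝ) + 1) := by
      rw [hsin, hsin]
      push_cast
      have : (m : ℝ) + 1 + 1 ≠ 0 := by positivity
      field_simp
      ring
    rw [e] at h
    linarith

end

section

open Complex Metric Filter Topology MeasureTheory Set Asymptotics ArithmeticFunction
open scoped BigOperators Nat ComplexConjugate

theorem integral_sin_div_log_ge {θ Y : ℝ} (hθ : 0 < θ) (hY : 2 ≤ Y) :
    (∫ x in (2 : ℝ)..Y, (1 - Real.cos (θ * x)) / x) / (θ * Real.log Y ^ 2) - 3 * θ ≤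
      ∫ x in (2 : ℝ)..Y, Real.sin (θ * x) / Real.log x := by
  have hlY : 0 < Real.log Y := Real.log_pos (by linarith)
  have hlog : ContinuousOn Real.log (Icc 2 Y) := Real.continuousOn_log.mono fun x hx => by
    simp only [mem_compl_iff, mem_singleton_iff]; linarith [hx.1]
  have hne : ∀ x ∈ Icc 2 Y, Real.log x ≠ 0 := fun x hx => (Real.log_pos (by linarith [hx.1])).ne'
  have hne0 : ∀ x ∈ Icc 2 Y, x ≠ 0 := fun x hx => by linarith [hx.1]
  have i1 : IntervalIntegrable (fun x => Real.sin (θ * x) / Real.log x) volume 2 Y :=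
    ContinuousOn.intervalIntegrable_of_Icc hY
      ((Continuous.continuousOn (by fun_prop)).div hlog hne)
  have i2 : IntervalIntegrable (fun x => (1 - Real.cos (θ * x)) / x / (θ * Real.log x ^ 2)) volume 2 Y :=
    ContinuousOn.intervalIntegrable_of_Icc hY
      (((Continuous.continuousOn (by fun_prop)).div continuousOn_id hne0).div
        (continuousOn_const.mul (hlog.pow 2)) fun x hx =>
          mul_ne_zero hθ.ne' (pow_ne_zero 2 (hne x hx)))
  have i3 : IntervalIntegrable (fun x => (1 - Real.cos (θ * x)) / x / (θ * Real.log Y ^ 2)) volume 2 Y :=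
    ContinuousOn.intervalIntegrable_of_Icc hY
      (((Continuous.continuousOn (by fun_prop)).div continuousOn_id hne0).div_const _)
  have e : ∫ x in (2 : ℝ)..Y, (Real.sin (θ * x) / Real.log x -
        (1 - Real.cos (θ * x)) / x / (θ * Real.log x ^ 2)) =
      (1 - Real.cos (θ * Y)) / (θ * Real.log Y) - (1 - Real.cos (θ * 2)) / (θ * Real.log 2) := by
    refine intervalIntegral.integral_eq_sub_of_hasDerivAt
      (f := fun x => (1 - Real.cos (θ * x)) / (θ * Real.log x)) (fun x hx => ?_) (i1.sub i2)
    rw [uIcc_of_le hY] at hx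
    have hl := hne x hx
    have hx0 := hne0 x hx
    have hc : HasDerivAt (fun x => Real.cos (θ * x)) (-Real.sin (θ * x) * (θ * 1)) x :=
      ((hasDerivAt_id x).const_mul θ).cos
    refine ((hc.const_sub 1).div ((Real.hasDerivAt_log hx0).const_mul θ)
      (mul_ne_zero hθ.ne' hl)).congr_deriv ?_
    field_simp
  rw [intervalIntegral.integral_sub i1 i2] at e
  have h1 : (∫ x in (2 : ℝ)..Y, (1 - Real.cos (θ * x)) / x) / (θ * Real.log Y ^ 2) ≤
      ∫ x in (2 : ℝ)..Y, (1 - Real.cos (θ * x)) / x / (θ * Real.log x ^ 2) := by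
    rw [← intervalIntegral.integral_div]
    refine intervalIntegral.integral_mono_on hY i3 i2 fun x hx => ?_
    have hlx : 0 < Real.log x := Real.log_pos (by linarith [hx.1])
    have hlxY : Real.log x ≤ Real.log Y := Real.log_le_log (by linarith [hx.1]) hx.2
    have hnn : 0 ≤ (1 - Real.cos (θ * x)) / x :=
      div_nonneg (by linarith [Real.cos_le_one (θ * x)]) (by linarith [hx.1])
    exact div_le_div_of_nonneg_left hnn (by positivity) (by gcongr)
  have h2 : 0 ≤ (1 - Real.cos (θ * Y)) / (θ * Real.log Y) :=
    div_nonneg (by linarith [Real.cos_le_one (θ * Y)]) (by positivity)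
  have hl2 : 0 < Real.log 2 := Real.log_pos (by norm_num)
  have h3 : (1 - Real.cos (θ * 2)) / (θ * Real.log 2) ≤ 3 * θ := by
    rw [div_le_iff₀ (by positivity)]
    have := Real.one_sub_sq_div_two_le_cos (x := θ * 2)
    have h4 := Real.log_two_gt_d9
    nlinarith [mul_pos hθ hθ]
  linarith

/-- Lower bound for the sine sum over prime powers up to a multiple of `k`. -/
theorem sum_vonMangoldt_mul_sin_ge {α : ℝ} (hα : |α| ≤ 4)
    (hW : ∀ x : ℝ, 1 < x →
      |∑ n ∈ Finset.range (⌊x⌋₊ + 1), vonMangoldt n * (x / n - 1) - x * Real.log x - α * x| ≤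
        √x / 4 + 4) {k m : ℕ} (hk : 3 * 10 ^ 13 ≤ k) (hm : 1 ≤ m) :
    (∑ j ∈ Finset.range m, 1 / ((j : ℝ) + 1)) / (2 * Real.pi / k * Real.log ((m * k : ℕ) : ℝ) ^ 2) -
      13 / 50 * (√((m * k : ℕ) : ℝ) / Real.log ((m * k : ℕ) : ℝ)) *
        (2 * Real.pi ^ 2 * m ^ 2 + 23 * Real.pi * m) - 1 ≤
    ∑ n ∈ Finset.range (m * k + 1),
      vonMangoldt n * (Real.sin (2 * Real.pi / k * n) / Real.log n) := by
  set θ : ℝ := 2 * Real.pi / k with hθdef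
  set Y : ℝ := ((m * k : ℕ) : ℝ) with hYdef
  have hkr : (3 * 10 ^ 13 : ℝ) ≤ k := by exact_mod_cast hk
  have hk0 : (0 : ℝ) < k := by linarith
  have hm1 : (1 : ℝ) ≤ m := by exact_mod_cast hm
  have hYe : Y = m * k := by rw [hYdef]; push_cast; ring
  have hYk : (k : ℝ) ≤ Y := by rw [hYe]; nlinarith
  have hY : 3 * 10 ^ 13 ≤ Y := hkr.trans hYk
  have hY2 : 2 ≤ Y := by linarith
  have hpi := Real.pi_pos
  have hpi3 := Real.pi_gt_three
  have hpi4 := Real.pi_lt_d2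
  have hθ : 0 < θ := by positivity
  have hθk : θ * k = 2 * Real.pi := by rw [hθdef]; field_simp
  have hθY : θ * Y = 2 * Real.pi * m := by rw [hYe]; linear_combination m * hθk
  have hθs : θ * 10 ^ 12 ≤ 1 := by nlinarith
  have hlY : 0 < Real.log Y := Real.log_pos (by linarith)
  have hS := le_sqrt_div_log hY
  set S := √Y / Real.log Y with hSdef
  have hsinY : Real.sin (θ * Y) = 0 := by
    rw [hθY, show 2 * Real.pi * m = (2 * m : ℕ) * Real.pi by push_cast; ring]
    exact Real.sin_nat_mul_pi _
  have hcosY : Real.cos (θ * Y) = 1 := by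
    rw [hθY, show 2 * Real.pi * m = (m : ℕ) * (2 * Real.pi) by ring]
    exact Real.cos_nat_mul_two_pi _
  have hfY : sinWeight θ Y = 0 := by simp [sinWeight, hsinY]
  have hb : ∀ x ∈ Icc 2 Y, |sinWeightDerivTwo θ x| * (√x / 4 + 4) ≤
      13 / 50 * S * (21 / 2 * θ) + 13 / 50 * S * θ ^ 2 * x := by
    intro x hx
    have hlx : 0 < Real.log x := Real.log_pos (by linarith [hx.1])
    have hx0 : 0 < x := by linarith [hx.1]
    calc _ ≤ (θ ^ 2 * x + 21 / 2 * θ) / Real.log x * (√x / 4 + 4) :=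
          mul_le_mul_of_nonneg_right (abs_sinWeightDerivTwo_le hθ.le hx.1) (by positivity)
      _ = (θ ^ 2 * x + 21 / 2 * θ) * ((√x / 4 + 4) / Real.log x) := by ring
      _ ≤ (θ ^ 2 * x + 21 / 2 * θ) * (13 / 50 * S) :=
          mul_le_mul_of_nonneg_left (sqrt_div_log_le hx.1 hx.2 hY) (by positivity)
      _ = _ := by ring
  have main := abs_sum_vonMangoldt_mul_sub_integral_le hα hW hY2
    (fun x hx => hasDerivAt_sinWeight θ (by linarith [hx.1]))
    (fun x hx => hasDerivAt_sinWeightDeriv θ (by linarith [hx.1]))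
    (continuousOn_sinWeightDerivTwo θ Y) hfY hb (by positivity) (by positivity)
  have hfl : ⌊Y⌋₊ = m * k := Nat.floor_natCast _
  rw [hfl] at main
  have e1 : ∑ n ∈ Finset.range (m * k + 1), vonMangoldt n * (sinWeight θ n / n) =
      ∑ n ∈ Finset.range (m * k + 1), vonMangoldt n * (Real.sin (θ * n) / Real.log n) := by
    refine Finset.sum_congr rfl fun n _ => ?_
    rcases Nat.eq_zero_or_pos n with rfl | hn
    · simp
    have : (n : ℝ) ≠ 0 := by positivity
    rw [sinWeight, mul_div_assoc, mul_div_cancel_left₀ _ this]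
  have e2 : ∫ x in (2 : ℝ)..Y, sinWeight θ x / x = ∫ x in (2 : ℝ)..Y, Real.sin (θ * x) / Real.log x := by
    refine intervalIntegral.integral_congr fun x hx => ?_
    rw [uIcc_of_le hY2] at hx
    have : x ≠ 0 := by linarith [hx.1]
    rw [sinWeight, mul_div_assoc, mul_div_cancel_left₀ _ this]
  rw [e1, e2] at main
  have h3 := integral_sin_div_log_ge hθ hY2
  obtain ⟨m', rfl⟩ : ∃ m', m = m' + 1 := ⟨m - 1, by omega⟩
  have h4 := integral_one_sub_cos_div_ge (k := (k : ℝ)) (by linarith) m'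
  rw [← hYe, ← hθdef] at h4
  set H := ∑ j ∈ Finset.range (m' + 1), 1 / ((j : ℝ) + 1)
  have hlY3 : 3 ≤ Real.log Y := by
    rw [Real.le_log_iff_exp_le (by linarith)]
    have := Real.exp_one_lt_d9
    calc Real.exp 3 = Real.exp 1 ^ 3 := by rw [← Real.exp_nat_mul]; norm_num
      _ ≤ 2.8 ^ 3 := pow_le_pow_left₀ (Real.exp_pos 1).le (by linarith) 3
      _ ≤ Y := le_trans (by norm_num) hY
  have h5 : H / (θ * Real.log Y ^ 2) - 1 / 2 ≤
      (∫ x in (2 : ℝ)..Y, (1 - Real.cos (θ * x)) / x) / (θ * Real.log Y ^ 2) := by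
    have hd : 0 < θ * Real.log Y ^ 2 := by positivity
    have : (H - 2 / k) / (θ * Real.log Y ^ 2) ≤
      (∫ x in (2 : ℝ)..Y, (1 - Real.cos (θ * x)) / x) / (θ * Real.log Y ^ 2) :=
        div_le_div_of_nonneg_right h4 hd.le
    have h6 : 2 / (k : ℝ) / (θ * Real.log Y ^ 2) ≤ 1 / 2 := by
      rw [div_div, div_le_iff₀ (by positivity)]
      have : (k : ℝ) * (θ * Real.log Y ^ 2) = 2 * Real.pi * Real.log Y ^ 2 := by rw [← hθk]; ring
      rw [this]
      nlinarith
    rw [sub_div] at this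
    linarith
  have h7 : |sinWeightDeriv θ Y| * (√Y / 4 + 4) ≤ 13 / 50 * S * (θ * Y) := by
    have : sinWeightDeriv θ Y = θ * Y / Real.log Y := by
      simp [sinWeightDeriv, hsinY, hcosY]
    rw [this, abs_of_nonneg (by positivity)]
    calc _ = θ * Y * ((√Y / 4 + 4) / Real.log Y) := by ring
      _ ≤ θ * Y * (13 / 50 * S) :=
          mul_le_mul_of_nonneg_left (sqrt_div_log_le hY2 le_rfl hY) (by positivity)
      _ = _ := by ring
  have hi := inv_log_le (le_refl (2 : ℝ))
  have hi0 : 0 < (Real.log 2)⁻¹ := inv_pos.2 (Real.log_pos (by norm_num))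
  have hs2 := abs_sin_mul_le hθ.le (show (0 : ℝ) ≤ 2 by norm_num)
  have hs2i : |Real.sin (θ * 2) * (Real.log 2)⁻¹| ≤ θ * 2 * (14428 / 10000) := by
    rw [abs_mul, abs_of_pos hi0]; exact mul_le_mul hs2 hi hi0.le (by positivity)
  have hs2j : |Real.sin (θ * 2) * (Real.log 2)⁻¹ ^ 2| ≤ θ * 2 * (14428 / 10000) ^ 2 := by
    rw [abs_mul, abs_of_pos (pow_pos hi0 2)]
    exact mul_le_mul hs2 (pow_le_pow_left₀ hi0.le hi 2) (by positivity) (by positivity)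
  have hc2i : |θ * 2 * Real.cos (θ * 2) * (Real.log 2)⁻¹| ≤ θ * 2 * (14428 / 10000) := by
    rw [abs_mul, abs_of_pos hi0, abs_mul, abs_of_pos (by positivity : 0 < θ * 2)]
    exact mul_le_mul (mul_le_of_le_one_right (by positivity) (Real.abs_cos_le_one _)) hi hi0.le
      (by positivity)
  have h8 : |sinWeightDeriv θ 2| ≤ 10 * θ := by
    have : sinWeightDeriv θ 2 = Real.sin (θ * 2) * (Real.log 2)⁻¹ +
        θ * 2 * Real.cos (θ * 2) * (Real.log 2)⁻¹ - Real.sin (θ * 2) * (Real.log 2)⁻¹ ^ 2 := by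
      simp only [sinWeightDeriv, div_eq_mul_inv, inv_pow]
    rw [this]
    rw [abs_le] at *
    constructor <;> linarith [hs2i.1, hs2i.2, hs2j.1, hs2j.2, hc2i.1, hc2i.2]
  have h9 : |sinWeight θ 2| ≤ 6 * θ := by
    have : sinWeight θ 2 = 2 * (Real.sin (θ * 2) * (Real.log 2)⁻¹) := by
      simp only [sinWeight, div_eq_mul_inv]; ring
    rw [this]
    rw [abs_le] at *
    constructor <;> linarith [hs2i.1, hs2i.2]
  have e3 : 13 / 50 * S * (21 / 2 * θ) * Y + 13 / 50 * S * θ ^ 2 * (Y ^ 2 / 2) +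
      13 / 50 * S * (θ * Y) = 13 / 50 * S * (2 * Real.pi ^ 2 * ((m' + 1 : ℕ) : ℝ) ^ 2 +
        23 * Real.pi * ((m' + 1 : ℕ) : ℝ)) := by
    linear_combination (13 / 50 * S * (23 / 2) + 13 / 50 * S * (θ * Y +
      2 * Real.pi * ((m' + 1 : ℕ) : ℝ)) / 2) * hθY
  have h10 := (abs_le.1 main).1
  linarith

end

section

open Complex Metric Filter Topology MeasureTheory Set Asymptotics ArithmeticFunction
open scoped BigOperators Nat ComplexConjugate

theorem sum_vonMangoldt_mul_le_sum_prime {g : ℕ → ℝ} (hg : ∀ n, |g n| ≤ 1) {N : ℕ} (hN : 1 ≤ N) :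
    ∑ n ∈ Finset.range (N + 1), vonMangoldt n * (g n / Real.log n) ≤
      (∑ p ∈ Finset.range (N + 1) with p.Prime, g p) + 3 / 2 * √(N : ℝ) * Real.log N := by
  have hN1 : (1 : ℝ) ≤ N := by exact_mod_cast hN
  rw [← Finset.sum_filter_add_sum_filter_not (Finset.range (N + 1)) (fun n => n.Prime)]
  have h1 : ∑ n ∈ Finset.range (N + 1) with n.Prime, vonMangoldt n * (g n / Real.log n) =
      ∑ p ∈ Finset.range (N + 1) with p.Prime, g p := by
    refine Finset.sum_congr rfl fun p hp => ?_
    have hp' := (Finset.mem_filter.1 hp).2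
    have : Real.log p ≠ 0 := (Real.log_pos (by exact_mod_cast hp'.one_lt)).ne'
    rw [vonMangoldt_apply_prime hp']; field_simp
  have hl4 : (1386 / 1000 : ℝ) ≤ Real.log 4 := by
    rw [show (4 : ℝ) = 2 ^ 2 by norm_num, Real.log_pow]; push_cast
    linarith [Real.log_two_gt_d9]
  have h2 : ∑ n ∈ Finset.range (N + 1) with ¬ n.Prime, vonMangoldt n * (g n / Real.log n) ≤
      1000 / 1386 * (Chebyshev.psi N - Chebyshev.theta N) := by
    rw [Chebyshev.psi_sub_theta_eq_sum_not_prime, Finset.mul_sum, Nat.floor_natCast]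
    have : Finset.filter (fun n => ¬ n.Prime) (Finset.Ioc 0 N) ⊆
        Finset.filter (fun n => ¬ n.Prime) (Finset.range (N + 1)) := by
      intro n hn
      simp only [Finset.mem_filter, Finset.mem_Ioc, Finset.mem_range] at hn ⊢
      exact ⟨by omega, hn.2⟩
    rw [← Finset.sum_subset this]
    · refine Finset.sum_le_sum fun n hn => ?_
      simp only [Finset.mem_filter, Finset.mem_Ioc] at hn
      by_cases h0 : vonMangoldt n = 0
      · simp [h0]
      have hn4 : 4 ≤ n := by
        by_contra hlt
        have : n = 1 ∨ n = 2 ∨ n = 3 := by omega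
        rcases this with rfl | rfl | rfl
        · simp at h0
        · exact hn.2 Nat.prime_two
        · exact hn.2 Nat.prime_three
      have hl : Real.log 4 ≤ Real.log n := Real.log_le_log (by norm_num) (by exact_mod_cast hn4)
      rw [mul_comm]
      refine mul_le_mul_of_nonneg_right ?_ vonMangoldt_nonneg
      rw [div_le_iff₀ (by linarith)]
      have := (abs_le.1 (hg n)).2
      linarith
    · intro n hn hn'
      simp only [Finset.mem_filter, Finset.mem_Ioc, Finset.mem_range] at hn hn'
      have : n = 0 := by
        by_contra h0
        exact hn' ⟨by omega, hn.2⟩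
      simp [this]
  have h3 := Chebyshev.psi_sub_theta_le hN1
  rw [h1]
  have h4 : 0 ≤ √(N : ℝ) * Real.log N := mul_nonneg (Real.sqrt_nonneg _) (Real.log_nonneg hN1)
  nlinarith

end

section

open Complex Metric Filter Topology MeasureTheory Set Asymptotics ArithmeticFunction
open scoped BigOperators Nat ComplexConjugate

theorem infinite_setOf_prime_not_dvd {k : ℕ} (hk : k ≠ 0) :
    {p : ℕ | p.Prime ∧ ¬ p ∣ k}.Infinite := by
  refine (Nat.infinite_setOfPred_prime.sdiff (k.primeFactors.finite_toSet)).mono ?_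
  rintro p ⟨hp, hpk⟩
  refine ⟨hp, fun h => hpk ?_⟩
  exact Nat.mem_primeFactors.2 ⟨hp, h, hk⟩

theorem sin_two_pi_div_mul_add {k : ℕ} (hk : k ≠ 0) (x : ℝ) (m : ℕ) :
    Real.sin (2 * Real.pi / k * (x + m * k)) = Real.sin (2 * Real.pi / k * x) := by
  have : (k : ℝ) ≠ 0 := by exact_mod_cast hk
  rw [show 2 * Real.pi / k * (x + m * k) = 2 * Real.pi / k * x + m * (2 * Real.pi) by field_simp]
  exact Real.sin_add_nat_mul_two_pi _ _

theorem sin_two_pi_div_mul_mod {k : ℕ} (hk : k ≠ 0) (n : ℕ) :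
    Real.sin (2 * Real.pi / k * ((n % k : ℕ) : ℝ)) = Real.sin (2 * Real.pi / k * n) := by
  have h : (n : ℝ) = ((n % k : ℕ) : ℝ) + ((n / k : ℕ) : ℝ) * k := by
    have := Nat.mod_add_div n k
    rw [mul_comm] at this
    exact_mod_cast this.symm
  conv_rhs => rw [h, sin_two_pi_div_mul_add hk]

theorem sin_two_pi_div_mul_nonneg {k : ℕ} (hk : k ≠ 0) {x : ℝ} (hx : 0 ≤ x) (hxk : 2 * x ≤ k) :
    0 ≤ Real.sin (2 * Real.pi / k * x) := by
  have hk' : (0 : ℝ) < k := by exact_mod_cast Nat.pos_of_ne_zero hk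
  refine Real.sin_nonneg_of_nonneg_of_le_pi (by positivity) ?_
  rw [show 2 * Real.pi / k * x = Real.pi * ((2 * x) / k) by ring]
  exact mul_le_of_le_one_right Real.pi_pos.le ((div_le_one hk').2 hxk)

theorem sum_coprime_sin_eq_zero {k : ℕ} (hk : 1 < k) :
    ∑ r ∈ Finset.range k with r.Coprime k, Real.sin (2 * Real.pi / k * r) = 0 := by
  have hk' : (k : ℝ) ≠ 0 := by positivity
  have h0 : ∀ r, r.Coprime k → r ≠ 0 := by
    rintro r hr rfl
    simp at hr; omega
  have key : ∑ r ∈ Finset.range k with r.Coprime k, Real.sin (2 * Real.pi / k * r) =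
      ∑ r ∈ Finset.range k with r.Coprime k, -Real.sin (2 * Real.pi / k * r) := by
    have hmem : ∀ r ∈ (Finset.range k).filter (fun r => r.Coprime k),
        k - r ∈ (Finset.range k).filter (fun r => r.Coprime k) := by
      intro r hr
      simp only [Finset.mem_filter, Finset.mem_range] at hr ⊢
      have := h0 r hr.2
      refine ⟨by omega, ?_⟩
      exact (Nat.coprime_self_sub_left hr.1.le).2 hr.2
    refine Finset.sum_bij' (fun r _ => k - r) (fun r _ => k - r) hmem hmem ?_ ?_ ?_
    · intro r hr
      have := Finset.mem_range.1 (Finset.mem_filter.1 hr).1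
      omega
    · intro r hr
      have := Finset.mem_range.1 (Finset.mem_filter.1 hr).1
      omega
    · intro r hr
      have := Finset.mem_range.1 (Finset.mem_filter.1 hr).1
      rw [Nat.cast_sub this.le, show 2 * Real.pi / k * ((k : ℝ) - r) =
        2 * Real.pi - 2 * Real.pi / k * r by field_simp, Real.sin_two_pi_sub, neg_neg]
  rw [Finset.sum_neg_distrib] at key
  linarith

theorem IsPInteger.sum_sin_eq_zero {k : ℕ} (h : IsPInteger k) :
    ∑ i ∈ Finset.range k.totient, Real.sin (2 * Real.pi / k * nthPrimeNotDvd k i) = 0 := by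
  obtain ⟨hk, hinj, himg⟩ := h
  have hk0 : k ≠ 0 := by omega
  rw [← sum_coprime_sin_eq_zero hk]
  have himg' : (Finset.range k.totient).image (fun i => nthPrimeNotDvd k i % k) =
      (Finset.range k).filter (fun r => r.Coprime k) := by
    apply Finset.coe_injective
    push_cast
    rw [himg]
    ext r; simp
  rw [← himg', Finset.sum_image (by simpa using hinj)]
  exact Finset.sum_congr rfl fun i _ => (sin_two_pi_div_mul_mod hk0 _).symm

theorem image_nthPrimeNotDvd {k : ℕ} (hk : k ≠ 0) {n : ℕ} (hn : n ≠ 0) :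
    (Finset.range n).image (nthPrimeNotDvd k) =
      (Finset.range (nthPrimeNotDvd k (n - 1) + 1)).filter (fun p => p.Prime ∧ ¬ p ∣ k) := by
  have hinf := infinite_setOf_prime_not_dvd hk
  classical
  ext p
  simp only [Finset.mem_image, Finset.mem_range, Finset.mem_filter, nthPrimeNotDvd]
  constructor
  · rintro ⟨i, hi, rfl⟩
    refine ⟨Nat.lt_succ_of_le ((Nat.nth_le_nth hinf).2 (by omega)), Nat.nth_mem_of_infinite hinf i⟩
  · rintro ⟨hp, hp'⟩
    refine ⟨Nat.count (fun p => p.Prime ∧ ¬ p ∣ k) p, ?_, Nat.nth_count hp'⟩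
    have : Nat.nth (fun p => p.Prime ∧ ¬ p ∣ k) (Nat.count (fun p => p.Prime ∧ ¬ p ∣ k) p) ≤
        Nat.nth (fun p => p.Prime ∧ ¬ p ∣ k) (n - 1) := by
      rw [Nat.nth_count hp']; omega
    have := (Nat.nth_le_nth hinf).1 this
    omega

theorem injective_nthPrimeNotDvd {k : ℕ} (hk : k ≠ 0) :
    Function.Injective (nthPrimeNotDvd k) :=
  Nat.nth_injective (infinite_setOf_prime_not_dvd hk)

theorem totient_add_card_primeFactors_le {k : ℕ} (hk : 1 < k) :
    k.totient + k.primeFactors.card ≤ k := by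
  have hd : Disjoint ((Finset.range k).filter (fun r => k.Coprime r)) k.primeFactors := by
    rw [Finset.disjoint_left]
    intro p hp hp'
    have h1 := (Finset.mem_filter.1 hp).2
    obtain ⟨h2, h3, _⟩ := Nat.mem_primeFactors.1 hp'
    exact (h2.coprime_iff_not_dvd.1 h1.symm) h3
  rw [Nat.totient_eq_card_coprime, ← Finset.card_union_of_disjoint hd]
  calc _ ≤ (Finset.Icc 1 k).card := by
        refine Finset.card_le_card ?_
        intro r hr
        rw [Finset.mem_Icc]
        rcases Finset.mem_union.1 hr with hr | hr
        · obtain ⟨h1, h2⟩ := Finset.mem_filter.1 hr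
          refine ⟨Nat.pos_of_ne_zero ?_, (Finset.mem_range.1 h1).le⟩
          rintro rfl
          simp at h2; omega
        · exact ⟨(Nat.prime_of_mem_primeFactors hr).pos, Nat.le_of_mem_primeFactors hr⟩
    _ = k := by simp

theorem card_primeFactors_le_sqrt {k : ℕ} (hk : 9 ≤ k) : (k.primeFactors.card : ℝ) ≤ √(k : ℝ) := by
  have h2 : 2 ^ k.primeFactors.card ≤ k := by
    calc 2 ^ k.primeFactors.card ≤ ∏ p ∈ k.primeFactors, p :=
          Finset.pow_card_le_prod _ _ _ fun p hp => (Nat.prime_of_mem_primeFactors hp).two_le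
      _ ≤ k := Nat.le_of_dvd (by omega) (Nat.prod_primeFactors_dvd k)
  apply Real.le_sqrt_of_sq_le
  generalize k.primeFactors.card = w at *
  have : w ^ 2 ≤ k := by
    by_cases hw : w ≤ 3
    · nlinarith
    · push Not at hw
      refine le_trans ?_ h2
      clear h2
      induction w, hw using Nat.le_induction with
      | base => norm_num
      | succ n hn ih => rw [pow_succ 2]; nlinarith
  exact_mod_cast this

theorem sum_prime_eq_sum_add_sum (k N : ℕ) (hk : k ≠ 0) (f : ℕ → ℝ) :
    ∑ p ∈ Finset.range N with p.Prime, f p =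
      (∑ p ∈ Finset.range N with (p.Prime ∧ ¬ p ∣ k), f p) +
        ∑ p ∈ k.primeFactors with p < N, f p := by
  rw [← Finset.sum_filter_add_sum_filter_not ((Finset.range N).filter Nat.Prime) (fun p => ¬ p ∣ k),
    Finset.filter_filter, Finset.filter_filter]
  congr 2
  ext p
  simp only [Finset.mem_filter, Finset.mem_range, Nat.mem_primeFactors]
  tauto

theorem IsPInteger.exists_sum_sin_le {k : ℕ} (h : IsPInteger k) :
    ∃ X m : ℕ, 1 ≤ m ∧ (2 * m - 1) * k ≤ 2 * X ∧ 2 * X < (2 * m + 1) * k ∧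
      Nat.primeCounting X ≤ k ∧
      ∑ p ∈ Finset.range (m * k + 1) with p.Prime, Real.sin (2 * Real.pi / k * p) ≤
        k.primeFactors.card := by
  have hk1 := h.1
  have hk0 : k ≠ 0 := by omega
  have hφ : k.totient ≠ 0 := (Nat.totient_pos.2 (by omega)).ne'
  set X := nthPrimeNotDvd k (k.totient - 1) with hX
  have himg := image_nthPrimeNotDvd hk0 hφ
  rw [← hX] at himg
  have hinj := injective_nthPrimeNotDvd hk0
  have hsum : ∑ p ∈ Finset.range (X + 1) with (p.Prime ∧ ¬ p ∣ k),
      Real.sin (2 * Real.pi / k * p) = 0 := by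
    rw [← himg, Finset.sum_image hinj.injOn, h.sum_sin_eq_zero]
  have hcard : ((Finset.range (X + 1)).filter (fun p => p.Prime ∧ ¬ p ∣ k)).card = k.totient := by
    rw [← himg, Finset.card_image_of_injective _ hinj, Finset.card_range]
  have hpi : Nat.primeCounting X ≤ k := by
    refine le_trans ?_ (totient_add_card_primeFactors_le hk1)
    have := sum_prime_eq_sum_add_sum k (X + 1) hk0 (fun _ => 1)
    simp only [Finset.sum_const, nsmul_eq_mul, mul_one] at this
    have h2 : ((Finset.range (X + 1)).filter Nat.Prime).card =
        ((Finset.range (X + 1)).filter (fun p => p.Prime ∧ ¬ p ∣ k)).card +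
        (k.primeFactors.filter (fun p => p < X + 1)).card := by exact_mod_cast this
    rw [Nat.primeCounting, Nat.primeCounting', Nat.count_eq_card_filter_range, h2, hcard]
    exact Nat.add_le_add_left (Finset.card_filter_le _ _) _
  have hkpos : (0 : ℝ) < k := by exact_mod_cast Nat.pos_of_ne_zero hk0
  obtain ⟨m, hm1, hm2⟩ : ∃ m : ℕ, 2 * m * k ≤ 2 * X + k ∧ 2 * X + k < 2 * (m + 1) * k := by
    refine ⟨(2 * X + k) / (2 * k), ?_, ?_⟩
    · have := Nat.div_mul_le_self (2 * X + k) (2 * k)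
      linarith
    · have := Nat.lt_div_mul_add (a := 2 * X + k) (b := 2 * k) (by omega)
      linarith
  have hm0 : m ≠ 0 := by
    rintro rfl
    have hpos : 0 < ∑ p ∈ Finset.range (X + 1) with (p.Prime ∧ ¬ p ∣ k),
        Real.sin (2 * Real.pi / k * p) := by
      refine Finset.sum_pos ?_ (Finset.card_pos.1 (by rw [hcard]; omega))
      intro p hp
      simp only [Finset.mem_filter, Finset.mem_range] at hp
      have hp0 : (0 : ℝ) < p := by exact_mod_cast hp.2.1.pos
      have hpk : 2 * (p : ℝ) < k := by
        have : 2 * p < k := by omega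
        exact_mod_cast this
      refine Real.sin_pos_of_pos_of_lt_pi (by have := Real.pi_pos; positivity) ?_
      rw [show 2 * Real.pi / k * p = Real.pi * ((2 * p) / k) by ring]
      exact mul_lt_of_lt_one_right Real.pi_pos ((div_lt_one hkpos).2 hpk)
    linarith
  refine ⟨X, m, by omega, ?_, by linarith, hpi, ?_⟩
  · obtain ⟨j, rfl⟩ := Nat.exists_eq_succ_of_ne_zero hm0
    simp only [Nat.succ_eq_add_one] at *
    rw [show 2 * (j + 1) - 1 = 2 * j + 1 by omega]
    linarith
  have hprime : ∑ p ∈ k.primeFactors with p < m * k + 1, Real.sin (2 * Real.pi / k * p) ≤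
      k.primeFactors.card := by
    calc _ ≤ ∑ p ∈ k.primeFactors with p < m * k + 1, (1 : ℝ) :=
          Finset.sum_le_sum fun p _ => Real.sin_le_one _
      _ ≤ _ := by
          rw [Finset.sum_const, nsmul_eq_mul, mul_one]
          exact_mod_cast Finset.card_filter_le _ _
  rw [sum_prime_eq_sum_add_sum k _ hk0]
  suffices ∑ p ∈ Finset.range (m * k + 1) with (p.Prime ∧ ¬ p ∣ k),
      Real.sin (2 * Real.pi / k * p) ≤ 0 by linarith
  have hm1' : 2 * (m : ℝ) * k ≤ 2 * X + k := by exact_mod_cast hm1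
  have hm2' : 2 * (X : ℝ) + k < 2 * (m + 1) * k := by exact_mod_cast hm2
  rw [← hsum]
  rcases le_total X (m * k) with hle | hle
  · rw [← Finset.sum_sdiff (Finset.filter_subset_filter (fun p => p.Prime ∧ ¬ p ∣ k)
      (Finset.range_mono (Nat.succ_le_succ hle)))]
    refine add_le_of_nonpos_left (Finset.sum_nonpos fun p hp => ?_)
    simp only [Finset.mem_sdiff, Finset.mem_filter, Finset.mem_range] at hp
    have h1 : (p : ℝ) ≤ m * k := by exact_mod_cast Nat.lt_succ_iff.1 hp.1.1
    have h2 : (X : ℝ) ≤ p := by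
      have : X ≤ p := by
        by_contra hc
        exact hp.2 ⟨by omega, hp.1.2⟩
      exact_mod_cast this
    have := sin_two_pi_div_mul_nonneg hk0 (x := m * k - p) (by linarith) (by linarith)
    have h3 := sin_two_pi_div_mul_add hk0 (-(p : ℝ)) m
    rw [mul_neg, Real.sin_neg, neg_add_eq_sub] at h3
    linarith
  · rw [← Finset.sum_sdiff (Finset.filter_subset_filter (fun p => p.Prime ∧ ¬ p ∣ k)
      (Finset.range_mono (Nat.succ_le_succ hle)))]
    refine le_add_of_nonneg_left (Finset.sum_nonneg fun p hp => ?_)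
    simp only [Finset.mem_sdiff, Finset.mem_filter, Finset.mem_range] at hp
    have h1 : (p : ℝ) ≤ X := by exact_mod_cast Nat.lt_succ_iff.1 hp.1.1
    have h2 : (m * k : ℝ) ≤ p := by
      have : m * k ≤ p := by
        by_contra hc
        exact hp.2 ⟨by omega, hp.1.2⟩
      exact_mod_cast this
    have := sin_two_pi_div_mul_nonneg hk0 (x := p - m * k) (by linarith) (by linarith)
    have h3 := sin_two_pi_div_mul_add hk0 ((p : ℝ) - m * k) m
    rw [sub_add_cancel] at h3
    rw [h3]; exact this

end

section

open Complex Metric Filter Topology MeasureTheory Set Asymptotics ArithmeticFunction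
open scoped BigOperators Nat ComplexConjugate

theorem lt_log_of_le {k : ℝ} (hk : 3 * 10 ^ 13 ≤ k) : 30.49 < Real.log k := by
  have h1 := lt_log_three_mul_ten_pow
  have h2 : Real.log (3 * 10 ^ 13) ≤ Real.log k := Real.log_le_log (by positivity) hk
  generalize Real.log (3 * 10 ^ 13) = a at *
  norm_num at *
  linarith

theorem log_pow_seven_le {k : ℝ} (hk : 3 * 10 ^ 13 ≤ k) : 900 * Real.log k ^ 7 ≤ k := by
  have h1 := lt_log_three_mul_ten_pow
  have h2 := log_three_mul_ten_pow_lt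
  have h3 : Real.log (3 * 10 ^ 13) ≤ Real.log k := Real.log_le_log (by positivity) hk
  have h4 : Real.exp (Real.log (3 * 10 ^ 13)) = 3 * 10 ^ 13 := Real.exp_log (by positivity)
  have h5 : Real.exp (Real.log k) = k := Real.exp_log (by linarith [show (0 : ℝ) < 3 * 10 ^ 13 by norm_num])
  generalize Real.log (3 * 10 ^ 13) = a at *
  generalize Real.log k = L at *
  have h6 : L ≤ a * Real.exp ((L - a) / 7) := by
    have := Real.add_one_le_exp ((L - a) / 7)
    nlinarith
  have h7 : L ^ 7 ≤ a ^ 7 * Real.exp (L - a) := by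
    calc L ^ 7 ≤ (a * Real.exp ((L - a) / 7)) ^ 7 := pow_le_pow_left₀ (by linarith) h6 7
      _ = _ := by
        rw [mul_pow, ← Real.exp_nat_mul]; congr 2; push_cast; ring
  have h8 : 900 * a ^ 7 ≤ 3 * 10 ^ 13 := by
    have := pow_le_pow_left₀ (by linarith) h2.le 7
    norm_num at this ⊢
    linarith
  calc 900 * L ^ 7 ≤ (900 * a ^ 7) * Real.exp (L - a) := by linarith
    _ ≤ (3 * 10 ^ 13) * Real.exp (L - a) := by gcongr
    _ = k := by rw [← h4, ← Real.exp_add, ← h5]; congr 1; ring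

theorem log_le_div_forty_add {x : ℝ} (hx : 0 < x) : Real.log x ≤ x / 40 + 2.716 := by
  have h1 := Real.log_le_sub_one_of_pos (show 0 < x / 40 by positivity)
  have h2 : Real.log (x / 40) = Real.log x - Real.log 40 := Real.log_div hx.ne' (by norm_num)
  have h3 : Real.log 40 ≤ 3.716 := by
    rw [show (40 : ℝ) = 2 ^ 5 * (5 / 4) by norm_num, Real.log_mul (by norm_num) (by norm_num),
      Real.log_pow]
    have := Real.log_le_sub_one_of_pos (show (0 : ℝ) < 5 / 4 by norm_num)
    have := Real.log_two_lt_d9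
    norm_num at *
    linarith
  linarith

theorem le_log_of_primeCounting_le {α : ℝ}
    (hW : ∀ x : ℝ, 1 < x → |∑ n ∈ Finset.range (⌊x⌋₊ + 1), vonMangoldt n * (x / n - 1) -
      x * Real.log x - α * x| ≤ √x / 4 + 4)
    {k m X : ℕ} (hk : 3 * 10 ^ 13 ≤ k) (hm : 1 ≤ m) (h1 : (2 * m - 1) * k ≤ 2 * X)
    (h2 : 2 * X < (2 * m + 1) * k) (hX : Nat.primeCounting X ≤ k) :
    (m : ℝ) ≤ 1.28 * Real.log k := by
  have hk' : (3 * 10 ^ 13 : ℝ) ≤ k := by exact_mod_cast hk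
  have hL := lt_log_of_le hk'
  have hm' : (1 : ℝ) ≤ m := by exact_mod_cast hm
  have h1' : (2 * (m : ℝ) - 1) * k ≤ 2 * X := by
    have : (((2 * m - 1) * k : ℕ) : ℝ) ≤ (2 * X : ℕ) := by exact_mod_cast h1
    rw [Nat.cast_mul, Nat.cast_sub (by omega)] at this
    push_cast at this
    exact this
  have h2' : 2 * (X : ℝ) < (2 * m + 1) * k := by exact_mod_cast h2
  have hXk : (k : ℝ) ≤ 2 * X := by nlinarith
  have hX13 : (10 ^ 13 : ℝ) ≤ X := by linarith
  have hX0 : (0 : ℝ) < X := by linarith [show (0 : ℝ) < 10 ^ 13 by norm_num]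
  have hkpos : (0 : ℝ) < k := by linarith [show (0 : ℝ) < 3 * 10 ^ 13 by norm_num]
  have hpsi := le_sum_vonMangoldt hW (x := X) (by linarith [show (2 : ℝ) < 10 ^ 13 by norm_num])
  have hpsi2 := Chebyshev.psi_le_primeCounting_mul_log' (X : ℝ)
  rw [Nat.floor_natCast] at hpsi2
  have hlogX : Real.log X ≤ Real.log k + ((m + 1 / 2) / 40 + 2.716) := by
    calc Real.log X ≤ Real.log ((m + 1 / 2) * k) := Real.log_le_log hX0 (by linarith)
      _ = Real.log k + Real.log (m + 1 / 2) := by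
        rw [Real.log_mul (by positivity) hkpos.ne', add_comm]
      _ ≤ _ := by gcongr; exact log_le_div_forty_add (by positivity)
  have hlogX0 : 0 ≤ Real.log X := Real.log_nonneg (by linarith [show (1 : ℝ) < 10 ^ 13 by norm_num])
  have hpiX : (Nat.primeCounting X : ℝ) * Real.log X ≤ k * Real.log X := by
    gcongr
  have hsq : (10 ^ 6 : ℝ) ≤ √(X : ℝ) := by
    apply Real.le_sqrt_of_sq_le
    norm_num at *
    linarith
  have hss : √(X : ℝ) * √(X : ℝ) = X := Real.mul_self_sqrt hX0.le
  have h9 : 0.9 * (X : ℝ) ≤ k * Real.log X := by nlinarith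
  have h10 : 0.9 * (X : ℝ) ≤ k * (Real.log k + ((m + 1 / 2) / 40 + 2.716)) := by
    refine h9.trans ?_
    gcongr
  have h11 : k * (0.9 * (m - 1 / 2)) ≤ k * (Real.log k + (((m : ℝ) + 1 / 2) / 40 + 2.716)) := by
    linarith
  have h12 := le_of_mul_le_mul_left h11 hkpos
  norm_num at *
  linarith

theorem main_term_bound {s q r l L M H : ℝ} (hL : 30.49 < L) (hq : 0 ≤ q) (hqL : q ^ 2 = L)
    (hs : 30 * L ^ 3 * q ≤ s) (hM : 1 ≤ M) (hML : M ≤ 1.28 * L) (hr : 0 ≤ r) (hrM : r ^ 2 = M)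
    (hl : 0 < l) (hlL : l ≤ 1.122 * L) (hH : 1 ≤ H) (hH' : M ≤ 20 ∨ 3.6 ≤ H) :
    2 * Real.pi * r * (13 / 50 * l * (2 * Real.pi ^ 2 * M ^ 2 + 23 * Real.pi * M) +
      3 / 2 * l ^ 3 + 2 * l ^ 2) < s * H := by
  have hpi := Real.pi_lt_d4
  have hpi0 := Real.pi_pos
  have hpi2 : Real.pi ^ 2 ≤ 9.8698 := by nlinarith
  have hL0 : 0 < L := by linarith
  have hl2 : l ^ 2 ≤ 1.259 * L ^ 2 := by
    have := pow_le_pow_left₀ hl.le hlL 2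
    norm_num at *; nlinarith
  have hl3 : l ^ 3 ≤ 1.4125 * L ^ 3 := by
    have h := pow_le_pow_left₀ hl.le hlL 3
    have : 0 < L ^ 3 := by positivity
    norm_num at *; nlinarith
  have hL23 : 30.49 * L ^ 2 ≤ L ^ 3 := by nlinarith [sq_nonneg L]
  have hL13 : 929.6 * L ≤ L ^ 3 := by nlinarith [sq_nonneg L]
  have hB : 13 / 50 * l * (2 * Real.pi ^ 2 * M ^ 2 + 23 * Real.pi * M) +
      3 / 2 * l ^ 3 + 2 * l ^ 2 ≤ L * (5.761 * M ^ 2 + 21.09 * M) + 2.202 * L ^ 3 := by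
    have h1 : 13 / 50 * l * (2 * Real.pi ^ 2 * M ^ 2 + 23 * Real.pi * M) ≤
        13 / 50 * (1.122 * L) * (2 * 9.8698 * M ^ 2 + 23 * 3.1416 * M) := by gcongr
    have : 0 < L * M := by positivity
    have : 0 < L * M ^ 2 := by positivity
    norm_num at *
    nlinarith
  have hq0 : 5.52 ≤ q := by
    by_contra hc
    push Not at hc
    norm_num at *
    nlinarith
  have hL3 : 0 < L ^ 3 := by positivity
  rcases hH' with h20 | hH36
  · have hr5 : r ≤ 4.4722 := by
      by_contra hc
      push Not at hc
      norm_num at *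
      nlinarith
    have hB2 : L * (5.761 * M ^ 2 + 21.09 * M) + 2.202 * L ^ 3 ≤ 5.14 * L ^ 3 := by
      have : 5.761 * M ^ 2 + 21.09 * M ≤ 5.761 * 20 ^ 2 + 21.09 * 20 := by gcongr
      have := mul_le_mul_of_nonneg_left this hL0.le
      norm_num at *
      nlinarith
    calc _ ≤ 2 * 3.1416 * 4.4722 * (5.14 * L ^ 3) := by
          refine mul_le_mul (by gcongr) (hB.trans hB2) (by positivity) (by positivity)
      _ < 30 * L ^ 3 * 5.52 := by norm_num; linarith
      _ ≤ 30 * L ^ 3 * q := by gcongr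
      _ ≤ s := hs
      _ ≤ s * H := le_mul_of_one_le_right (le_trans (by positivity) hs) hH
  · have hrq : r ≤ 1.132 * q := by
      apply le_of_sq_le_sq _ (by positivity)
      rw [mul_pow, hrM, hqL]; norm_num at *; linarith
    have hB2 : L * (5.761 * M ^ 2 + 21.09 * M) + 2.202 * L ^ 3 ≤ 12.6 * L ^ 3 := by
      have : 5.761 * M ^ 2 + 21.09 * M ≤ 5.761 * (1.28 * L) ^ 2 + 21.09 * (1.28 * L) := by gcongr
      have := mul_le_mul_of_nonneg_left this hL0.le
      norm_num at *
      nlinarith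
    have hqpos : 0 < L ^ 3 * q := by positivity
    calc _ ≤ 2 * 3.1416 * (1.132 * q) * (12.6 * L ^ 3) := by
          refine mul_le_mul (by gcongr) (hB.trans hB2) (by positivity) (by positivity)
      _ < 30 * L ^ 3 * q * 3.6 := by norm_num; nlinarith
      _ ≤ s * 3.6 := by gcongr
      _ ≤ s * H := by gcongr; exact le_trans (by positivity) hs

theorem one_le_sum_range_inv {m : ℕ} (hm : 1 ≤ m) :
    1 ≤ ∑ j ∈ Finset.range m, 1 / ((j : ℝ) + 1) := by
  calc (1 : ℝ) = ∑ j ∈ Finset.range 1, 1 / ((j : ℝ) + 1) := by simp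
    _ ≤ _ := Finset.sum_le_sum_of_subset_of_nonneg (Finset.range_mono hm)
      fun _ _ _ => by positivity

theorem le_sum_range_inv_of_le {m : ℕ} (hm : 21 ≤ m) :
    3.6 ≤ ∑ j ∈ Finset.range m, 1 / ((j : ℝ) + 1) := by
  calc (3.6 : ℝ) ≤ ∑ j ∈ Finset.range 21, 1 / ((j : ℝ) + 1) := by
        simp only [Finset.sum_range_succ, Finset.sum_range_zero]; norm_num
    _ ≤ _ := Finset.sum_le_sum_of_subset_of_nonneg (Finset.range_mono hm)
      fun _ _ _ => by positivity

theorem sqrt_mul_log_lt {k m : ℕ} (hk : 3 * 10 ^ 13 ≤ k) (hm : 1 ≤ m)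
    (hmk : (m : ℝ) ≤ 1.28 * Real.log k) :
    3 / 2 * √((m * k : ℕ) : ℝ) * Real.log ((m * k : ℕ) : ℝ) + √(k : ℝ) <
      (∑ j ∈ Finset.range m, 1 / ((j : ℝ) + 1)) /
        (2 * Real.pi / k * Real.log ((m * k : ℕ) : ℝ) ^ 2) -
        13 / 50 * (√((m * k : ℕ) : ℝ) / Real.log ((m * k : ℕ) : ℝ)) *
          (2 * Real.pi ^ 2 * m ^ 2 + 23 * Real.pi * m) - 1 := by
  have hk' : (3 * 10 ^ 13 : ℝ) ≤ k := by exact_mod_cast hk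
  have hkpos : (0 : ℝ) < k := by linarith [show (0 : ℝ) < 3 * 10 ^ 13 by norm_num]
  have hm' : (1 : ℝ) ≤ m := by exact_mod_cast hm
  have hL := lt_log_of_le hk'
  have h7 := log_pow_seven_le hk'
  have hlogm := log_le_div_forty_add (show (0 : ℝ) < m by linarith)
  have hlogm0 := Real.log_nonneg hm'
  have hl : Real.log ((m * k : ℕ) : ℝ) = Real.log m + Real.log k := by
    push_cast
    exact Real.log_mul (by positivity) hkpos.ne'
  have hsq : √((m * k : ℕ) : ℝ) = √(m : ℝ) * √(k : ℝ) := by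
    push_cast
    exact Real.sqrt_mul (by positivity) _
  have hH := one_le_sum_range_inv hm
  have hH' : (m : ℝ) ≤ 20 ∨ 3.6 ≤ ∑ j ∈ Finset.range m, 1 / ((j : ℝ) + 1) := by
    rcases le_or_gt m 20 with h | h
    · exact Or.inl (by exact_mod_cast h)
    · exact Or.inr (le_sum_range_inv_of_le h)
  have hss : √(k : ℝ) ^ 2 = k := Real.sq_sqrt hkpos.le
  have hs1 : 1 ≤ √(k : ℝ) := Real.one_le_sqrt.2 (by linarith [show (1 : ℝ) < 3 * 10 ^ 13 by norm_num])
  have hr1 : 1 ≤ √(m : ℝ) := Real.one_le_sqrt.2 hm'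
  rw [hsq, hl]
  generalize Real.log k = L at *
  have hq2 : √L ^ 2 = L := Real.sq_sqrt (by linarith)
  have hs : 30 * L ^ 3 * √L ≤ √(k : ℝ) := by
    apply Real.le_sqrt_of_sq_le
    calc _ = 900 * L ^ 6 * √L ^ 2 := by ring
      _ = 900 * L ^ 7 := by rw [hq2]; ring
      _ ≤ _ := h7
  have key := main_term_bound (r := √(m : ℝ)) (l := Real.log m + L) hL (Real.sqrt_nonneg L) hq2 hs
    hm' hmk (by positivity) (Real.sq_sqrt (by positivity)) (by linarith)
    (by norm_num at *; linarith) hH hH'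
  generalize (∑ j ∈ Finset.range m, 1 / ((j : ℝ) + 1)) = H at *
  have hl0 : 0 < Real.log m + L := by linarith
  generalize Real.log m + L = l at *
  generalize √(m : ℝ) = r at *
  have hpi := Real.pi_pos
  have hs0 : 0 < √(k : ℝ) := by linarith
  generalize √(k : ℝ) = s at *
  have e1 : H / (2 * Real.pi / k * l ^ 2) = s * (s * H) / (2 * Real.pi * l ^ 2) := by
    rw [← hss]; field_simp
  have e2 : s * (2 * Real.pi * r * (13 / 50 * l * (2 * Real.pi ^ 2 * m ^ 2 + 23 * Real.pi * m) +
      3 / 2 * l ^ 3 + 2 * l ^ 2)) / (2 * Real.pi * l ^ 2) =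
      13 / 50 * (r * s / l) * (2 * Real.pi ^ 2 * m ^ 2 + 23 * Real.pi * m) +
      3 / 2 * (r * s) * l + 2 * (r * s) := by
    field_simp
  have e3 : s * (2 * Real.pi * r * (13 / 50 * l * (2 * Real.pi ^ 2 * m ^ 2 + 23 * Real.pi * m) +
      3 / 2 * l ^ 3 + 2 * l ^ 2)) / (2 * Real.pi * l ^ 2) < s * (s * H) / (2 * Real.pi * l ^ 2) := by
    gcongr
  rw [e1]
  rw [e2] at e3
  nlinarith

end

theorem no_large_PInteger_of_RH (hRH : RiemannHypothesis) (k : ℕ)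
    (hk : 3 * 10 ^ 13 ≤ k) : ¬ IsPInteger k := by
  intro hP
  obtain ⟨α, hα, hW⟩ := abs_sum_vonMangoldt_mul_sub_le hRH
  obtain ⟨X, m, hm, h1, h2, hX, hsum⟩ := hP.exists_sum_sin_le
  have hmk := le_log_of_primeCounting_le hW hk hm h1 h2 hX
  have hN : 1 ≤ m * k := Nat.one_le_iff_ne_zero.2 (by positivity)
  have hlow := sum_vonMangoldt_mul_sin_ge hα hW hk hm
  have hup := sum_vonMangoldt_mul_le_sum_prime
    (g := fun n => Real.sin (2 * Real.pi / k * n)) (fun n => Real.abs_sin_le_one _) hN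
  have hfin := sqrt_mul_log_lt hk hm hmk
  have hω := card_primeFactors_le_sqrt (k := k) (by omega)
  linarith
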